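/- Fix integers m ≥ 1, n ≥ 2, k ≥ 1, N ≥ 1, and distinct points x̂₁, …, x̂_N ∈ ℂⁿ. For each i = 1, …, N let y_i : ℂ^m → ℂⁿ be holomorphic with y_i(w) ≠ y_j(w) for all w ∈ ℂ^m whenever i ≠ j, and for each 1 ≤ j ≤ k let w ↦ A_{i,j}(w) be a holomorphic family of symmetric continuous j-multilinear maps (ℂⁿ)^j → ℂⁿ (holomorphic meaning that w ↦ A_{i,j}(w)(v₁,…,v_j) is holomorphic for every fixed tuple of vectors), such that A_{i,1}(w) : ℂⁿ → ℂⁿ is an invertible linear map for every w. Then there exists a holomorphic map F : ℂ^m × ℂⁿ → ℂⁿ such that for every w ∈ ℂ^m the map F(w, ·) is a holomorphic automorphism of ℂⁿ, and for all i = 1, …, N and all w ∈ ℂ^m one has F(w, x̂_i) = y_i(w) and the j-th iterated Fréchet derivative of z ↦ F(w, z) at x̂_i equals A_{i,j}(w) for every 1 ≤ j ≤ k. -/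

import Mathlib

open Set Filter Topology Metric

section EntireMaps

variable {E F : Type*} [NormedAddCommGroup E] [NormedSpace ℂ E]
  [NormedAddCommGroup F] [NormedSpace ℂ F]

/-- Cauchy estimate for the Fréchet derivative of an entire map. -/
theorem norm_fderiv_le_of_entire {f : E → F} (hf : Differentiable ℂ f) {x : E} {r C : ℝ}
    (hr : 0 < r) (hC : ∀ z ∈ closedBall x r, ‖f z‖ ≤ C) : ‖fderiv ℂ f x‖ ≤ C / r := by
  have hC0 : 0 ≤ C := (norm_nonneg _).trans (hC x (mem_closedBall_self hr.le))
  refine ContinuousLinearMap.opNorm_le_bound _ (by positivity) fun v => ?_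
  rcases eq_or_ne v 0 with rfl | hv
  · simp
  have hv' : 0 < ‖v‖ := norm_pos_iff.mpr hv
  have hg : Differentiable ℂ (fun t : ℂ => f (x + t • v)) := by fun_prop
  have hd : deriv (fun t : ℂ => f (x + t • v)) 0 = fderiv ℂ f x v := by
    have h1 : HasDerivAt (fun t : ℂ => x + t • v) v 0 := by
      simpa using ((hasDerivAt_id (0 : ℂ)).smul_const v).const_add x
    have h2 : HasFDerivAt f (fderiv ℂ f x) (x + (0 : ℂ) • v) := by
      simpa using (hf x).hasFDerivAt
    exact (h2.comp_hasDerivAt (0 : ℂ) h1).deriv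
  have hb := Complex.norm_deriv_le_of_forall_mem_sphere_norm_le (c := 0) (R := r / ‖v‖) (C := C)
    (by positivity) hg.diffContOnCl (fun z hz => hC _ (by
      have hz' : ‖z‖ = r / ‖v‖ := by simpa using hz
      rw [mem_closedBall, dist_eq_norm, add_sub_cancel_left, norm_smul, hz']
      field_simp
      exact le_rfl))
  rw [hd] at hb
  calc _ ≤ _ := hb
    _ = _ := by field_simp

theorem norm_sub_le_of_entire {f : E → F} (hf : Differentiable ℂ f) {c : E} {R C : ℝ}
    (hC : ∀ z ∈ closedBall c (R + 1), ‖f z‖ ≤ C) {x y : E} (hx : x ∈ closedBall c R)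
    (hy : y ∈ closedBall c R) : ‖f x - f y‖ ≤ C * ‖x - y‖ := by
  let : NormedSpace ℝ E := NormedSpace.restrictScalars ℝ ℂ E
  refine (convex_closedBall c R).norm_image_sub_le_of_norm_fderiv_le (𝕜 := ℂ)
    (fun z _ => hf z) (fun z hz => ?_) hy hx
  have := norm_fderiv_le_of_entire hf (x := z) (r := 1) (C := C) one_pos (fun u hu => hC u ?_)
  · simpa using this
  · exact closedBall_subset_closedBall' (by
      have := mem_closedBall.mp hz; linarith) hu

theorem norm_fderiv_le_of_entire_closedBall {f : E → F} (hf : Differentiable ℂ f) {c : E} {R C : ℝ}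
    (hC : ∀ z ∈ closedBall c (R + 1), ‖f z‖ ≤ C) {x : E} (hx : x ∈ closedBall c R) :
    ‖fderiv ℂ f x‖ ≤ C := by
  have := norm_fderiv_le_of_entire hf (x := x) (r := 1) (C := C) one_pos (fun u hu => hC u ?_)
  · simpa using this
  · exact closedBall_subset_closedBall' (by
      have := mem_closedBall.mp hx; linarith) hu

/-- A limit of entire maps, uniform on all balls, is entire. -/
theorem differentiable_of_tendstoUniformlyOn_closedBall [CompleteSpace F] {f : ℕ → E → F} {g : E → F}
    (hf : ∀ i, Differentiable ℂ (f i))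
    (h : ∀ R : ℝ, TendstoUniformlyOn f g atTop (closedBall 0 R)) : Differentiable ℂ g := by
  have hcau : ∀ R : ℝ, UniformCauchySeqOn (fun i => fderiv ℂ (f i)) atTop (closedBall 0 R) := by
    intro R
    rw [Metric.uniformCauchySeqOn_iff]
    intro ε hε
    obtain ⟨M, hM⟩ := Metric.uniformCauchySeqOn_iff.mp (h (R + 1)).uniformCauchySeqOn (ε / 2) (by positivity)
    refine ⟨M, fun i hi j hj x hx => ?_⟩
    have h1 := norm_fderiv_le_of_entire_closedBall ((hf i).sub (hf j)) (C := ε / 2) (c := 0) (R := R)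
      (fun z hz => by
        have := (hM i hi j hj z hz).le
        rwa [dist_eq_norm] at this) hx
    rw [fderiv_sub (hf i x) (hf j x)] at h1
    rw [dist_eq_norm]
    linarith
  have hlim : ∀ x, ∃ g', Tendsto (fun i => fderiv ℂ (f i) x) atTop (𝓝 g') := fun x =>
    cauchySeq_tendsto_of_complete ((hcau ‖x‖).cauchySeq (x := x) (by simp))
  choose g' hg' using hlim
  intro x
  have hx : x ∈ ball (0 : E) (‖x‖ + 1) := by simp
  refine (hasFDerivAt_of_tendstoUniformlyOn (𝕜 := ℂ) isOpen_ball (f := f) (g := g) (g' := g')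
    (f' := fun i => fderiv ℂ (f i)) (l := atTop)
    (((hcau (‖x‖ + 1)).tendstoUniformlyOn_of_tendsto (fun y _ => hg' y)).mono ball_subset_closedBall)
    (fun i y _ => (hf i y).hasFDerivAt) (fun y hy => ?_) hx).differentiableAt
  exact (h (‖x‖ + 1)).tendsto_at (ball_subset_closedBall hy)

variable [FiniteDimensional ℂ E]

theorem exists_bound_of_continuous {X Y : Type*} [NormedAddCommGroup X] [NormedAddCommGroup Y]
    [ProperSpace X] {f : X → Y} (hf : Continuous f) (x : X) (R : ℝ) :
    ∃ C, 0 ≤ C ∧ ∀ z ∈ closedBall x R, ‖f z‖ ≤ C := by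
  obtain ⟨C, hC⟩ := (isCompact_closedBall x R).exists_bound_of_continuousOn hf.continuousOn
  exact ⟨max C 0, le_max_right _ _, fun z hz => (hC z hz).trans (le_max_left _ _)⟩

theorem exists_lipschitz_fderiv_of_entire {f : E → F} (hf : Differentiable ℂ f) (R : ℝ) :
    ∃ C, 0 ≤ C ∧ ∀ x ∈ closedBall (0 : E) R, ∀ y ∈ closedBall (0 : E) R,
      ‖fderiv ℂ f x - fderiv ℂ f y‖ ≤ C * ‖x - y‖ := by
  have : ProperSpace E := FiniteDimensional.proper ℂ E
  obtain ⟨C, hC0, hC⟩ := exists_bound_of_continuous hf.continuous 0 (R + 1 + 1)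
  refine ⟨C, hC0, fun x hx y hy => ?_⟩
  have hd : Differentiable ℂ (fun z => f z - f (z + (y - x))) := by fun_prop
  have h1 := norm_fderiv_le_of_entire hd (x := x) (r := 1) (C := C * ‖x - y‖) one_pos
    (fun u hu => by
      have hu1 : u ∈ closedBall (0 : E) (R + 1) :=
        closedBall_subset_closedBall' (by have := mem_closedBall.mp hx; linarith) hu
      have hu2 : u + (y - x) ∈ closedBall (0 : E) (R + 1) := by
        have hu' : ‖u - x‖ ≤ 1 := by simpa [dist_eq_norm] using hu
        have hy' : ‖y‖ ≤ R := by simpa using hy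
        simp only [mem_closedBall, dist_zero_right]
        calc ‖u + (y - x)‖ = ‖(u - x) + y‖ := by congr 1; abel
          _ ≤ _ := norm_add_le _ _
          _ ≤ _ := by linarith
      have := norm_sub_le_of_entire hf hC hu1 hu2
      refine this.trans_eq ?_
      congr 2; abel)
  have h2 : fderiv ℂ (fun z => f z - f (z + (y - x))) x = fderiv ℂ f x - fderiv ℂ f y := by
    rw [fderiv_fun_sub (hf x) (by fun_prop), fderiv_comp_add_right]
    simp
  rw [h2] at h1
  simpa using h1

theorem differentiable_fderiv_apply_of_entire [CompleteSpace F] {f : E → F}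
    (hf : Differentiable ℂ f) (v : E) : Differentiable ℂ (fun x => fderiv ℂ f x v) := by
  let : NormedSpace ℝ E := NormedSpace.restrictScalars ℝ ℂ E
  refine differentiable_of_tendstoUniformlyOn_closedBall
    (f := fun i x => ((i : ℂ) + 1) • (f (x + ((i : ℂ) + 1)⁻¹ • v) - f x)) (fun i => by fun_prop) ?_
  intro R
  obtain ⟨C, hC0, hC⟩ := exists_lipschitz_fderiv_of_entire hf (R + ‖v‖)
  rw [Metric.tendstoUniformlyOn_iff]
  intro ε hε
  have hlim : Tendsto (fun i : ℕ => C * ‖v‖ * ‖v‖ * (1 / ((i : ℝ) + 1))) atTop (𝓝 0) := by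
    simpa using tendsto_one_div_add_atTop_nhds_zero_nat.const_mul (C * ‖v‖ * ‖v‖)
  filter_upwards [hlim.eventually_lt_const hε] with i hi x hx
  refine lt_of_le_of_lt ?_ hi
  have hx' : ‖x‖ ≤ R := by simpa using hx
  have hi0 : ((i : ℂ) + 1) ≠ 0 := by exact_mod_cast Nat.succ_ne_zero i
  have hni : ‖((i : ℂ) + 1)‖ = (i : ℝ) + 1 := by
    have : ((i : ℂ) + 1) = (((i : ℝ) + 1 : ℝ) : ℂ) := by push_cast; rfl
    rw [this, Complex.norm_real, Real.norm_of_nonneg (by positivity)]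
  set h : E := ((i : ℂ) + 1)⁻¹ • v with hh
  have hnh : ‖h‖ = ‖v‖ / ((i : ℝ) + 1) := by
    rw [hh, norm_smul, norm_inv, hni]; field_simp
  have hhv : ‖h‖ ≤ ‖v‖ := by
    rw [hnh]; exact div_le_self (norm_nonneg _) (by linarith [(Nat.cast_nonneg i : (0:ℝ) ≤ i)])
  have hs : closedBall x ‖h‖ ⊆ closedBall (0 : E) (R + ‖v‖) :=
    closedBall_subset_closedBall' (by simp; linarith)
  have key := (convex_closedBall x ‖h‖).norm_image_sub_le_of_norm_fderiv_le (𝕜 := ℂ)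
    (f := fun z => f z - fderiv ℂ f x z) (C := C * ‖h‖)
    (fun z _ => (hf z).sub (fderiv ℂ f x).differentiableAt) (fun z hz => by
      rw [fderiv_fun_sub (hf z) (fderiv ℂ f x).differentiableAt, ContinuousLinearMap.fderiv]
      refine (hC z (hs hz) x (hs (mem_closedBall_self (norm_nonneg _)))).trans ?_
      gcongr
      simpa [dist_eq_norm] using hz)
    (x := x) (y := x + h) (mem_closedBall_self (norm_nonneg _)) (by simp)
  have e1 : f (x + h) - fderiv ℂ f x (x + h) - (f x - fderiv ℂ f x x)
      = f (x + h) - f x - fderiv ℂ f x h := by rw [map_add]; abel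
  rw [e1, add_sub_cancel_left] at key
  have e2 : fderiv ℂ f x v - ((i : ℂ) + 1) • (f (x + h) - f x)
      = - (((i : ℂ) + 1) • (f (x + h) - f x - fderiv ℂ f x h)) := by
    rw [hh, map_smul, smul_sub _ _ (_ • _), smul_smul, mul_inv_cancel₀ hi0, one_smul]; abel
  rw [dist_eq_norm, e2, norm_neg, norm_smul, hni]
  calc ((i : ℝ) + 1) * _ ≤ ((i : ℝ) + 1) * (C * ‖h‖ * ‖h‖) := by gcongr
    _ = _ := by rw [hnh]; field_simp

theorem contDiff_of_entire [CompleteSpace F] {f : E → F} (hf : Differentiable ℂ f) {k : ℕ∞} :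
    ContDiff ℂ k f := by
  suffices h : ∀ (n : ℕ) (f : E → F), Differentiable ℂ f → ContDiff ℂ n f by
    exact contDiff_iff_forall_nat_le.mpr fun n _ => h n f hf
  intro n
  induction n with
  | zero => intro f hf; exact contDiff_zero.mpr hf.continuous
  | succ n ih =>
    intro f hf
    rw [show ((n + 1 : ℕ) : WithTop ℕ∞) = (n : WithTop ℕ∞) + 1 by push_cast; rfl,
      contDiff_succ_iff_fderiv_apply]
    refine ⟨hf, fun h => ?_, fun y => ih _ (differentiable_fderiv_apply_of_entire hf y)⟩
    exact absurd h (by simp)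

theorem differentiable_fderiv_of_entire [CompleteSpace F] {f : E → F} (hf : Differentiable ℂ f) :
    Differentiable ℂ (fderiv ℂ f) := by
  have := contDiff_of_entire hf (k := 2)
  exact (this.fderiv_right (m := 1) (by norm_num)).differentiable (by norm_num)

end EntireMaps

theorem iteratedFDeriv_eq_zero_of_norm_le {E F : Type} [NormedAddCommGroup E] [NormedSpace ℂ E]
    [FiniteDimensional ℂ E] [NormedAddCommGroup F] [NormedSpace ℂ F] [CompleteSpace F] {f : E → F}
    (hf : Differentiable ℂ f) {x : E} {k : ℕ} {C r : ℝ} (hr : 0 < r)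
    (h : ∀ z ∈ closedBall x r, ‖f z‖ ≤ C * ‖z - x‖ ^ (k + 1)) {j : ℕ} (hj : j ≤ k) :
    iteratedFDeriv ℂ j f x = 0 := by
  induction j generalizing k F C r with
  | zero =>
    have := h x (mem_closedBall_self hr.le)
    ext v
    simpa using this
  | succ j ih =>
    obtain ⟨k, rfl⟩ : ∃ l, k = l + 1 := ⟨k - 1, by omega⟩
    have h0 : iteratedFDeriv ℂ j (fderiv ℂ f) x = 0 := by
      refine ih (k := k) (C := C * 2 ^ (k + 2)) (r := r / 2) (differentiable_fderiv_of_entire hf)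
        (by positivity) (fun z hz => ?_) (by omega)
      have hz' : ‖z - x‖ ≤ r / 2 := by simpa [dist_eq_norm] using hz
      rcases eq_or_ne z x with rfl | hne
      · have : HasFDerivAt f (0 : E →L[ℂ] F) z := by
          have hz0 : f z = 0 := by simpa using h z (mem_closedBall_self hr.le)
          rw [hasFDerivAt_iff_isLittleO]
          have hO : (fun w => f w - f z - (0 : E →L[ℂ] F) (w - z)) =O[𝓝 z] fun w => ‖w - z‖ ^ (k + 2) := by
            refine Asymptotics.IsBigO.of_bound C ?_
            filter_upwards [closedBall_mem_nhds z hr] with w hw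
            simpa [hz0] using h w hw
          refine hO.trans_isLittleO ?_
          have := (Asymptotics.isLittleO_pow_id (𝕜 := ℝ) (n := k + 2) (by omega))
          have ht : Tendsto (fun w => ‖w - z‖) (𝓝 z) (𝓝 0) := by
            have : ContinuousAt (fun w : E => ‖w - z‖) z := by fun_prop
            simpa [ContinuousAt] using this
          exact (this.comp_tendsto ht).of_norm_right
        rw [this.fderiv]; simp
      · have hpos : 0 < ‖z - x‖ := norm_pos_iff.mpr (sub_ne_zero.mpr hne)
        have hC0 : 0 ≤ C := by
          have := (norm_nonneg _).trans (h z (by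
            rw [mem_closedBall, dist_eq_norm]; linarith))
          by_contra hneg
          have : C * ‖z - x‖ ^ (k + 1 + 1) < 0 := mul_neg_of_neg_of_pos (by linarith) (by positivity)
          linarith
        have := norm_fderiv_le_of_entire hf (x := z) (r := ‖z - x‖)
          (C := C * (2 * ‖z - x‖) ^ (k + 2)) hpos (fun u hu => by
            have hu' : ‖u - z‖ ≤ ‖z - x‖ := by simpa [dist_eq_norm] using hu
            have hux : ‖u - x‖ ≤ 2 * ‖z - x‖ := by
              have := norm_add_le (u - z) (z - x)
              rw [sub_add_sub_cancel] at this
              linarith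
            refine (h u (by rw [mem_closedBall, dist_eq_norm]; linarith)).trans ?_
            gcongr)
        refine this.trans_eq ?_
        rw [mul_pow]; field_simp; ring
    ext v
    rw [iteratedFDeriv_succ_apply_right, h0]
    simp

theorem exists_matrix_right_inverse {B ι κ : Type*} [CommRing B] [Algebra ℂ B] [Fintype ι]
    [DecidableEq ι] [Fintype κ] (N : Matrix ι κ B)
    (h : ∀ M : Ideal B, M.IsMaximal → ∃ χ : B →ₐ[ℂ] ℂ, (∀ b ∈ M, χ b = 0) ∧
      ∃ s : Matrix κ ι ℂ, N.map χ * s = 1) : ∃ S : Matrix κ ι B, N * S = 1 := by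
  let a : Ideal B :=
    { carrier := {f | ∃ S : Matrix κ ι B, N * S = f • (1 : Matrix ι ι B)}
      zero_mem' := ⟨0, by simp⟩
      add_mem' := by
        rintro f g ⟨S, hS⟩ ⟨T, hT⟩
        exact ⟨S + T, by rw [Matrix.mul_add, hS, hT, add_smul]⟩
      smul_mem' := by
        rintro c f ⟨S, hS⟩
        exact ⟨c • S, by rw [Matrix.mul_smul, hS, smul_smul, smul_eq_mul]⟩ }
  have ha : a = ⊤ := by
    by_contra hne
    obtain ⟨M, hM, haM⟩ := Ideal.exists_le_maximal a hne
    obtain ⟨χ, hχ, s, hs⟩ := h M hM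
    have hmem : (N * s.map (algebraMap ℂ B)).det ∈ a :=
      ⟨s.map (algebraMap ℂ B) * (N * s.map (algebraMap ℂ B)).adjugate, by
        rw [← Matrix.mul_assoc, Matrix.mul_adjugate]⟩
    have h0 := hχ _ (haM hmem)
    have h1 : χ (N * s.map (algebraMap ℂ B)).det = 1 := by
      rw [AlgHom.map_det, AlgHom.mapMatrix_apply, Matrix.map_mul, Matrix.map_map]
      have : (χ ∘ algebraMap ℂ B) = id := by ext z; simp
      rw [this, Matrix.map_id, hs, Matrix.det_one]
    exact zero_ne_one (h0.symm.trans h1)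
  obtain ⟨S, hS⟩ : (1 : B) ∈ a := by rw [ha]; trivial
  exact ⟨S, by simpa using hS⟩

/-- Restriction of polynomials to a closed polydisc. -/
noncomputable def polydiscRestrict (m : ℕ) (R : ℝ) :
    MvPolynomial (Fin m) ℂ →ₐ[ℂ] C(closedBall (0 : Fin m → ℂ) R, ℂ) :=
  MvPolynomial.aeval fun a => ⟨fun z => z.1 a, (continuous_apply a).comp continuous_subtype_val⟩

theorem polydiscRestrict_apply {m : ℕ} {R : ℝ} (p : MvPolynomial (Fin m) ℂ)
    (z : closedBall (0 : Fin m → ℂ) R) : polydiscRestrict m R p z = MvPolynomial.eval z.1 p := by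
  have h : (ContinuousMap.evalAlgHom ℂ ℂ z).comp (polydiscRestrict m R) =
      MvPolynomial.aeval z.1 := by
    ext a
    simp [polydiscRestrict]
  have := DFunLike.congr_fun h p
  simpa [MvPolynomial.aeval_eq_eval] using this

/-- The uniform closure of the polynomials on a closed polydisc. -/
noncomputable def polydiscAlgebra (m : ℕ) (R : ℝ) :
    Subalgebra ℂ C(closedBall (0 : Fin m → ℂ) R, ℂ) :=
  (polydiscRestrict m R).range.topologicalClosure

instance (m : ℕ) (R : ℝ) : CompleteSpace (polydiscAlgebra m R) :=
  (Subalgebra.isClosed_topologicalClosure _).completeSpace_coe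

/-- Polynomials as elements of the polydisc algebra. -/
noncomputable def polydiscPoly (m : ℕ) (R : ℝ) : MvPolynomial (Fin m) ℂ →ₐ[ℂ] polydiscAlgebra m R :=
  (polydiscRestrict m R).codRestrict _ fun p =>
    Subalgebra.le_topologicalClosure _ ⟨p, rfl⟩

/-- Evaluation of an element of the polydisc algebra at a point. -/
noncomputable def polydiscEval {m : ℕ} {R : ℝ} (z : closedBall (0 : Fin m → ℂ) R) :
    polydiscAlgebra m R →ₐ[ℂ] ℂ :=
  (ContinuousMap.evalAlgHom ℂ ℂ z).comp (polydiscAlgebra m R).val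

theorem norm_polydiscEval_le {m : ℕ} {R : ℝ} (z : closedBall (0 : Fin m → ℂ) R)
    (f : polydiscAlgebra m R) : ‖polydiscEval z f‖ ≤ ‖f‖ := ContinuousMap.norm_coe_le_norm f.1 z

theorem continuous_polydiscEval {m : ℕ} {R : ℝ} (z : closedBall (0 : Fin m → ℂ) R) :
    Continuous (polydiscEval z) :=
  (continuous_eval_const z).comp continuous_subtype_val

theorem polydiscEval_poly {m : ℕ} {R : ℝ} (z : closedBall (0 : Fin m → ℂ) R)
    (p : MvPolynomial (Fin m) ℂ) : polydiscEval z (polydiscPoly m R p) = MvPolynomial.eval z.1 p :=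
  polydiscRestrict_apply p z

theorem denseRange_polydiscPoly (m : ℕ) (R : ℝ) : DenseRange (polydiscPoly m R) := by
  intro f
  have hf : f.1 ∈ closure (Set.range (polydiscRestrict m R)) := by
    have h : f.1 ∈ ((polydiscRestrict m R).range.topologicalClosure : Set _) := f.2
    rwa [Subalgebra.topologicalClosure_coe] at h
  rw [closure_subtype]
  convert hf
  ext g
  constructor
  · rintro ⟨x, ⟨p, rfl⟩, rfl⟩; exact ⟨p, rfl⟩
  · rintro ⟨p, rfl⟩; exact ⟨polydiscPoly m R p, ⟨p, rfl⟩, rfl⟩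

theorem exists_polydiscEval_of_isMaximal {m : ℕ} {R : ℝ} (hR : 0 ≤ R)
    (M : Ideal (polydiscAlgebra m R)) (hM : M.IsMaximal) :
    ∃ z : closedBall (0 : Fin m → ℂ) R, ∀ b ∈ M, polydiscEval z b = 0 := by
  let χ := M.toCharacterSpace
  let a : Fin m → ℂ := fun i => χ (polydiscPoly m R (MvPolynomial.X i))
  have : Nonempty (closedBall (0 : Fin m → ℂ) R) := ⟨⟨0, by simpa using hR⟩⟩
  have ha : a ∈ closedBall (0 : Fin m → ℂ) R := by
    rw [mem_closedBall, dist_zero_right, pi_norm_le_iff_of_nonneg hR]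
    intro i
    refine (AlgHom.norm_apply_le_self_mul_norm_one χ _).trans ?_
    have h1 : ‖(1 : polydiscAlgebra m R)‖ = 1 := by
      change ‖(1 : C(closedBall (0 : Fin m → ℂ) R, ℂ))‖ = 1
      exact norm_one
    rw [h1, mul_one]
    change ‖polydiscRestrict m R (MvPolynomial.X i)‖ ≤ R
    rw [ContinuousMap.norm_le _ hR]
    intro z
    rw [polydiscRestrict_apply, MvPolynomial.eval_X]
    exact (norm_le_pi_norm z.1 i).trans (mem_closedBall_zero_iff.mp z.2)
  refine ⟨⟨a, ha⟩, fun b hb => ?_⟩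
  have hχ : (fun b => χ b) = fun b => polydiscEval ⟨a, ha⟩ b := by
    refine (denseRange_polydiscPoly m R).equalizer (map_continuous χ)
      (continuous_polydiscEval _) (funext fun p => ?_)
    have : (WeakDual.CharacterSpace.toAlgHom χ).comp (polydiscPoly m R) =
        (polydiscEval ⟨a, ha⟩).comp (polydiscPoly m R) := by
      ext i
      simp only [AlgHom.comp_apply, polydiscEval_poly, MvPolynomial.eval_X]
      rfl
    exact DFunLike.congr_fun this p
  rw [← congrFun hχ b]
  exact M.toCharacterSpace_apply_eq_zero_of_mem hb

/-- An entire map is approximated on balls by its homogeneous Taylor polynomials. -/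
theorem exists_taylor_approx {E F : Type*} [NormedAddCommGroup E] [NormedSpace ℂ E]
    [FiniteDimensional ℂ E] [NormedAddCommGroup F] [NormedSpace ℂ F] [CompleteSpace F] {f : E → F}
    (hf : Differentiable ℂ f) (R : ℝ) {ε : ℝ} (hε : 0 < ε) : ∃ J : ℕ, ∀ z ∈ closedBall (0 : E) R,
      ‖∑ j ∈ Finset.range J, (j.factorial : ℂ)⁻¹ • iteratedFDeriv ℂ j f 0 (fun _ => z) - f z‖ ≤ ε := by
  have : ProperSpace E := FiniteDimensional.proper ℂ E
  obtain ⟨C, hC0, hC⟩ := exists_bound_of_continuous hf.continuous 0 (2 * R)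
  obtain ⟨J, hJ⟩ : ∃ J : ℕ, C * (1 / 2 : ℝ) ^ J / (1 - 1 / 2) ≤ ε := by
    have : Tendsto (fun J : ℕ => C * (1 / 2 : ℝ) ^ J / (1 - 1 / 2)) atTop (𝓝 0) := by
      have := ((tendsto_pow_atTop_nhds_zero_of_lt_one (r := (1 / 2 : ℝ)) (by norm_num)
        (by norm_num)).const_mul C).div_const (1 - 1 / 2)
      simpa using this
    exact (this.eventually_le_const hε).exists
  refine ⟨J, fun z hz => le_trans ?_ hJ⟩
  have hg : Differentiable ℂ (fun t : ℂ => f (t • z)) := by fun_prop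
  have hd : ∀ j, iteratedDeriv j (fun t : ℂ => f (t • z)) 0 = iteratedFDeriv ℂ j f 0 (fun _ => z) := by
    intro j
    have := (ContinuousLinearMap.toSpanSingleton ℂ z).iteratedFDeriv_comp_right
      (contDiff_of_entire hf (k := j)) 0 (i := j) le_rfl
    rw [iteratedDeriv_eq_iteratedFDeriv]
    have h2 := congrArg (fun q => q (fun _ => (1 : ℂ))) this
    simpa [Function.comp_def] using! h2
  have hs := Complex.hasSum_taylorSeries_of_entire hg 0 1
  simp only [sub_zero, one_pow, one_smul, hd] at hs
  refine norm_sub_le_of_geometric_bound_of_hasSum (by norm_num) (fun j => ?_) hs J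
  have hb := Complex.norm_iteratedDeriv_le_of_forall_mem_sphere_norm_le (c := 0) (R := 2) (C := C) j
    two_pos hg.diffContOnCl (fun t ht => hC _ (by
      have ht' : ‖t‖ = 2 := by simpa using ht
      have hz' : ‖z‖ ≤ R := by simpa using hz
      simp only [mem_closedBall, dist_zero_right, norm_smul, ht']
      linarith))
  rw [hd] at hb
  rw [norm_smul, norm_inv, Complex.norm_natCast]
  have hj : (0 : ℝ) < j.factorial := by positivity
  calc (j.factorial : ℝ)⁻¹ * _ ≤ (j.factorial : ℝ)⁻¹ * (j.factorial * C / 2 ^ j) := by gcongr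
    _ = C * (1 / 2) ^ j := by rw [div_pow, one_pow]; field_simp

theorem exists_mvPolynomial_eval_eq_multilinear {m j : ℕ}
    (M : ContinuousMultilinearMap ℂ (fun _ : Fin j => Fin m → ℂ) ℂ) :
    ∃ p : MvPolynomial (Fin m) ℂ, ∀ z, MvPolynomial.eval z p = M (fun _ => z) := by
  refine ⟨∑ r : Fin j → Fin m, MvPolynomial.C (M fun i => Pi.single (r i) 1) *
    ∏ i, MvPolynomial.X (r i), fun z => ?_⟩
  have hz : (fun _ : Fin j => z) = fun _ => ∑ a : Fin m, z a • (Pi.single a (1 : ℂ) : Fin m → ℂ) := by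
    funext _
    ext b
    simp [Pi.single_apply]
  have h2 := M.toMultilinearMap.map_sum (fun (_ : Fin j) (a : Fin m) => z a • (Pi.single a (1 : ℂ) : Fin m → ℂ))
  rw [hz]
  refine Eq.trans ?_ h2.symm
  simp only [MultilinearMap.map_smul_univ, map_sum, map_mul, map_prod, MvPolynomial.eval_C,
    MvPolynomial.eval_X, smul_eq_mul]
  refine Finset.sum_congr rfl fun r _ => ?_
  rw [mul_comm]; rfl

/-- Polynomials approximate entire functions uniformly on polydiscs. -/
theorem exists_mvPolynomial_approx {m : ℕ} {f : (Fin m → ℂ) → ℂ} (hf : Differentiable ℂ f)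
    (R : ℝ) {ε : ℝ} (hε : 0 < ε) : ∃ p : MvPolynomial (Fin m) ℂ, ∀ z ∈ closedBall (0 : Fin m → ℂ) R,
      ‖MvPolynomial.eval z p - f z‖ ≤ ε := by
  obtain ⟨J, hJ⟩ := exists_taylor_approx hf R hε
  choose p hp using fun j => exists_mvPolynomial_eval_eq_multilinear (iteratedFDeriv ℂ j f 0)
  refine ⟨∑ j ∈ Finset.range J, MvPolynomial.C (j.factorial : ℂ)⁻¹ * p j, fun z hz => ?_⟩
  simpa [hp] using hJ z hz

theorem exists_polydiscAlgebra_of_entire {m : ℕ} {f : (Fin m → ℂ) → ℂ} (hf : Differentiable ℂ f)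
    (R : ℝ) : ∃ b : polydiscAlgebra m R, ∀ z, polydiscEval z b = f z.1 := by
  let g : C(closedBall (0 : Fin m → ℂ) R, ℂ) := ⟨fun z => f z.1, by
    have := hf.continuous; fun_prop⟩
  have hg : g ∈ polydiscAlgebra m R := by
    rw [polydiscAlgebra, ← SetLike.mem_coe, Subalgebra.topologicalClosure_coe,
      Metric.mem_closure_iff]
    intro ε hε
    obtain ⟨p, hp⟩ := exists_mvPolynomial_approx hf R (half_pos hε)
    refine ⟨_, ⟨p, rfl⟩, lt_of_le_of_lt ?_ (half_lt_self hε)⟩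
    rw [ContinuousMap.dist_le (half_pos hε).le]
    intro z
    rw [dist_comm, dist_eq_norm]
    have := hp z.1 z.2
    rw [← polydiscRestrict_apply p z] at this
    exact this
  exact ⟨⟨g, hg⟩, fun z => rfl⟩

theorem exists_matrix_right_inverse_approx {m : ℕ} {ι κ : Type*} [Fintype ι] [DecidableEq ι] [Fintype κ]
    (N : (Fin m → ℂ) → Matrix ι κ ℂ) (hN : ∀ i j, Differentiable ℂ fun w => N w i j)
    (hs : ∀ w, ∃ s : Matrix κ ι ℂ, N w * s = 1) {R : ℝ} (hR : 0 ≤ R) :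
    ∃ C : ℝ, ∀ δ > 0, ∃ S : (Fin m → ℂ) → Matrix κ ι ℂ,
      (∀ j i, Differentiable ℂ fun w => S w j i) ∧
      (∀ w ∈ closedBall (0 : Fin m → ℂ) R, ∀ j i, ‖S w j i‖ ≤ C) ∧
      ∀ w ∈ closedBall (0 : Fin m → ℂ) R, ∀ i i', ‖(N w * S w - (1 : Matrix ι ι ℂ)) i i'‖ ≤ δ := by
  choose b hb using fun i j => exists_polydiscAlgebra_of_entire (hN i j) R
  obtain ⟨S, hS⟩ := exists_matrix_right_inverse (Matrix.of b) (fun M hM => by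
    obtain ⟨z, hz⟩ := exists_polydiscEval_of_isMaximal hR M hM
    obtain ⟨s, hs⟩ := hs z.1
    refine ⟨polydiscEval z, hz, s, ?_⟩
    rw [← hs]
    congr 1
    ext i j
    simp [hb])
  obtain ⟨CS, hCS⟩ : ∃ C, ∀ j i, ‖S j i‖ ≤ C :=
    ⟨∑ j, ∑ i, ‖S j i‖, fun j i => (Finset.single_le_sum (f := fun i => ‖S j i‖)
      (fun _ _ => norm_nonneg _) (Finset.mem_univ i)).trans
      (Finset.single_le_sum (f := fun j => ∑ i, ‖S j i‖)
      (fun _ _ => Finset.sum_nonneg fun _ _ => norm_nonneg _) (Finset.mem_univ j))⟩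
  obtain ⟨CN, hCN0, hCN⟩ : ∃ C : ℝ, 0 ≤ C ∧ ∀ i, ∑ j, ‖b i j‖ ≤ C :=
    ⟨∑ i, ∑ j, ‖b i j‖, by positivity, fun i => (Finset.single_le_sum (f := fun i => ∑ j, ‖b i j‖)
      (fun _ _ => Finset.sum_nonneg fun _ _ => norm_nonneg _) (Finset.mem_univ i))⟩
  refine ⟨CS + 1, fun δ hδ => ?_⟩
  set η := min 1 (δ / (CN + 1)) with hη
  have hη0 : 0 < η := lt_min one_pos (by positivity)
  have happ : ∀ j i, ∃ p : MvPolynomial (Fin m) ℂ, ‖S j i - polydiscPoly m R p‖ ≤ η := by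
    intro j i
    obtain ⟨p, hp⟩ := (denseRange_polydiscPoly m R).exists_dist_lt (S j i) hη0
    exact ⟨p, by rw [← dist_eq_norm]; exact hp.le⟩
  choose p hp using happ
  have hev : ∀ (w : Fin m → ℂ) (hw : w ∈ closedBall (0 : Fin m → ℂ) R) j i,
      ‖polydiscEval ⟨w, hw⟩ (S j i) - MvPolynomial.eval w (p j i)‖ ≤ η := by
    intro w hw j i
    have h := (norm_polydiscEval_le ⟨w, hw⟩ (S j i - polydiscPoly m R (p j i))).trans (hp j i)
    rwa [map_sub, polydiscEval_poly] at h
  refine ⟨fun w => Matrix.of fun j i => MvPolynomial.eval w (p j i), fun j i => ?_, fun w hw j i => ?_,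
    fun w hw i i' => ?_⟩
  · simp only [Matrix.of_apply]
    have : AnalyticOnNhd ℂ (fun w : Fin m → ℂ => MvPolynomial.eval w (p j i)) univ := by
      have := AnalyticOnNhd.aeval_mvPolynomial (𝕜 := ℂ) (A := ℂ) (B := ℂ) (E := Fin m → ℂ)
        (f := fun w a => w a) (s := univ) (fun a => 
          (ContinuousLinearMap.proj (R := ℂ) (φ := fun _ : Fin m => ℂ) a).analyticOnNhd univ) (p j i)
      simpa [MvPolynomial.aeval_eq_eval] using! this
    exact fun w => (this w trivial).differentiableAt
  · simp only [Matrix.of_apply]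
    have h1 := hev w hw j i
    have h2 := (norm_polydiscEval_le ⟨w, hw⟩ (S j i)).trans (hCS j i)
    have h3 := norm_sub_norm_le (MvPolynomial.eval w (p j i)) (polydiscEval ⟨w, hw⟩ (S j i))
    rw [norm_sub_rev] at h3
    have : η ≤ 1 := min_le_left _ _
    linarith
  · have e : (1 : Matrix ι ι ℂ) i i' = ∑ j, N w i j * polydiscEval ⟨w, hw⟩ (S j i') := by
      have h := congrArg (polydiscEval ⟨w, hw⟩) (congrFun (congrFun hS i) i')
      rw [Matrix.mul_apply, map_sum] at h
      simp only [map_mul, Matrix.of_apply, hb] at h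
      refine Eq.trans ?_ h.symm
      simp only [Matrix.one_apply]
      split_ifs
      · exact (map_one _).symm
      · exact (map_zero _).symm
    rw [Matrix.sub_apply, Matrix.mul_apply, e, ← Finset.sum_sub_distrib]
    refine (norm_sum_le _ _).trans ?_
    calc _ ≤ ∑ j, ‖b i j‖ * η := by
          refine Finset.sum_le_sum fun j _ => ?_
          rw [← mul_sub, norm_mul]
          gcongr
          · rw [← hb i j ⟨w, hw⟩]; exact norm_polydiscEval_le _ _
          · rw [norm_sub_rev]; exact hev w hw j i'
      _ ≤ CN * (δ / (CN + 1)) := by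
          rw [← Finset.sum_mul]
          exact mul_le_mul (hCN i) (min_le_right _ _) hη0.le hCN0
      _ ≤ δ := by
          rw [mul_div_assoc', div_le_iff₀ (by positivity)]
          nlinarith

theorem exists_norm_le_of_matrix_entries {ι κ X : Type*} [Fintype ι] [DecidableEq ι] [Fintype κ]
    [DecidableEq κ] [NormedAddCommGroup X] [NormedSpace ℂ X] (Φ : Matrix ι κ ℂ →ₗ[ℂ] X) :
    ∃ C, 0 < C ∧ ∀ (A : Matrix ι κ ℂ) (δ : ℝ), 0 ≤ δ → (∀ i j, ‖A i j‖ ≤ δ) → ‖Φ A‖ ≤ C * δ := by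
  refine ⟨1 + ∑ i, ∑ j, ‖Φ (Matrix.single i j 1)‖, by positivity, fun A δ hδ hA => ?_⟩
  have hA' : A = ∑ i, ∑ j, A i j • Matrix.single i j (1 : ℂ) := by
    conv_lhs => rw [Matrix.matrix_eq_sum_single A]
    simp [Matrix.smul_single]
  conv_lhs => rw [hA']
  simp only [map_sum, map_smul]
  calc _ ≤ ∑ i, ‖∑ j, A i j • Φ (Matrix.single i j 1)‖ := norm_sum_le _ _
    _ ≤ ∑ i, ∑ j, ‖Φ (Matrix.single i j 1)‖ * δ := by
        refine Finset.sum_le_sum fun i _ => (norm_sum_le _ _).trans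
          (Finset.sum_le_sum fun j _ => ?_)
        rw [norm_smul, mul_comm]
        gcongr
        exact hA i j
    _ ≤ _ := by
        simp only [← Finset.sum_mul]
        gcongr
        linarith

/-- A holomorphic family of surjective linear maps has, on each polydisc, approximate entire right
inverses whose norms are bounded independently of the precision. -/
theorem exists_right_inverse_approx {m : ℕ} {T V : Type*} [NormedAddCommGroup T] [NormedSpace ℂ T]
    [FiniteDimensional ℂ T] [NormedAddCommGroup V] [NormedSpace ℂ V] [FiniteDimensional ℂ V]
    {N : (Fin m → ℂ) → T →L[ℂ] V} (hN : Differentiable ℂ N)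
    (hs : ∀ w, Function.Surjective (N w)) {R : ℝ} (hR : 0 ≤ R) :
    ∃ C : ℝ, 0 ≤ C ∧ ∀ δ > 0, ∃ S : (Fin m → ℂ) → V →L[ℂ] T, Differentiable ℂ S ∧
      (∀ w ∈ closedBall (0 : Fin m → ℂ) R, ‖S w‖ ≤ C) ∧
      ∀ w ∈ closedBall (0 : Fin m → ℂ) R, ‖N w ∘L S w - ContinuousLinearMap.id ℂ V‖ ≤ δ := by
  classical
  let bT := Module.finBasis ℂ T
  let bV := Module.finBasis ℂ V
  let N' : (Fin m → ℂ) → Matrix _ _ ℂ := fun w => LinearMap.toMatrix bT bV (N w).toLinearMap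
  let Φ : Matrix (Fin (Module.finrank ℂ T)) (Fin (Module.finrank ℂ V)) ℂ →ₗ[ℂ] (V →L[ℂ] T) :=
    LinearMap.toContinuousLinearMap.toLinearMap ∘ₗ (Matrix.toLin bV bT).toLinearMap
  let Ψ : Matrix (Fin (Module.finrank ℂ V)) (Fin (Module.finrank ℂ V)) ℂ →ₗ[ℂ] (V →L[ℂ] V) :=
    LinearMap.toContinuousLinearMap.toLinearMap ∘ₗ (Matrix.toLin bV bV).toLinearMap
  obtain ⟨CΦ, hCΦ0, hCΦ⟩ := exists_norm_le_of_matrix_entries Φ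
  obtain ⟨CΨ, hCΨ0, hCΨ⟩ := exists_norm_le_of_matrix_entries Ψ
  obtain ⟨C, hC⟩ := exists_matrix_right_inverse_approx (m := m) N' (fun i j => by
      have : (fun w => N' w i j) = fun w => (LinearMap.toContinuousLinearMap (bV.coord i)) (N w (bT j)) := by
        funext w
        simp [N', LinearMap.toMatrix_apply]
      rw [this]
      fun_prop) (fun w => by
      obtain ⟨g, hg⟩ := (N w).toLinearMap.exists_rightInverse_of_surjective
        (LinearMap.range_eq_top.mpr (hs w))
      exact ⟨LinearMap.toMatrix bV bT g, by
        rw [← LinearMap.toMatrix_comp, hg, LinearMap.toMatrix_id]⟩) hR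
  refine ⟨CΦ * max C 0, by positivity, fun δ hδ => ?_⟩
  obtain ⟨S, hSd, hSC, hSδ⟩ := hC (δ / CΨ) (by positivity)
  refine ⟨fun w => Φ (S w), ?_, fun w hw => hCΦ _ _ (le_max_right _ _) fun j i =>
    (hSC w hw j i).trans (le_max_left _ _), fun w hw => ?_⟩
  · have hS' : Differentiable ℂ (fun w => ∑ i, ∑ j, S w i j • Φ (Matrix.single i j (1 : ℂ))) :=
      Differentiable.fun_sum fun i _ => Differentiable.fun_sum fun j _ => (hSd i j).smul_const _
    convert hS' using 2 with w
    conv_lhs => rw [Matrix.matrix_eq_sum_single (S w)]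
    simp only [map_sum, ← map_smul, Matrix.smul_single, smul_eq_mul, mul_one]
  · have e : N w ∘L Φ (S w) - ContinuousLinearMap.id ℂ V = Ψ (N' w * S w - 1) := by
      rw [map_sub]
      congr 1
      · ext v
        simp only [Φ, Ψ, LinearMap.comp_apply, ContinuousLinearMap.comp_apply, LinearEquiv.coe_coe,
          LinearMap.coe_toContinuousLinearMap']
        rw [Matrix.toLin_mul bV bT bV]
        simp [N']
      · ext v
        simp [Ψ]
    rw [e]
    refine (hCΨ _ _ (by positivity) (hSδ w hw)).trans_eq ?_
    field_simp

/-- A holomorphic family, parametrised by a vector space `T`, of automorphisms of `X` which is the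
identity for the parameter `0`. -/
structure Spray (T X : Type*) [NormedAddCommGroup T] [NormedSpace ℂ T] [NormedAddCommGroup X]
    [NormedSpace ℂ X] where
  /-- the automorphisms -/
  f : T → X → X
  /-- their inverses -/
  g : T → X → X
  differentiable_f : Differentiable ℂ fun q : T × X => f q.1 q.2
  differentiable_g : Differentiable ℂ fun q : T × X => g q.1 q.2
  g_f : ∀ τ x, g τ (f τ x) = x
  f_g : ∀ τ x, f τ (g τ x) = x
  f_zero : ∀ x, f 0 x = x

namespace Spray

variable {T X W : Type*} [NormedAddCommGroup T] [NormedSpace ℂ T] [NormedAddCommGroup X]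
  [NormedSpace ℂ X] (s : Spray T X)

theorem g_zero (x : X) : s.g 0 x = x := by
  conv_lhs => rw [← s.f_zero x, s.g_f]

/-- The derivative of the spray in the direction of the parameter, at parameter `0`. -/
noncomputable def M (x : X) : T →L[ℂ] X :=
  (fderiv ℂ (fun q : T × X => s.f q.1 q.2) (0, x)) ∘L ContinuousLinearMap.inl ℂ T X

/-- Composition of a list of parameter-dependent automorphisms of the spray. -/
def act : List (W → T) → W → X → X
  | [], _, x => x
  | τ :: l, w, x => s.f (τ w) (act l w x)

/-- The inverse of `Spray.act`. -/
def inv : List (W → T) → W → X → X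
  | [], _, x => x
  | τ :: l, w, x => inv l w (s.g (τ w) x)

theorem act_append (l l' : List (W → T)) (w : W) (x : X) :
    s.act (l ++ l') w x = s.act l w (s.act l' w x) := by
  induction l with
  | nil => rfl
  | cons τ l ih => simp [act, ih]

theorem inv_append (l l' : List (W → T)) (w : W) (x : X) :
    s.inv (l ++ l') w x = s.inv l' w (s.inv l w x) := by
  induction l generalizing x with
  | nil => rfl
  | cons τ l ih => simp [inv, ih]

theorem inv_act (l : List (W → T)) (w : W) (x : X) : s.inv l w (s.act l w x) = x := by
  induction l with
  | nil => rfl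
  | cons τ l ih => simp [inv, act, s.g_f, ih]

theorem act_inv (l : List (W → T)) (w : W) (x : X) : s.act l w (s.inv l w x) = x := by
  induction l generalizing x with
  | nil => rfl
  | cons τ l ih => simp [inv, act, s.f_g, ih]

theorem differentiable_act [NormedAddCommGroup W] [NormedSpace ℂ W] {l : List (W → T)} (hl : ∀ τ ∈ l, Differentiable ℂ τ) :
    Differentiable ℂ fun q : W × X => s.act l q.1 q.2 := by
  induction l with
  | nil => exact differentiable_snd
  | cons τ l ih =>
    have h1 := ih fun τ' h => hl τ' (List.mem_cons_of_mem _ h)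
    have h2 : Differentiable ℂ fun q : W × X => τ q.1 :=
      (hl τ List.mem_cons_self).comp differentiable_fst
    exact s.differentiable_f.comp (h2.prodMk h1)

theorem differentiable_inv [NormedAddCommGroup W] [NormedSpace ℂ W] {l : List (W → T)} (hl : ∀ τ ∈ l, Differentiable ℂ τ) :
    Differentiable ℂ fun q : W × X => s.inv l q.1 q.2 := by
  induction l with
  | nil => exact differentiable_snd
  | cons τ l ih =>
    have h1 := ih fun τ' h => hl τ' (List.mem_cons_of_mem _ h)
    have h2 : Differentiable ℂ fun q : W × X => τ q.1 :=
      (hl τ List.mem_cons_self).comp differentiable_fst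
    have h3 : Differentiable ℂ fun q : W × X => s.g (τ q.1) q.2 :=
      s.differentiable_g.comp (h2.prodMk differentiable_snd)
    exact h1.comp (differentiable_fst.prodMk h3)

theorem act_mem {U : Set X} (hU : ∀ τ, ∀ x ∈ U, s.f τ x ∈ U) (l : List (W → T)) (w : W) {x : X}
    (hx : x ∈ U) : s.act l w x ∈ U := by
  induction l with
  | nil => exact hx
  | cons τ l ih => exact hU _ _ ih

theorem hasFDerivAt_f (τ : T) (x : X) : HasFDerivAt (fun τ => s.f τ x)
    ((fderiv ℂ (fun q : T × X => s.f q.1 q.2) (τ, x)) ∘L ContinuousLinearMap.inl ℂ T X) τ := by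
  have h := (s.differentiable_f (τ, x)).hasFDerivAt
  exact HasFDerivAt.comp (f := fun τ : T => (τ, x)) τ h (hasFDerivAt_prodMk_left τ x)

variable [FiniteDimensional ℂ T] [FiniteDimensional ℂ X]

theorem exists_norm_sub_le (B : ℝ) : ∃ C, 0 < C ∧ ∀ (τ : T) (x : X), ‖τ‖ ≤ 1 → ‖x‖ ≤ B →
    ‖s.f τ x - x‖ ≤ C * ‖τ‖ ∧ ‖s.g τ x - x‖ ≤ C * ‖τ‖ := by
  have : ProperSpace (T × X) := FiniteDimensional.proper ℂ _
  obtain ⟨C, hC0, hC⟩ := exists_bound_of_continuous s.differentiable_f.continuous 0 (max 1 B + 1)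
  obtain ⟨C', hC0', hC'⟩ := exists_bound_of_continuous s.differentiable_g.continuous 0 (max 1 B + 1)
  refine ⟨max C C' + 1, by positivity, fun τ x hτ hx => ?_⟩
  have h1 : ((τ, x) : T × X) ∈ closedBall (0 : T × X) (max 1 B) := by
    rw [mem_closedBall_zero_iff, Prod.norm_def]
    exact max_le_max hτ hx
  have h2 : ((0, x) : T × X) ∈ closedBall (0 : T × X) (max 1 B) := by
    rw [mem_closedBall_zero_iff, Prod.norm_def]
    exact max_le_max (by simp) hx
  have e : ‖((τ, x) : T × X) - (0, x)‖ = ‖τ‖ := by simp [Prod.norm_def]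
  have h3 := norm_sub_le_of_entire s.differentiable_f hC h1 h2
  have h4 := norm_sub_le_of_entire s.differentiable_g hC' h1 h2
  rw [e] at h3 h4
  simp only [s.f_zero, s.g_zero] at h3 h4
  constructor
  · exact h3.trans (by gcongr; linarith [le_max_left C C'])
  · exact h4.trans (by gcongr; linarith [le_max_right C C'])

theorem exists_norm_sub_sub_le (B : ℝ) : ∃ C, 0 < C ∧ ∀ (τ : T) (x y : X), ‖τ‖ ≤ 1 → ‖x‖ ≤ B →
    ‖y‖ ≤ B → ‖s.f τ x - s.f τ y‖ ≤ (1 + C * ‖τ‖) * ‖x - y‖ := by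
  obtain ⟨C, hC0, hC⟩ := s.exists_norm_sub_le (B + 1)
  refine ⟨C, hC0, fun τ x y hτ hx hy => ?_⟩
  have hd : Differentiable ℂ (fun x => s.f τ x - x) :=
    (s.differentiable_f.comp ((differentiable_const τ).prodMk differentiable_id)).sub differentiable_id
  have h := norm_sub_le_of_entire hd (c := 0) (R := B) (C := C * ‖τ‖)
    (fun z hz => (hC τ z hτ (by simpa using hz)).1) (by simpa using hx) (by simpa using hy)
  calc _ = ‖(s.f τ x - x - (s.f τ y - y)) + (x - y)‖ := by congr 1; abel
    _ ≤ _ := norm_add_le _ _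
    _ ≤ _ := by linarith

theorem differentiable_M : Differentiable ℂ s.M := by
  have h := differentiable_fderiv_of_entire s.differentiable_f
  have h1 : Differentiable ℂ (fun x : X => fderiv ℂ (fun q : T × X => s.f q.1 q.2) (0, x)) :=
    h.comp ((differentiable_const 0).prodMk differentiable_id)
  exact h1.clm_comp (differentiable_const _)

theorem exists_norm_sub_sub_M_le (B : ℝ) : ∃ C, 0 < C ∧ ∀ (τ : T) (x : X), ‖τ‖ ≤ 1 → ‖x‖ ≤ B →
    ‖s.f τ x - x - s.M x τ‖ ≤ C * ‖τ‖ ^ 2 := by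
  obtain ⟨C, hC0, hC⟩ := exists_lipschitz_fderiv_of_entire s.differentiable_f (max 1 B)
  let : NormedSpace ℝ T := NormedSpace.restrictScalars ℝ ℂ T
  refine ⟨C + 1, by positivity, fun τ x hτ hx => ?_⟩
  have hmem : ∀ σ ∈ closedBall (0 : T) ‖τ‖, ((σ, x) : T × X) ∈ closedBall (0 : T × X) (max 1 B) := by
    intro σ hσ
    rw [mem_closedBall_zero_iff] at hσ ⊢
    rw [Prod.norm_def]
    exact max_le_max (hσ.trans hτ) hx
  have h := (convex_closedBall (0 : T) ‖τ‖).norm_image_sub_le_of_norm_hasFDerivWithin_le (𝕜 := ℂ)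
    (f := fun σ => s.f σ x - s.M x σ) (C := C * ‖τ‖)
    (fun σ _ => ((s.hasFDerivAt_f σ x).sub (s.M x).hasFDerivAt).hasFDerivWithinAt)
    (fun σ hσ => by
      rw [M, ← ContinuousLinearMap.sub_comp]
      refine (ContinuousLinearMap.opNorm_comp_le _ _).trans ?_
      have h1 := hC _ (hmem σ hσ) _ (hmem 0 (by simp))
      have h2 : ‖((σ, x) : T × X) - (0, x)‖ ≤ ‖τ‖ := by
        simpa [Prod.norm_def] using hσ
      have h3 := ContinuousLinearMap.norm_inl_le_one ℂ T X
      calc _ ≤ (C * ‖τ‖) * 1 := by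
            refine mul_le_mul (h1.trans (by gcongr)) h3 (norm_nonneg _) (by positivity)
        _ = _ := mul_one _)
    (x := 0) (y := τ) (by simp) (by simp)
  simp only [s.f_zero, map_zero, sub_zero] at h
  calc _ = ‖s.f τ x - s.M x τ - x‖ := by congr 1; abel
    _ ≤ _ := h
    _ = C * ‖τ‖ ^ 2 := by ring
    _ ≤ _ := by gcongr; linarith

/-- Automorphisms with small total parameter are close to the identity on a given ball. -/
theorem exists_total_norm_le (B : ℝ) {η : ℝ} (hη : 0 < η) : ∃ σ > 0, ∀ (l : List (W → T)) (w : W),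
    (l.map fun τ => ‖τ w‖).sum ≤ σ → ∀ x : X, ‖x‖ ≤ B →
      ‖s.act l w x - x‖ ≤ η ∧ ‖s.inv l w x - x‖ ≤ η := by
  obtain ⟨C, hC0, hC⟩ := s.exists_norm_sub_le (B + 1)
  refine ⟨min (min 1 η) 1 / (C + 1), by positivity, fun l w hl x hx => ?_⟩
  have hσ : (C + 1) * (l.map fun τ => ‖τ w‖).sum ≤ min (min 1 η) 1 := by
    rwa [le_div_iff₀' (by positivity)] at hl
  have hnn : ∀ l : List (W → T), 0 ≤ (l.map fun τ => ‖τ w‖).sum := fun l =>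
    List.sum_nonneg (by simp only [List.mem_map]; rintro _ ⟨τ, _, rfl⟩; exact norm_nonneg _)
  have h1 : (C + 1) * (l.map fun τ => ‖τ w‖).sum ≤ 1 := hσ.trans (min_le_right _ _)
  have h2 : (C + 1) * (l.map fun τ => ‖τ w‖).sum ≤ η :=
    hσ.trans ((min_le_left _ _).trans (min_le_right _ _))
  have h0 := hnn l
  have key1 : ∀ l : List (W → T), (C + 1) * (l.map fun τ => ‖τ w‖).sum ≤ 1 →
      ‖s.act l w x - x‖ ≤ C * (l.map fun τ => ‖τ w‖).sum := by
    intro l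
    induction l with
    | nil => intro _; simp [act]
    | cons τ l ih =>
      intro h
      simp only [List.map_cons, List.sum_cons] at h ⊢
      have hl0 := hnn l
      have hτ0 := norm_nonneg (τ w)
      have ih' := ih (by nlinarith)
      have hb : ‖s.act l w x‖ ≤ B + 1 := by
        have := norm_sub_norm_le (s.act l w x) x
        nlinarith
      have := (hC (τ w) _ (by nlinarith) hb).1
      calc _ = ‖(s.f (τ w) (s.act l w x) - s.act l w x) + (s.act l w x - x)‖ := by
            simp [act]
        _ ≤ _ := norm_add_le _ _
        _ ≤ _ := by linarith
  have key2 : ∀ (l : List (W → T)) (x : X), (C + 1) * (l.map fun τ => ‖τ w‖).sum ≤ 1 →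
      ‖x‖ + (C + 1) * (l.map fun τ => ‖τ w‖).sum ≤ B + 1 → 
      ‖s.inv l w x - x‖ ≤ C * (l.map fun τ => ‖τ w‖).sum := by
    intro l
    induction l with
    | nil => intro _ _; simp [inv]
    | cons τ l ih =>
      intro x h h'
      simp only [List.map_cons, List.sum_cons] at h h' ⊢
      have hl0 := hnn l
      have hτ0 := norm_nonneg (τ w)
      have h3 := (hC (τ w) x (by nlinarith) (by nlinarith)).2
      have h4 := norm_sub_norm_le (s.g (τ w) x) x
      have ih' := ih (s.g (τ w) x) (by nlinarith) (by nlinarith)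
      calc _ = ‖(s.inv l w (s.g (τ w) x) - s.g (τ w) x) + (s.g (τ w) x - x)‖ := by
            simp [inv]
        _ ≤ _ := norm_add_le _ _
        _ ≤ _ := by linarith
  exact ⟨(key1 l h1).trans (by linarith), (key2 l x h1 (by linarith)).trans (by linarith)⟩

end Spray

theorem ContinuousLinearMap.norm_pow_le_pow {V : Type*} [NormedAddCommGroup V] [NormedSpace ℂ V]
    {Q : V →L[ℂ] V} {q : ℝ} (hQ : ‖Q‖ ≤ q) (i : ℕ) : ‖Q ^ i‖ ≤ q ^ i := by
  have hq : 0 ≤ q := (norm_nonneg _).trans hQ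
  induction i with
  | zero => rw [pow_zero, pow_zero]; exact ContinuousLinearMap.norm_id_le
  | succ i ih =>
    rw [pow_succ, pow_succ]
    exact (norm_mul_le _ _).trans (mul_le_mul ih hQ (norm_nonneg _) (by positivity))

theorem exists_right_inverse_approx_of_near {m : ℕ} {T V : Type*} [NormedAddCommGroup T]
    [NormedSpace ℂ T] [FiniteDimensional ℂ T] [NormedAddCommGroup V] [NormedSpace ℂ V]
    [FiniteDimensional ℂ V] {N : (Fin m → ℂ) → T →L[ℂ] V} (hN : Differentiable ℂ N)
    (hs : ∀ w, Function.Surjective (N w)) (σ : V →L[ℂ] T) {R R' : ℝ} (hRR' : R ≤ R') (hR' : 0 ≤ R')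
    (hσ : ∀ w ∈ closedBall (0 : Fin m → ℂ) R, ‖1 - N w ∘L σ‖ ≤ 1 / 2) :
    ∃ C : ℝ, 0 ≤ C ∧ ∀ δ > 0, ∃ S : (Fin m → ℂ) → V →L[ℂ] T, Differentiable ℂ S ∧
      (∀ w ∈ closedBall (0 : Fin m → ℂ) R, ‖S w‖ ≤ 2 * ‖σ‖ + 1) ∧
      (∀ w ∈ closedBall (0 : Fin m → ℂ) R', ‖S w‖ ≤ C) ∧
      ∀ w ∈ closedBall (0 : Fin m → ℂ) R', ‖N w ∘L S w - 1‖ ≤ δ := by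
  obtain ⟨C, hC0, hC⟩ := exists_right_inverse_approx hN hs hR'
  have hQd : Differentiable ℂ (fun w => (1 : V →L[ℂ] V) - N w ∘L σ) :=
    (differentiable_const _).sub (hN.clm_comp (differentiable_const _))
  obtain ⟨q', hq0', hq'⟩ := exists_bound_of_continuous hQd.continuous 0 R'
  obtain ⟨q, hq0, hq⟩ : ∃ q : ℝ, 0 < q ∧ ∀ w ∈ closedBall (0 : Fin m → ℂ) R', ‖1 - N w ∘L σ‖ ≤ q :=
    ⟨q' + 1, by positivity, fun w hw => (hq' w hw).trans (by linarith)⟩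
  obtain ⟨L, hL⟩ : ∃ L : ℕ, C * (1 / 2 : ℝ) ^ L ≤ 1 := by
    have : Tendsto (fun J : ℕ => C * (1 / 2 : ℝ) ^ J) atTop (𝓝 0) := by
      simpa using (tendsto_pow_atTop_nhds_zero_of_lt_one (r := (1 / 2 : ℝ)) (by norm_num)
        (by norm_num)).const_mul C
    exact (this.eventually_le_const one_pos).exists
  have hbound : ∀ (Q : V →L[ℂ] V) (S : V →L[ℂ] T) (b : ℝ), ‖Q‖ ≤ b → ‖S‖ ≤ C →
      ‖σ ∘L (∑ i ∈ Finset.range L, Q ^ i) + S ∘L Q ^ L‖ ≤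
        ‖σ‖ * ∑ i ∈ Finset.range L, b ^ i + C * b ^ L := by
    intro Q S b hQ hS
    refine (norm_add_le _ _).trans (add_le_add ?_ ?_)
    · refine (ContinuousLinearMap.opNorm_comp_le _ _).trans ?_
      gcongr
      exact (norm_sum_le _ _).trans (Finset.sum_le_sum fun i _ =>
        ContinuousLinearMap.norm_pow_le_pow hQ i)
    · exact (ContinuousLinearMap.opNorm_comp_le _ _).trans
        (mul_le_mul hS (ContinuousLinearMap.norm_pow_le_pow hQ L) (norm_nonneg _) hC0)
  refine ⟨‖σ‖ * ∑ i ∈ Finset.range L, q ^ i + C * q ^ L, by positivity, fun δ hδ => ?_⟩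
  obtain ⟨S, hSd, hSC, hSδ⟩ := hC (δ / q ^ L) (by positivity)
  refine ⟨fun w => σ ∘L (∑ i ∈ Finset.range L, (1 - N w ∘L σ) ^ i) + S w ∘L (1 - N w ∘L σ) ^ L,
    ?_, fun w hw => ?_, fun w hw => hbound _ _ _ (hq w hw) (hSC w hw), fun w hw => ?_⟩
  · refine ((differentiable_const _).clm_comp (Differentiable.fun_sum fun i _ => hQd.pow i)).add
      (hSd.clm_comp (hQd.pow L))
  · refine (hbound _ _ _ (hσ w hw) (hSC w (closedBall_subset_closedBall hRR' hw))).trans ?_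
    have h2 : ∑ i ∈ Finset.range L, (1 / 2 : ℝ) ^ i ≤ 2 := sum_geometric_two_le L
    nlinarith [norm_nonneg σ]
  · set Q := 1 - N w ∘L σ with hQ
    have hN1 : N w ∘L σ = 1 - Q := by rw [hQ]; abel
    have e : N w ∘L (σ ∘L (∑ i ∈ Finset.range L, Q ^ i) + S w ∘L Q ^ L) - 1 =
        (N w ∘L S w - 1) * Q ^ L := by
      rw [ContinuousLinearMap.comp_add, ← ContinuousLinearMap.comp_assoc,
        ← ContinuousLinearMap.comp_assoc, hN1]
      change (1 - Q) * (∑ i ∈ Finset.range L, Q ^ i) + (N w ∘L S w) * Q ^ L - 1 = _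
      rw [mul_neg_geom_sum, sub_mul, one_mul]
      abel
    rw [e]
    calc _ ≤ ‖N w ∘L S w - 1‖ * ‖Q ^ L‖ := norm_mul_le _ _
      _ ≤ δ / q ^ L * q ^ L := mul_le_mul (hSδ w hw) (ContinuousLinearMap.norm_pow_le_pow (hq w hw) L)
          (norm_nonneg _) (by positivity)
      _ = δ := by field_simp

namespace Spray

variable {T V : Type*} [NormedAddCommGroup T] [NormedSpace ℂ T] [NormedAddCommGroup V]
  [NormedSpace ℂ V] (s : Spray T V)

/-- Newton iteration for the equation `s.f (σ x) ζ = p`. -/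
noncomputable def newton (σ : V →L[ℂ] T) (p : V) : ℕ → V → V
  | 0, _ => 0
  | i + 1, ζ => newton σ p i ζ - (s.f (σ (newton σ p i ζ)) ζ - p)

theorem differentiable_newton (σ : V →L[ℂ] T) (p : V) (i : ℕ) :
    Differentiable ℂ (s.newton σ p i) := by
  induction i with
  | zero => exact differentiable_const 0
  | succ i ih =>
    have h : Differentiable ℂ (fun ζ => s.f (σ (s.newton σ p i ζ)) ζ) :=
      s.differentiable_f.comp ((σ.differentiable.comp ih).prodMk differentiable_id)
    exact ih.sub (h.sub (differentiable_const p))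

theorem exists_newton_bound [FiniteDimensional ℂ T] [FiniteDimensional ℂ V] {σ : V →L[ℂ] T} {p : V} (hσ : s.M p ∘L σ = 1) :
    ∃ r > 0, ∀ i ζ, ‖ζ - p‖ ≤ r → ‖s.newton σ p i ζ‖ ≤ 2 * ‖ζ - p‖ ∧
      ‖s.f (σ (s.newton σ p i ζ)) ζ - p‖ ≤ (1 / 2) ^ i * ‖ζ - p‖ := by
  let : NormedSpace ℝ V := NormedSpace.restrictScalars ℝ ℂ V
  let H' : V × V → V →L[ℂ] V := fun q => 1 -
    ((fderiv ℂ (fun q : T × V => s.f q.1 q.2) (σ q.1, q.2)) ∘L ContinuousLinearMap.inl ℂ T V) ∘L σ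
  have hH' : Continuous H' := by
    have h := (differentiable_fderiv_of_entire s.differentiable_f).continuous
    have h2 : Continuous fun q : V × V => fderiv ℂ (fun q : T × V => s.f q.1 q.2) (σ q.1, q.2) :=
      h.comp ((σ.continuous.comp continuous_fst).prodMk continuous_snd)
    exact continuous_const.sub ((h2.clm_comp continuous_const).clm_comp continuous_const)
  have hH0 : H' (0, p) = 0 := by
    simp only [H', map_zero]
    rw [show fderiv ℂ (fun q : T × V => s.f q.1 q.2) (0, p) ∘L ContinuousLinearMap.inl ℂ T V = s.M p
      from rfl, hσ, sub_self]
  have hHd : ∀ x ζ, HasFDerivAt (fun x => x - s.f (σ x) ζ) (H' (x, ζ)) x := fun x ζ =>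
    (hasFDerivAt_id x).sub ((s.hasFDerivAt_f (σ x) ζ).comp x σ.hasFDerivAt)
  obtain ⟨ρ, hρ, hb⟩ : ∃ ρ > 0, ∀ q ∈ closedBall ((0, p) : V × V) ρ, ‖H' q‖ ≤ 1 / 2 := by
    have : ∀ᶠ q in 𝓝 ((0, p) : V × V), ‖H' q‖ ≤ 1 / 2 := by
      have ht : Tendsto (fun q => ‖H' q‖) (𝓝 ((0, p) : V × V)) (𝓝 0) := by
        have := hH'.norm.tendsto ((0, p) : V × V)
        rwa [hH0, norm_zero] at this
      exact ht.eventually_le_const (by norm_num)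
    exact Metric.nhds_basis_closedBall.mem_iff.mp this
  have hlip : ∀ ζ, ‖ζ - p‖ ≤ ρ → ∀ x ∈ closedBall (0 : V) ρ, ∀ y ∈ closedBall (0 : V) ρ,
      ‖(x - s.f (σ x) ζ) - (y - s.f (σ y) ζ)‖ ≤ 1 / 2 * ‖x - y‖ := by
    intro ζ hζ x hx y hy
    refine (convex_closedBall (0 : V) ρ).norm_image_sub_le_of_norm_hasFDerivWithin_le (𝕜 := ℂ)
      (fun z _ => (hHd z ζ).hasFDerivWithinAt) (fun z hz => hb _ ?_) hy hx
    rw [mem_closedBall, Prod.dist_eq, dist_eq_norm, dist_eq_norm]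
    exact max_le (by simpa using hz) hζ
  refine ⟨ρ / 2, by positivity, fun i ζ hζ => ?_⟩
  set d := ‖ζ - p‖ with hd
  have hd0 : 0 ≤ d := norm_nonneg _
  suffices h : ‖s.newton σ p i ζ‖ ≤ 2 * (1 - (1 / 2) ^ i) * d ∧
      ‖s.f (σ (s.newton σ p i ζ)) ζ - p‖ ≤ (1 / 2) ^ i * d by
    refine ⟨h.1.trans ?_, h.2⟩
    have : (0 : ℝ) ≤ (1 / 2) ^ i := by positivity
    nlinarith
  induction i with
  | zero => simp [newton, s.f_zero, hd]
  | succ i ih =>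
    obtain ⟨h1, h2⟩ := ih
    have hp : (0 : ℝ) ≤ (1 / 2) ^ i := by positivity
    have h3 : ‖s.newton σ p (i + 1) ζ‖ ≤ 2 * (1 - (1 / 2) ^ (i + 1)) * d := by
      refine (norm_sub_le _ _).trans ((add_le_add h1 h2).trans_eq ?_)
      ring
    refine ⟨h3, ?_⟩
    have h4 := hlip ζ (by linarith) (s.newton σ p i ζ) (by
      rw [mem_closedBall_zero_iff]; nlinarith) (s.newton σ p (i + 1) ζ) (by
      have : (0 : ℝ) ≤ (1 / 2) ^ (i + 1) := by positivity
      rw [mem_closedBall_zero_iff]; nlinarith)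
    have e1 : s.newton σ p i ζ - s.newton σ p (i + 1) ζ = s.f (σ (s.newton σ p i ζ)) ζ - p := by
      simp [newton]
    have e2 : s.newton σ p i ζ - s.f (σ (s.newton σ p i ζ)) ζ -
        (s.newton σ p (i + 1) ζ - s.f (σ (s.newton σ p (i + 1) ζ)) ζ) =
        s.f (σ (s.newton σ p (i + 1) ζ)) ζ - p := by
      have : s.newton σ p (i + 1) ζ = s.newton σ p i ζ - (s.f (σ (s.newton σ p i ζ)) ζ - p) := rfl
      generalize s.f (σ (s.newton σ p (i + 1) ζ)) ζ = a
      rw [this]; abel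
    rw [e1, e2] at h4
    calc _ ≤ _ := h4
      _ ≤ 1 / 2 * ((1 / 2) ^ i * d) := by gcongr
      _ = _ := by ring

end Spray

namespace Spray

variable {m : ℕ} {T V : Type*} [NormedAddCommGroup T] [NormedSpace ℂ T] [NormedAddCommGroup V]
  [NormedSpace ℂ V] (s : Spray T V)

/-- The parameter of the `k`-th of `L` Euler steps along the path `t ↦ γ (t w)` from `t = 1` to
`t = 0`. -/
noncomputable def eulerParam (γ : (Fin m → ℂ) → V) (S : (Fin m → ℂ) → V →L[ℂ] T) (L k : ℕ)
    (w : Fin m → ℂ) : T :=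
  S (((1 - k / L : ℝ) : ℂ) • w)
    (γ (((1 - (k + 1 : ℕ) / L : ℝ) : ℂ) • w) - γ (((1 - k / L : ℝ) : ℂ) • w))

/-- The first `k` Euler steps. -/
noncomputable def eulerWord (γ : (Fin m → ℂ) → V) (S : (Fin m → ℂ) → V →L[ℂ] T) (L : ℕ) :
    ℕ → List ((Fin m → ℂ) → T)
  | 0 => []
  | k + 1 => eulerParam γ S L k :: eulerWord γ S L k

theorem differentiable_of_mem_eulerWord {γ : (Fin m → ℂ) → V} (hγ : Differentiable ℂ γ)
    {S : (Fin m → ℂ) → V →L[ℂ] T} (hS : Differentiable ℂ S) (L k : ℕ) :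
    ∀ τ ∈ eulerWord γ S L k, Differentiable ℂ τ := by
  induction k with
  | zero => simp [eulerWord]
  | succ k ih =>
    intro τ hτ
    rcases List.mem_cons.mp hτ with rfl | h
    · unfold eulerParam
      exact Differentiable.clm_apply (by fun_prop) (by fun_prop)
    · exact ih τ h

theorem eulerParam_bounds {γ : (Fin m → ℂ) → V} {S : (Fin m → ℂ) → V →L[ℂ] T} {w : Fin m → ℂ}
    {R c e : ℝ} (hw : w ∈ closedBall 0 R) (he : 0 ≤ e)
    (hS : ∀ w ∈ closedBall (0 : Fin m → ℂ) R, ‖S w‖ ≤ c)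
    (hγ : ∀ w ∈ closedBall (0 : Fin m → ℂ) R, ∀ w' ∈ closedBall (0 : Fin m → ℂ) R,
      ‖γ w - γ w'‖ ≤ e * ‖w - w'‖) {L : ℕ} (hL : 0 < L) :
    (∀ j ≤ L, ((1 - j / L : ℝ) : ℂ) • w ∈ closedBall (0 : Fin m → ℂ) R) ∧
    (∀ j < L, ‖γ (((1 - (j + 1 : ℕ) / L : ℝ) : ℂ) • w) - γ (((1 - j / L : ℝ) : ℂ) • w)‖
      ≤ e * R / L) ∧
    (∀ j < L, ‖eulerParam γ S L j w‖ ≤ c * (e * R) / L) := by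
  have hL' : (0 : ℝ) < L := by exact_mod_cast hL
  rw [mem_closedBall_zero_iff] at hw
  have h1 : ∀ j ≤ L, ((1 - j / L : ℝ) : ℂ) • w ∈ closedBall (0 : Fin m → ℂ) R := by
    intro j hj
    have hj' : (j : ℝ) / L ≤ 1 := by
      rw [div_le_one hL']
      exact_mod_cast hj
    have hj0 : 0 ≤ (j : ℝ) / L := by positivity
    rw [mem_closedBall_zero_iff, norm_smul, Complex.norm_real, Real.norm_of_nonneg (by linarith)]
    nlinarith [norm_nonneg w]
  have h2 : ∀ j < L, ‖γ (((1 - (j + 1 : ℕ) / L : ℝ) : ℂ) • w) - γ (((1 - j / L : ℝ) : ℂ) • w)‖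
      ≤ e * R / L := by
    intro j hj
    refine (hγ _ (h1 (j + 1) hj) _ (h1 j hj.le)).trans ?_
    rw [← sub_smul, norm_smul, ← Complex.ofReal_sub, Complex.norm_real]
    have : (1 - ((j + 1 : ℕ) : ℝ) / L) - (1 - j / L) = -(1 / L) := by
      push_cast
      ring
    rw [this, norm_neg, Real.norm_of_nonneg (by positivity), mul_div_assoc]
    gcongr
    rw [one_div_mul_eq_div]
    gcongr
  refine ⟨h1, h2, fun j hj => ?_⟩
  refine (ContinuousLinearMap.le_opNorm _ _).trans ?_
  rw [mul_div_assoc]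
  exact mul_le_mul (hS _ (h1 j hj.le)) (h2 j hj) (norm_nonneg _)
    ((norm_nonneg _).trans (hS _ (h1 j hj.le)))

theorem sum_eulerWord_le {γ : (Fin m → ℂ) → V} {S : (Fin m → ℂ) → V →L[ℂ] T} {w : Fin m → ℂ}
    {R c e : ℝ} (hw : w ∈ closedBall 0 R) (he : 0 ≤ e)
    (hS : ∀ w ∈ closedBall (0 : Fin m → ℂ) R, ‖S w‖ ≤ c)
    (hγ : ∀ w ∈ closedBall (0 : Fin m → ℂ) R, ∀ w' ∈ closedBall (0 : Fin m → ℂ) R,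
      ‖γ w - γ w'‖ ≤ e * ‖w - w'‖) {L : ℕ} (hL : 0 < L) :
    ((eulerWord γ S L L).map fun τ => ‖τ w‖).sum ≤ c * (e * R) := by
  have h := (eulerParam_bounds hw he hS hγ hL).2.2
  have key : ∀ k ≤ L, ((eulerWord γ S L k).map fun τ => ‖τ w‖).sum ≤ k * (c * (e * R) / L) := by
    intro k
    induction k with
    | zero => simp [eulerWord]
    | succ k ih =>
      intro hk
      have h1 := ih (by omega)
      have h2 := h k (by omega)
      simp only [eulerWord, List.map_cons, List.sum_cons]
      push_cast
      linarith
  refine (key L le_rfl).trans_eq ?_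
  have : (L : ℝ) ≠ 0 := by positivity
  field_simp

theorem exists_euler [FiniteDimensional ℂ T] [FiniteDimensional ℂ V] {γ : (Fin m → ℂ) → V}
    (hγ : Differentiable ℂ γ) (R C ε : ℝ) (hR : 0 ≤ R) (hC : 0 ≤ C) (hε : 0 < ε) :
    ∃ δ > 0, ∀ S : (Fin m → ℂ) → V →L[ℂ] T, (∀ w ∈ closedBall (0 : Fin m → ℂ) R, ‖S w‖ ≤ C) →
      (∀ w ∈ closedBall (0 : Fin m → ℂ) R, ‖s.M (γ w) ∘L S w - 1‖ ≤ δ) →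
      ∃ L : ℕ, 0 < L ∧ ∀ w ∈ closedBall (0 : Fin m → ℂ) R,
        ‖s.act (eulerWord γ S L L) w (γ w) - γ 0‖ ≤ ε := by
  obtain ⟨G, hG0, hG⟩ := exists_bound_of_continuous hγ.continuous 0 (R + 1)
  obtain ⟨C₂, hC₂, h₂⟩ := s.exists_norm_sub_sub_le (G + 1)
  obtain ⟨C₃, hC₃, h₃⟩ := s.exists_norm_sub_sub_M_le (G + 1)
  set g := G * R with hg
  have hg0 : 0 ≤ g := by positivity
  set a := C₂ * (C * g) with ha
  set b := C₃ * (C * g) ^ 2 with hb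
  have ha0 : 0 ≤ a := by positivity
  have hb0 : 0 ≤ b := by positivity
  set μ := min 1 ε with hμ
  have hμ0 : 0 < μ := by positivity
  refine ⟨μ / (2 * Real.exp a * (g + 1)), by positivity, fun S hS hMS => ?_⟩
  set δ := μ / (2 * Real.exp a * (g + 1)) with hδ
  have hδ0 : 0 < δ := by positivity
  obtain ⟨L, hL⟩ := exists_nat_gt (2 * Real.exp a * b / μ + C * g + 1)
  have hq : 0 ≤ 2 * Real.exp a * b / μ := by positivity
  have hCg : 0 ≤ C * g := by positivity
  have hL0 : (0 : ℝ) < L := by linarith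
  have hLn : 0 < L := by exact_mod_cast hL0
  set β := b / L + δ * g with hβ
  have hβ0 : 0 ≤ β := by positivity
  have hβμ : Real.exp a * β ≤ μ := by
    have e1 : Real.exp a * (b / L) ≤ μ / 2 := by
      have : 2 * Real.exp a * b / μ ≤ L := by linarith
      rw [div_le_iff₀ hμ0] at this
      rw [← mul_div_assoc, div_le_iff₀ hL0]
      linarith
    have e2 : Real.exp a * (δ * g) ≤ μ / 2 := by
      have : Real.exp a * (δ * (g + 1)) = μ / 2 := by
        rw [hδ]
        field_simp
      have : Real.exp a * (δ * g) ≤ Real.exp a * (δ * (g + 1)) := by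
        gcongr
        linarith
      linarith
    rw [hβ, mul_add]
    linarith
  have hγL : ∀ w ∈ closedBall (0 : Fin m → ℂ) R, ∀ w' ∈ closedBall (0 : Fin m → ℂ) R,
      ‖γ w - γ w'‖ ≤ G * ‖w - w'‖ := fun w hw w' hw' => norm_sub_le_of_entire hγ hG hw hw'
  refine ⟨L, hLn, fun w hw => ?_⟩
  obtain ⟨hb1, hb2, hb3⟩ := eulerParam_bounds hw hG0 hS hγL hLn
  have hτ1 : C * g / L ≤ 1 := by
    rw [div_le_one hL0]
    linarith
  have hbound : ∀ k ≤ L, (k / L : ℝ) * (1 + a / L) ^ k * β ≤ μ := by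
    intro k hk
    have hk' : (k : ℝ) / L ≤ 1 := by
      rw [div_le_one hL0]
      exact_mod_cast hk
    have hk0 : 0 ≤ (k : ℝ) / L := by positivity
    have h1 : (1 + a / L) ^ k ≤ Real.exp a := by
      calc (1 + a / L) ^ k ≤ Real.exp (a / L) ^ k := by
            gcongr
            linarith [Real.add_one_le_exp (a / L)]
        _ = Real.exp (a * (k / L)) := by
            rw [← Real.exp_nat_mul]
            congr 1
            ring
        _ ≤ _ := by
            rw [Real.exp_le_exp]
            nlinarith
    calc (k / L : ℝ) * (1 + a / L) ^ k * β ≤ 1 * Real.exp a * β := by gcongr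
      _ ≤ μ := by rwa [one_mul]
  have key : ∀ k ≤ L, ‖s.act (eulerWord γ S L k) w (γ w) - γ (((1 - k / L : ℝ) : ℂ) • w)‖
      ≤ (k / L : ℝ) * (1 + a / L) ^ k * β := by
    intro k
    induction k with
    | zero => simp [eulerWord, act]
    | succ k ih =>
      intro hk
      have hkL : k < L := by omega
      have e0 := ih hkL.le
      have e1 := e0.trans (hbound k hkL.le)
      set x := s.act (eulerWord γ S L k) w (γ w) with hx
      set p := γ (((1 - k / L : ℝ) : ℂ) • w) with hp
      set p' := γ (((1 - (k + 1 : ℕ) / L : ℝ) : ℂ) • w) with hp'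
      set τ := eulerParam γ S L k w with hτ
      have hpG : ‖p‖ ≤ G := hG _ (closedBall_subset_closedBall (by linarith) (hb1 k hkL.le))
      have hxG : ‖x‖ ≤ G + 1 := by
        have := norm_add_le (x - p) p
        rw [sub_add_cancel] at this
        linarith [min_le_left 1 ε]
      have hτL : ‖τ‖ ≤ C * g / L := hb3 k hkL
      have f1 := h₂ τ x p (hτL.trans hτ1) hxG (by linarith)
      have f2 := h₃ τ p (hτL.trans hτ1) (by linarith)
      have f3 : ‖s.M p τ - (p' - p)‖ ≤ δ * (g / L) := by
        have : s.M p τ - (p' - p) = (s.M p ∘L S (((1 - k / L : ℝ) : ℂ) • w) - 1) (p' - p) := rfl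
        rw [this]
        exact (ContinuousLinearMap.le_opNorm _ _).trans
          (mul_le_mul (hMS _ (hb1 k hkL.le)) (hb2 k hkL) (norm_nonneg _) hδ0.le)
      have f4 : ‖s.f τ x - p'‖ ≤ ‖s.f τ x - s.f τ p‖ + ‖s.f τ p - p - s.M p τ‖
          + ‖s.M p τ - (p' - p)‖ := by
        have : s.f τ x - p' = (s.f τ x - s.f τ p) + (s.f τ p - p - s.M p τ)
          + (s.M p τ - (p' - p)) := by abel
        rw [this]
        exact norm_add₃_le
      have f1' : ‖s.f τ x - s.f τ p‖ ≤ (1 + a / L) * ((k / L : ℝ) * (1 + a / L) ^ k * β) := by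
        refine f1.trans ?_
        have : C₂ * ‖τ‖ ≤ a / L := by
          rw [ha, mul_div_assoc]
          gcongr
        gcongr
      have f2' : ‖s.f τ p - p - s.M p τ‖ ≤ b / L * (1 / L) := by
        refine f2.trans ?_
        have : b / L * (1 / L) = C₃ * (C * g / L) ^ 2 := by
          rw [hb]
          ring
        rw [this]
        gcongr
      have hone : 1 ≤ (1 + a / L) ^ (k + 1) := one_le_pow₀ (by linarith [div_nonneg ha0 hL0.le])
      change ‖s.f τ x - p'‖ ≤ _
      calc _ ≤ (1 + a / L) * ((k / L : ℝ) * (1 + a / L) ^ k * β) + b / L * (1 / L)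
            + δ * (g / L) := by linarith
        _ = (k / L : ℝ) * (1 + a / L) ^ (k + 1) * β + 1 * (β / L) := by
          rw [hβ]
          ring
        _ ≤ (k / L : ℝ) * (1 + a / L) ^ (k + 1) * β + (1 + a / L) ^ (k + 1) * (β / L) := by
          gcongr
        _ = _ := by
          push_cast
          ring
  have h := (key L le_rfl).trans (hbound L le_rfl)
  have e : ((1 - (L : ℝ) / L : ℝ) : ℂ) • w = 0 := by
    rw [div_self hL0.ne']
    simp
  rw [e] at h
  exact h.trans (min_le_right _ _)

end Spray

namespace Spray

variable {m : ℕ} {T V E : Type*} [NormedAddCommGroup T] [NormedSpace ℂ T] [NormedAddCommGroup V]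
  [NormedSpace ℂ V] [NormedAddCommGroup E] [NormedSpace ℂ E]

/-- Every entire map into `U` which is `ε`-close to the constant `p₀` on the ball of radius `R + 1`
can be moved arbitrarily close to `p₀` on any given larger ball, by words in the spray that differ
only in their last letter and which act on `E` almost like the identity over the ball of
radius `R`. -/
def Correctable (sV : Spray T V) (sE : Spray T E) (U : Set V) (p₀ : V) (m : ℕ) (R B η ε : ℝ) :
    Prop :=
  ∀ γ : (Fin m → ℂ) → V, Differentiable ℂ γ → (∀ w, γ w ∈ U) →
    (∀ w ∈ closedBall (0 : Fin m → ℂ) (R + 1), ‖γ w - p₀‖ ≤ ε) → ∀ R', R ≤ R' → 0 ≤ R' →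
    ∃ (l : List ((Fin m → ℂ) → T)) (τ : ℕ → (Fin m → ℂ) → T),
      (∀ τ ∈ l, Differentiable ℂ τ) ∧ (∀ i, Differentiable ℂ (τ i)) ∧
      (∀ i, ∀ w ∈ closedBall (0 : Fin m → ℂ) R, ∀ x, ‖x‖ ≤ B →
        ‖sE.act (τ i :: l) w x - x‖ ≤ η ∧ ‖sE.inv (τ i :: l) w x - x‖ ≤ η) ∧
      (∀ ε' > 0, ∃ i, ∀ w ∈ closedBall (0 : Fin m → ℂ) R',
        ‖sV.act (τ i :: l) w (γ w) - p₀‖ ≤ ε') ∧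
      ∃ C, ∀ i, ∀ w ∈ closedBall (0 : Fin m → ℂ) R', ‖τ i w‖ ≤ C

theorem Correctable.mono {sV : Spray T V} {sE : Spray T E} {U : Set V} {p₀ : V} {R B η ε ε' : ℝ}
    (h : Correctable sV sE U p₀ m R B η ε) (hε : ε' ≤ ε) : Correctable sV sE U p₀ m R B η ε' :=
  fun γ h1 h2 h3 => h γ h1 h2 fun w hw => (h3 w hw).trans hε

variable [FiniteDimensional ℂ T] [FiniteDimensional ℂ V] [FiniteDimensional ℂ E]

theorem exists_correctable (sV : Spray T V) (sE : Spray T E) {U : Set V}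
    (hsurj : ∀ x ∈ U, Function.Surjective (sV.M x)) {p₀ : V} (hp₀ : p₀ ∈ U) {R B η : ℝ}
    (hR : 0 ≤ R + 1) (hη : 0 < η) : ∃ ε > 0, Correctable sV sE U p₀ m R B η ε := by
  have : CompleteSpace V := FiniteDimensional.complete ℂ V
  have : CompleteSpace T := FiniteDimensional.complete ℂ T
  obtain ⟨σ₀, hσ₀⟩ := (sV.M p₀).exists_rightInverse_of_surjective
    (LinearMap.range_eq_top.mpr (hsurj p₀ hp₀))
  obtain ⟨r, hr, hnewton⟩ := sV.exists_newton_bound (σ := σ₀) (p := p₀) hσ₀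
  obtain ⟨σ, hσ, htotal⟩ := sE.exists_total_norm_le (W := Fin m → ℂ) B hη
  have hcont : Continuous fun ζ => (1 : V →L[ℂ] V) - sV.M ζ ∘L σ₀ :=
    continuous_const.sub (sV.differentiable_M.continuous.clm_comp continuous_const)
  obtain ⟨ε₁, hε₁, hnear⟩ := 
    Metric.continuousAt_iff.mp (hcont.continuousAt (x := p₀)) (1 / 2) (by norm_num)
  have hnear' : ∀ ζ, ‖ζ - p₀‖ < ε₁ → ‖(1 : V →L[ℂ] V) - sV.M ζ ∘L σ₀‖ ≤ 1 / 2 := by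
    intro ζ hζ
    have h := hnear (x := ζ) (by rwa [dist_eq_norm])
    rw [dist_eq_norm, hσ₀] at h
    have e : (1 : V →L[ℂ] V) - sV.M ζ ∘L σ₀ - (1 - ContinuousLinearMap.id ℂ V)
      = 1 - sV.M ζ ∘L σ₀ := by
      have : (1 : V →L[ℂ] V) - ContinuousLinearMap.id ℂ V = 0 := sub_self _
      rw [this, sub_zero]
    rw [e] at h
    exact h.le
  set c := 2 * ‖σ₀‖ + 1 with hc
  set D := 4 * ‖σ₀‖ + c * |R| + 1 with hD
  have hD0 : 0 < D := by positivity
  refine ⟨min (ε₁ / 2) (min (r / 2) (σ / D)), by positivity, ?_⟩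
  set ε := min (ε₁ / 2) (min (r / 2) (σ / D)) with hε
  have hε0 : 0 < ε := by positivity
  have hεε₁ : ε ≤ ε₁ / 2 := min_le_left _ _
  have hεr : ε ≤ r / 2 := (min_le_right _ _).trans (min_le_left _ _)
  have hεD : ε * D ≤ σ := by
    rw [← le_div_iff₀ hD0]
    exact (min_le_right _ _).trans (min_le_right _ _)
  intro γ hγ hγU hγε R' hRR' hR'
  have hRR1 : closedBall (0 : Fin m → ℂ) R ⊆ closedBall 0 (R + 1) :=
    closedBall_subset_closedBall (by linarith)
  obtain ⟨C, hC0, hC⟩ := exists_right_inverse_approx_of_near (N := fun w => sV.M (γ w))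
    (sV.differentiable_M.comp hγ) (fun w => hsurj _ (hγU w)) σ₀ hRR' hR'
    (fun w hw => hnear' _ ((hγε w (hRR1 hw)).trans_lt (by linarith)))
  obtain ⟨δ, hδ, heuler⟩ := sV.exists_euler hγ R' C ε hR' hC0 hε0
  obtain ⟨S, hS, hSR, hSR', hSδ⟩ := hC δ hδ
  obtain ⟨L, hL, hact⟩ := heuler S hSR' hSδ
  have hl := differentiable_of_mem_eulerWord hγ hS L L
  set l := eulerWord γ S L L with hldef
  have hγ0 : ‖γ 0 - p₀‖ ≤ ε := hγε 0 (mem_closedBall_self hR)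
  have hactp : ∀ w ∈ closedBall (0 : Fin m → ℂ) R', ‖sV.act l w (γ w) - p₀‖ ≤ 2 * ε := by
    intro w hw
    have := norm_sub_le_norm_sub_add_norm_sub (sV.act l w (γ w)) (γ 0) p₀
    linarith [hact w hw]
  have hdact : Differentiable ℂ fun w => sV.act l w (γ w) :=
    (sV.differentiable_act hl).comp (differentiable_id.prodMk hγ)
  have hletter : ∀ i, ∀ w ∈ closedBall (0 : Fin m → ℂ) R',
      ‖σ₀ (sV.newton σ₀ p₀ i (sV.act l w (γ w)))‖ ≤ 4 * ‖σ₀‖ * ε := by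
    intro i w hw
    have h1 := hactp w hw
    have h2 := (hnewton i _ (h1.trans (by linarith))).1
    calc _ ≤ ‖σ₀‖ * ‖sV.newton σ₀ p₀ i (sV.act l w (γ w))‖ := σ₀.le_opNorm _
      _ ≤ ‖σ₀‖ * (2 * (2 * ε)) := by
        gcongr
        linarith
      _ = _ := by ring
  refine ⟨l, fun i w => σ₀ (sV.newton σ₀ p₀ i (sV.act l w (γ w))), hl,
    fun i => σ₀.differentiable.comp ((sV.differentiable_newton σ₀ p₀ i).comp hdact),
    fun i w hw x hx => ?_, fun ε' hε' => ?_, _, hletter⟩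
  · refine htotal _ w ?_ x hx
    simp only [List.map_cons, List.sum_cons]
    have h1 := hletter i w (closedBall_subset_closedBall hRR' hw)
    have hlip : ∀ w ∈ closedBall (0 : Fin m → ℂ) R, ∀ w' ∈ closedBall (0 : Fin m → ℂ) R,
        ‖γ w - γ w'‖ ≤ ε * ‖w - w'‖ := by
      intro w hw w' hw'
      have := norm_sub_le_of_entire (hγ.sub (differentiable_const p₀)) (c := 0) (R := R) (C := ε)
        hγε hw hw'
      simpa using this
    have h2 := sum_eulerWord_le hw hε0.le hSR hlip hL
    have h3 : c * (ε * R) ≤ ε * (c * |R|) := by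
      have := le_abs_self R
      have hc0 : 0 ≤ c * ε := by positivity
      nlinarith
    rw [hD] at hεD
    linarith
  · obtain ⟨i, hi⟩ := exists_pow_lt_of_lt_one (show 0 < ε' / (2 * ε) by positivity)
      (show (1 / 2 : ℝ) < 1 by norm_num)
    refine ⟨i, fun w hw => ?_⟩
    have h1 := hactp w hw
    have h2 := (hnewton i _ (h1.trans (by linarith))).2
    change ‖sV.f (σ₀ (sV.newton σ₀ p₀ i (sV.act l w (γ w)))) (sV.act l w (γ w)) - p₀‖ ≤ ε'
    refine h2.trans ?_
    rw [lt_div_iff₀ (by positivity)] at hi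
    refine le_trans ?_ hi.le
    gcongr

/-- The inductive condition on the words whose limit is the automorphism to be constructed. -/
def Good (sV : Spray T V) (sE : Spray T E) (U : Set V) (p₀ : V) (γ : (Fin m → ℂ) → V) (j : ℕ)
    (l : List ((Fin m → ℂ) → T)) : Prop :=
  (∀ τ ∈ l, Differentiable ℂ τ) ∧ ∃ B η ε : ℝ,
    (j ≤ B ∧ ∀ w ∈ closedBall (0 : Fin m → ℂ) j, ∀ x, ‖x‖ ≤ j → ‖sE.act l w x‖ ≤ B) ∧
    (η ≤ (1 / 2) ^ j ∧ ∀ w ∈ closedBall (0 : Fin m → ℂ) j, ∀ x x', ‖x‖ ≤ j + 1 → ‖x'‖ ≤ j + 1 →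
      ‖x - x'‖ ≤ η → ‖sE.inv l w x - sE.inv l w x'‖ ≤ (1 / 2) ^ j) ∧
    (ε ≤ (1 / 2) ^ j ∧ Correctable sV sE U p₀ m (j - 1) B η ε) ∧
    ∀ w ∈ closedBall (0 : Fin m → ℂ) j, ‖sV.act l w (γ w) - p₀‖ ≤ ε

theorem good_zero (sV : Spray T V) (sE : Spray T E) {U : Set V}
    (hsurj : ∀ x ∈ U, Function.Surjective (sV.M x)) {p₀ : V} (hp₀ : p₀ ∈ U)
    {γ : (Fin m → ℂ) → V} (hγ0 : γ 0 = p₀) : Good sV sE U p₀ γ 0 [] := by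
  obtain ⟨ε, hε, hcorr⟩ := exists_correctable (m := m) sV sE hsurj hp₀ (R := -1) (B := 0)
    (η := 1) (by norm_num) one_pos
  refine ⟨by simp, 0, 1, min ε 1, ⟨by simp, ?_⟩, ⟨by simp, ?_⟩,
    ⟨by simp, by simpa using hcorr.mono (min_le_left _ _)⟩, ?_⟩
  · intro w _ x hx
    simpa [act] using hx
  · intro w _ x x' _ _ h
    simpa [inv] using h
  · intro w hw
    have : w = 0 := by simpa using hw
    rw [this]
    simp [act, hγ0, hε.le]

theorem Good.exists_succ {sV : Spray T V} {sE : Spray T E} {U : Set V}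
    (hU : ∀ τ, ∀ x ∈ U, sV.f τ x ∈ U)
    (hsurj : ∀ x ∈ U, Function.Surjective (sV.M x)) {p₀ : V} (hp₀ : p₀ ∈ U)
    {γ : (Fin m → ℂ) → V} (hγ : Differentiable ℂ γ) (hγU : ∀ w, γ w ∈ U) {j : ℕ}
    {l : List ((Fin m → ℂ) → T)} (h : Good sV sE U p₀ γ j l) :
    ∃ l', Good sV sE U p₀ γ (j + 1) l' ∧ ∀ w ∈ closedBall (0 : Fin m → ℂ) (j - 1), ∀ x, ‖x‖ ≤ j →
      ‖sE.act l' w x - sE.act l w x‖ ≤ (1 / 2) ^ j ∧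
      ‖sE.inv l' w x - sE.inv l w x‖ ≤ (1 / 2) ^ j := by
  obtain ⟨hl, B, η, ε, ⟨hjB, hB⟩, ⟨hη, hinv⟩, ⟨hε, hcorr⟩, hclose⟩ := h
  obtain ⟨l', τ, hl', hτ, hsmall, happrox, C, hC⟩ := hcorr (fun w => sV.act l w (γ w))
    ((sV.differentiable_act hl).comp (differentiable_id.prodMk hγ))
    (fun w => sV.act_mem hU l w (hγU w)) (by simpa using hclose) (j + 1) (by linarith) (by positivity)
  have hll' : ∀ τ ∈ l' ++ l, Differentiable ℂ τ := by
    intro τ h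
    rcases List.mem_append.mp h with h | h
    exacts [hl' τ h, hl τ h]
  have : ProperSpace (T × (Fin m → ℂ) × E) := FiniteDimensional.proper ℂ _
  set ρ : ℝ := max C (j + 2) with hρ
  have hdf : Differentiable ℂ fun q : T × (Fin m → ℂ) × E =>
      sE.f q.1 (sE.act (l' ++ l) q.2.1 q.2.2) :=
    sE.differentiable_f.comp (differentiable_fst.prodMk
      ((sE.differentiable_act hll').comp differentiable_snd))
  have hdg : Differentiable ℂ fun q : T × (Fin m → ℂ) × E =>
      sE.inv (l' ++ l) q.2.1 (sE.g q.1 q.2.2) := by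
    have h1 : Differentiable ℂ fun q : T × (Fin m → ℂ) × E => sE.g q.1 q.2.2 :=
      sE.differentiable_g.comp (f := fun q : T × (Fin m → ℂ) × E => (q.1, q.2.2)) (by fun_prop)
    exact (sE.differentiable_inv hll').comp
      ((differentiable_fst.comp differentiable_snd).prodMk h1)
  obtain ⟨B', hB0', hB'⟩ := exists_bound_of_continuous hdf.continuous 0 ρ
  obtain ⟨Λ, hΛ0, hΛ⟩ := exists_bound_of_continuous hdg.continuous 0 (ρ + 1)
  set η' : ℝ := min 1 (1 / (Λ + 1)) * (1 / 2) ^ (j + 1) with hη'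
  have hη'0 : 0 < η' := by positivity
  obtain ⟨ε', hε', hcorr'⟩ := exists_correctable (m := m) sV sE hsurj hp₀ (R := j)
    (B := max B' (j + 1)) (by positivity) hη'0
  obtain ⟨i, hi⟩ := happrox (min ε' ((1 / 2) ^ (j + 1))) (by positivity)
  have hmem : ∀ w ∈ closedBall (0 : Fin m → ℂ) ((j + 1 : ℕ) : ℝ), ∀ x : E, ‖x‖ ≤ j + 2 →
      ((τ i w, w, x) : T × (Fin m → ℂ) × E) ∈ closedBall 0 ρ := by
    intro w hw x hx
    push_cast at hw
    have h1 := hC i w hw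
    rw [mem_closedBall_zero_iff] at hw ⊢
    rw [Prod.norm_def, Prod.norm_def]
    exact max_le (h1.trans (le_max_left _ _))
      ((max_le (hw.trans (by linarith)) hx).trans (le_max_right _ _))
  refine ⟨τ i :: (l' ++ l), ⟨?_, max B' (j + 1), η', min ε' ((1 / 2) ^ (j + 1)),
    ⟨by push_cast; exact le_max_right _ _, ?_⟩, ⟨?_, ?_⟩,
    ⟨min_le_right _ _, by simpa using hcorr'.mono (min_le_left _ _)⟩, ?_⟩, ?_⟩
  · intro τ' h
    rcases List.mem_cons.mp h with rfl | h
    exacts [hτ i, hll' τ' h]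
  · intro w hw x hx
    push_cast at hx
    exact (hB' _ (hmem w hw x (by linarith))).trans (le_max_left _ _)
  · rw [hη']
    exact mul_le_of_le_one_left (by positivity) (min_le_left _ _)
  · intro w hw x x' hx hx' hxx'
    push_cast at hx hx'
    have h1 := norm_sub_le_of_entire hdg hΛ (hmem w hw x (by linarith))
      (hmem w hw x' (by linarith))
    have e : ‖((τ i w, w, x) : T × (Fin m → ℂ) × E) - (τ i w, w, x')‖ = ‖x - x'‖ := by
      simp [Prod.norm_def]
    rw [e] at h1
    refine h1.trans ?_
    calc Λ * ‖x - x'‖ ≤ (Λ + 1) * η' := by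
          gcongr
          linarith
      _ ≤ (Λ + 1) * (1 / (Λ + 1) * (1 / 2) ^ (j + 1)) := by
          rw [hη']
          gcongr
          exact min_le_right _ _
      _ = _ := by
          field_simp
  · intro w hw
    push_cast at hw
    have := hi w hw
    rwa [← List.cons_append, act_append]
  · intro w hw x hx
    have hwj : w ∈ closedBall (0 : Fin m → ℂ) j := closedBall_subset_closedBall (by linarith) hw
    rw [← List.cons_append, act_append, inv_append]
    have h1 := (hsmall i w hw _ (hB w hwj x hx)).1
    have h2 := (hsmall i w hw x (hx.trans hjB)).2
    refine ⟨h1.trans hη, hinv w hwj _ _ ?_ (by linarith) h2⟩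
    have h3 := norm_sub_norm_le (sE.inv (τ i :: l') w x) x
    have h4 : ((1 : ℝ) / 2) ^ j ≤ 1 := pow_le_one₀ (by norm_num) (by norm_num)
    linarith

end Spray

theorem exists_limit_of_norm_sub_le {X E : Type*} [NormedAddCommGroup X] [NormedSpace ℂ X]
    [NormedAddCommGroup E] [NormedSpace ℂ E] [CompleteSpace E] {f : ℕ → X → E}
    (hf : ∀ j, Differentiable ℂ (f j))
    (h : ∀ (j : ℕ) q, ‖q‖ + 1 ≤ j → ‖f (j + 1) q - f j q‖ ≤ (1 / 2) ^ j) :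
    ∃ g : X → E, Differentiable ℂ g ∧ (∀ q, Tendsto (fun j => f j q) atTop (𝓝 (g q))) ∧
      ∀ R, TendstoUniformlyOn f g atTop (closedBall 0 R) := by
  have hgeo : ∀ q (J : ℕ), ‖q‖ + 1 ≤ J → ∀ i,
      dist (f (i + J) q) (f (i + 1 + J) q) ≤ (1 / 2) ^ J * (1 / 2) ^ i := by
    intro q J hJ i
    have h1 := h (i + J) q (by push_cast; linarith [i.cast_nonneg (α := ℝ)])
    rw [dist_comm, dist_eq_norm, ← pow_add, add_comm J i, add_right_comm]
    exact h1
  have hlim : ∀ q, ∃ y, Tendsto (fun j => f j q) atTop (𝓝 y) := by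
    intro q
    obtain ⟨J, hJ⟩ := exists_nat_ge (‖q‖ + 1)
    obtain ⟨y, hy⟩ := cauchySeq_tendsto_of_complete
      (cauchySeq_of_le_geometric (1 / 2) _ (by norm_num) (hgeo q J hJ))
    exact ⟨y, (tendsto_add_atTop_iff_nat (f := fun j => f j q) J).mp hy⟩
  choose g hg using hlim
  have hdist : ∀ q (J : ℕ), ‖q‖ + 1 ≤ J → dist (f J q) (g q) ≤ 2 * (1 / 2) ^ J := by
    intro q J hJ
    have h1 := dist_le_of_le_geometric_of_tendsto₀ (1 / 2) _ (by norm_num) (hgeo q J hJ)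
      ((tendsto_add_atTop_iff_nat (f := fun j => f j q) J).mpr (hg q))
    rw [zero_add] at h1
    refine h1.trans_eq ?_
    ring
  have hunif : ∀ R, TendstoUniformlyOn f g atTop (closedBall 0 R) := by
    intro R
    rw [Metric.tendstoUniformlyOn_iff]
    intro ε hε
    have h0 : Tendsto (fun J : ℕ => 2 * (1 / 2 : ℝ) ^ J) atTop (𝓝 0) := by
      simpa using (tendsto_pow_atTop_nhds_zero_of_lt_one (r := (1 / 2 : ℝ)) (by norm_num)
        (by norm_num)).const_mul 2
    filter_upwards [h0.eventually (gt_mem_nhds hε),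
      tendsto_natCast_atTop_atTop.eventually_ge_atTop (R + 1)] with J hJ hJR q hq
    rw [mem_closedBall_zero_iff] at hq
    rw [dist_comm]
    exact (hdist q J (by linarith)).trans_lt hJ
  exact ⟨g, differentiable_of_tendstoUniformlyOn_closedBall hf hunif, hg, hunif⟩

namespace Spray

variable {m : ℕ} {T V : Type*} [NormedAddCommGroup T] [NormedSpace ℂ T] [NormedAddCommGroup V]
  [NormedSpace ℂ V] [FiniteDimensional ℂ T] [FiniteDimensional ℂ V]

theorem eventually_exists_f_eq (s : Spray T V) {y : V} (hy : Function.Surjective (s.M y)) :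
    ∀ᶠ q : V × V in 𝓝 (y, y), ∃ τ, s.f τ q.2 = q.1 := by
  have : CompleteSpace V := FiniteDimensional.complete ℂ V
  have : CompleteSpace T := FiniteDimensional.complete ℂ T
  have hd : HasStrictFDerivAt (fun q : T × V => s.f q.1 q.2)
      (fderiv ℂ (fun q : T × V => s.f q.1 q.2) (0, y)) (0, y) :=
    ((contDiff_of_entire s.differentiable_f (k := 1)).contDiffAt (x := ((0 : T), y))).hasStrictFDerivAt (by simp)
  set D := fderiv ℂ (fun q : T × V => s.f q.1 q.2) (0, y) with hD
  have h2 : HasStrictFDerivAt (fun q : T × V => (s.f q.1 q.2, q.2))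
    (D.prod (ContinuousLinearMap.snd ℂ T V)) (0, y) := hd.prodMk hasStrictFDerivAt_snd
  have hsurj : Function.Surjective (D.prod (ContinuousLinearMap.snd ℂ T V)) := by
    rintro ⟨a, b⟩
    obtain ⟨τ, hτ⟩ := hy (a - D (0, b))
    refine ⟨(τ, b), ?_⟩
    have h3 : D (τ, b) = D (τ, 0) + D (0, b) := by
      rw [← map_add]
      simp
    have h4 : s.M y τ = D (τ, 0) := rfl
    simp [h3, ← h4, hτ]
  have h3 := h2.map_nhds_eq_of_surj (LinearMap.range_eq_top.mpr hsurj)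
  rw [s.f_zero] at h3
  rw [← h3, eventually_map]
  exact Eventually.of_forall fun q => ⟨q.1, rfl⟩

theorem exists_act_eq (s : Spray T V) {U : Set V} (hU : ∀ τ, ∀ x ∈ U, s.f τ x ∈ U)
    (hsurj : ∀ x ∈ U, Function.Surjective (s.M x)) (hUc : IsPreconnected U) {p q : V} (hp : p ∈ U)
    (hq : q ∈ U) : ∃ l : List T, ∀ {W : Type} (w : W), s.act (l.map fun τ _ => τ) w p = q := by
  let A : Set V := {y | ∃ l : List T, ∀ {W : Type} (w : W), s.act (l.map fun τ _ => τ) w p = y}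
  have hA : ∀ y ∈ A, ∀ τ, s.f τ y ∈ A := by
    rintro y ⟨l, hl⟩ τ
    exact ⟨τ :: l, fun w => by simp [act, hl]⟩
  have hAU : A ⊆ U := by
    rintro y ⟨l, hl⟩
    rw [← hl ()]
    exact s.act_mem hU _ _ hp
  have hopen : IsOpen A := by
    rw [isOpen_iff_mem_nhds]
    intro y hy
    have h := s.eventually_exists_f_eq (hsurj y (hAU hy))
    have h2 := (Continuous.tendsto' (by fun_prop : Continuous fun a : V => (a, y)) y _ rfl).eventually h
    filter_upwards [h2] with a ⟨τ, hτ⟩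
    rw [← hτ]
    exact hA y hy τ
  have hclosed : closure A ∩ U ⊆ A := by
    rintro y ⟨hy, hyU⟩
    have h := s.eventually_exists_f_eq (hsurj y hyU)
    have h2 := (Continuous.tendsto' (by fun_prop : Continuous fun z : V => (y, z)) y _ rfl).eventually h
    obtain ⟨z, ⟨τ, hτ⟩, hz⟩ := (mem_closure_iff_frequently.mp hy).and_eventually h2 |>.exists.imp
      fun _ h => h.symm
    have hzA := hA z hz τ
    rwa [show s.f τ z = y from hτ] at hzA
  exact hUc.subset_of_closure_inter_subset hopen ⟨p, hp, [], fun w => rfl⟩ hclosed hq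

variable {E : Type*} [NormedAddCommGroup E] [NormedSpace ℂ E] [FiniteDimensional ℂ E]

theorem exists_limit_of_eq (sV : Spray T V) (sE : Spray T E) {U : Set V}
    (hU : ∀ τ, ∀ x ∈ U, sV.f τ x ∈ U) (hsurj : ∀ x ∈ U, Function.Surjective (sV.M x)) {p₀ : V}
    {γ : (Fin m → ℂ) → V} (hγ : Differentiable ℂ γ) (hγU : ∀ w, γ w ∈ U) (hγ0 : γ 0 = p₀) :
    ∃ (l : ℕ → List ((Fin m → ℂ) → T)) (Ξ Ξ' : (Fin m → ℂ) × E → E),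
      Differentiable ℂ Ξ ∧ Differentiable ℂ Ξ' ∧
      (∀ w x, Ξ' (w, Ξ (w, x)) = x) ∧ (∀ w x, Ξ (w, Ξ' (w, x)) = x) ∧
      (∀ w x, Tendsto (fun j => sE.act (l j) w x) atTop (𝓝 (Ξ (w, x)))) ∧
      (∀ w r, ∃ C, ∀ᶠ j in atTop, ∀ x ∈ closedBall (0 : E) r, ‖sE.act (l j) w x‖ ≤ C) ∧
      ∀ w, Tendsto (fun j => sV.act (l j) w (γ w)) atTop (𝓝 p₀) := by
  have hp₀ : p₀ ∈ U := hγ0 ▸ hγU 0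
  have : CompleteSpace E := FiniteDimensional.complete ℂ E
  have step : ∀ (j : ℕ) (l : {l // Good sV sE U p₀ γ j l}), ∃ l' : {l // Good sV sE U p₀ γ (j + 1) l},
      ∀ w ∈ closedBall (0 : Fin m → ℂ) (j - 1), ∀ x, ‖x‖ ≤ j →
        ‖sE.act l'.1 w x - sE.act l.1 w x‖ ≤ (1 / 2) ^ j ∧
        ‖sE.inv l'.1 w x - sE.inv l.1 w x‖ ≤ (1 / 2) ^ j := by
    intro j l
    obtain ⟨l', h1, h2⟩ := l.2.exists_succ hU hsurj hp₀ hγ hγU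
    exact ⟨⟨l', h1⟩, h2⟩
  choose next hnext using step
  let L : ∀ j, {l // Good sV sE U p₀ γ j l} := fun j =>
    Nat.rec (motive := fun j => {l // Good sV sE U p₀ γ j l})
      ⟨[], good_zero sV sE hsurj hp₀ hγ0⟩ (fun j l => next j l) j
  have hL : ∀ j : ℕ, ∀ w ∈ closedBall (0 : Fin m → ℂ) (j - 1), ∀ x, ‖x‖ ≤ j →
        ‖sE.act (L (j + 1)).1 w x - sE.act (L j).1 w x‖ ≤ (1 / 2) ^ j ∧
        ‖sE.inv (L (j + 1)).1 w x - sE.inv (L j).1 w x‖ ≤ (1 / 2) ^ j := fun j => hnext j (L j)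
  have hmem : ∀ (j : ℕ) (q : (Fin m → ℂ) × E), ‖q‖ + 1 ≤ j →
      q.1 ∈ closedBall (0 : Fin m → ℂ) (j - 1) ∧ ‖q.2‖ ≤ j := by
    intro j q hq
    rw [mem_closedBall_zero_iff]
    constructor <;> linarith [norm_fst_le q, norm_snd_le q]
  obtain ⟨Ξ, hΞ, hΞl, hΞu⟩ := exists_limit_of_norm_sub_le
    (f := fun j (q : (Fin m → ℂ) × E) => sE.act (L j).1 q.1 q.2)
    (fun j => sE.differentiable_act (L j).2.1)
    (fun j q hq => (hL j _ (hmem j q hq).1 _ (hmem j q hq).2).1)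
  obtain ⟨Ξ', hΞ', hΞl', hΞu'⟩ := exists_limit_of_norm_sub_le
    (f := fun j (q : (Fin m → ℂ) × E) => sE.inv (L j).1 q.1 q.2)
    (fun j => sE.differentiable_inv (L j).2.1)
    (fun j q hq => (hL j _ (hmem j q hq).1 _ (hmem j q hq).2).2)
  have hcomp : ∀ {f : ℕ → (Fin m → ℂ) × E → E} {g : (Fin m → ℂ) × E → E}, Continuous g →
      (∀ R, TendstoUniformlyOn f g atTop (closedBall 0 R)) → ∀ (w : Fin m → ℂ) {x : ℕ → E} {x₀ : E},
      Tendsto x atTop (𝓝 x₀) → Tendsto (fun j => f j (w, x j)) atTop (𝓝 (g (w, x₀))) := by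
    intro f g hg hfg w x x₀ hx
    refine tendsto_comp_of_locally_uniform_limit (F := f) (g := fun j => (w, x j))
      hg.continuousAt (tendsto_const_nhds.prodMk_nhds hx) fun u hu => ?_
    refine ⟨closedBall 0 (‖((w, x₀) : (Fin m → ℂ) × E)‖ + 1), ?_, hfg _ u hu⟩
    refine mem_of_superset (closedBall_mem_nhds _ one_pos) (closedBall_subset_closedBall' ?_)
    rw [dist_zero_right, add_comm]
  refine ⟨fun j => (L j).1, Ξ, Ξ', hΞ, hΞ', fun w x => ?_, fun w x => ?_,
    fun w x => hΞl (w, x), fun w r => ?_, fun w => ?_⟩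
  · have h1 := hcomp hΞ'.continuous hΞu' w (hΞl (w, x))
    simp only [inv_act] at h1
    exact (tendsto_nhds_unique h1 tendsto_const_nhds)
  · have h1 := hcomp hΞ.continuous hΞu w (hΞl' (w, x))
    simp only [act_inv] at h1
    exact (tendsto_nhds_unique h1 tendsto_const_nhds)
  · have : ProperSpace ((Fin m → ℂ) × E) := FiniteDimensional.proper ℂ _
    obtain ⟨C, -, hC⟩ := exists_bound_of_continuous hΞ.continuous 0 (max ‖w‖ r)
    refine ⟨C + 1, ?_⟩
    filter_upwards [Metric.tendstoUniformlyOn_iff.mp (hΞu (max ‖w‖ r)) 1 one_pos] with j hj x hx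
    have hq : ((w, x) : (Fin m → ℂ) × E) ∈ closedBall (0 : (Fin m → ℂ) × E) (max ‖w‖ r) := by
      rw [mem_closedBall_zero_iff] at hx ⊢
      exact max_le_max le_rfl hx
    have h1 := hj _ hq
    rw [dist_comm, dist_eq_norm] at h1
    have h2 := norm_le_norm_add_norm_sub' (sE.act (L j).1 w x) (Ξ (w, x))
    linarith [hC _ hq]
  · rw [tendsto_iff_norm_sub_tendsto_zero]
    refine squeeze_zero' (Eventually.of_forall fun _ => norm_nonneg _) ?_
      (tendsto_pow_atTop_nhds_zero_of_lt_one (r := (1 / 2 : ℝ)) (by norm_num) (by norm_num))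
    filter_upwards [tendsto_natCast_atTop_atTop.eventually_ge_atTop ‖w‖] with j hj
    obtain ⟨-, B, η, ε, -, -, ⟨hε, -⟩, hclose⟩ := (L j).2
    exact (hclose w (by simpa using hj)).trans hε

theorem exists_limit (sV : Spray T V) (sE : Spray T E) {U : Set V}
    (hU : ∀ τ, ∀ x ∈ U, sV.f τ x ∈ U) (hsurj : ∀ x ∈ U, Function.Surjective (sV.M x))
    (hUc : IsPreconnected U) {p₀ : V} (hp₀ : p₀ ∈ U)
    {γ : (Fin m → ℂ) → V} (hγ : Differentiable ℂ γ) (hγU : ∀ w, γ w ∈ U) :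
    ∃ (l : ℕ → List ((Fin m → ℂ) → T)) (Ξ Ξ' : (Fin m → ℂ) × E → E),
      Differentiable ℂ Ξ ∧ Differentiable ℂ Ξ' ∧
      (∀ w x, Ξ' (w, Ξ (w, x)) = x) ∧ (∀ w x, Ξ (w, Ξ' (w, x)) = x) ∧
      (∀ w x, Tendsto (fun j => sE.act (l j) w x) atTop (𝓝 (Ξ (w, x)))) ∧
      (∀ w r, ∃ C, ∀ᶠ j in atTop, ∀ x ∈ closedBall (0 : E) r, ‖sE.act (l j) w x‖ ≤ C) ∧
      ∀ w, Tendsto (fun j => sV.act (l j) w (γ w)) atTop (𝓝 p₀) := by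
  obtain ⟨l₀, hl₀⟩ := sV.exists_act_eq hU hsurj hUc (hγU 0) hp₀
  set k : List ((Fin m → ℂ) → T) := l₀.map fun τ _ => τ with hk
  have hkd : ∀ τ ∈ k, Differentiable ℂ τ := by
    intro τ hτ
    obtain ⟨t, -, rfl⟩ := List.mem_map.mp hτ
    exact differentiable_const t
  obtain ⟨l, Ξ, Ξ', h1, h2, h3, h4, h5, h6, h7⟩ := exists_limit_of_eq sV sE hU hsurj
    (γ := fun w => sV.act k w (γ w))
    ((sV.differentiable_act hkd).comp (differentiable_id.prodMk hγ))
    (fun w => sV.act_mem hU k w (hγU w)) (hl₀ 0)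
  refine ⟨fun j => l j ++ k, fun q => Ξ (q.1, sE.act k q.1 q.2), fun q => sE.inv k q.1 (Ξ' q),
    h1.comp (differentiable_fst.prodMk (sE.differentiable_act hkd)),
    (sE.differentiable_inv hkd).comp (differentiable_fst.prodMk h2),
    fun w x => ?_, fun w x => ?_, fun w x => ?_, fun w r => ?_, fun w => ?_⟩
  · simp [h3, inv_act]
  · simp [h4, act_inv]
  · simpa [act_append] using h5 w _
  · have : ProperSpace E := FiniteDimensional.proper ℂ _
    obtain ⟨r', -, hr'⟩ := exists_bound_of_continuous
      ((sE.differentiable_act hkd).continuous.comp (continuous_const (y := w) |>.prodMk continuous_id)) 0 r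
    obtain ⟨C, hC⟩ := h6 w r'
    refine ⟨C, hC.mono fun j hj x hx => ?_⟩
    rw [act_append]
    exact hj _ (mem_closedBall_zero_iff.mpr (hr' x hx))
  · simpa [act_append] using h7 w

end Spray

/-- The data of a complete vector field `q μ v` on `ℂⁿ`, where `v = e_b + s e_a`,
`q = (ζ_a - s ζ_b) ^ d ∏ ζ_i ^ β_i` is constant in the direction `v`, and `μ = ζ_b + c` has
derivative `1` in the direction `v`. -/
structure Overshear (n : ℕ) where
  /-- the first coordinate involved -/
  a : Fin n
  /-- the second coordinate involved -/
  b : Fin n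
  ne : a ≠ b
  /-- the slope of the direction -/
  s : ℂ
  /-- the degree in the two coordinates involved -/
  d : ℕ
  /-- the exponents of the other coordinates -/
  β : Fin n → ℕ
  /-- the additive constant -/
  c : ℂ

namespace Overshear

variable {n : ℕ} (o : Overshear n)

section Algebra

variable {B : Type*} [CommRing B] [Algebra ℂ B]

/-- The first integral of the vector field. -/
def q (ζ : Fin n → B) : B := (ζ o.a - o.s • ζ o.b) ^ o.d * ∏ i ∈ {o.a, o.b}ᶜ, ζ i ^ o.β i

/-- The affine linear factor of the vector field. -/
def μ (ζ : Fin n → B) : B := ζ o.b + o.c • 1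

/-- The direction of the vector field. -/
noncomputable def dir : Fin n → ℂ := Pi.single o.b 1 + Pi.single o.a o.s

theorem dir_a : o.dir o.a = o.s := by simp [dir, o.ne]

theorem dir_b : o.dir o.b = 1 := by simp [dir, o.ne]

theorem dir_of_mem {i : Fin n} (hi : i ∈ ({o.a, o.b}ᶜ : Finset (Fin n))) : o.dir i = 0 := by
  simp only [Finset.mem_compl, Finset.mem_insert, Finset.mem_singleton, not_or] at hi
  simp [dir, hi.1, hi.2]

/-- The value of the vector field. -/
noncomputable def field (ζ : Fin n → B) : Fin n → B := fun i => o.dir i • (o.q ζ * o.μ ζ)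

theorem q_shift (ζ : Fin n → B) (x : B) : o.q (fun i => ζ i + o.dir i • x) = o.q ζ := by
  simp only [q, o.dir_a, o.dir_b]
  congr 1
  · simp
  · exact Finset.prod_congr rfl fun i hi => by simp [o.dir_of_mem hi]

theorem μ_shift (ζ : Fin n → B) (x : B) : o.μ (fun i => ζ i + o.dir i • x) = o.μ ζ + x := by
  simp only [μ, o.dir_b, one_smul]
  ring

theorem map_q {B' : Type*} [CommRing B'] [Algebra ℂ B'] (φ : B →ₐ[ℂ] B') (ζ : Fin n → B) :
    φ (o.q ζ) = o.q (fun i => φ (ζ i)) := by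
  simp [q]

theorem map_μ {B' : Type*} [CommRing B'] [Algebra ℂ B'] (φ : B →ₐ[ℂ] B') (ζ : Fin n → B) :
    φ (o.μ ζ) = o.μ (fun i => φ (ζ i)) := by
  simp [μ]

theorem q_mem {S : Subalgebra ℂ B} {ζ : Fin n → B} (h : ∀ i, ζ i ∈ S) : o.q ζ ∈ S :=
  mul_mem (pow_mem (sub_mem (h _) (S.smul_mem (h _) _)) _)
    (prod_mem fun _ _ => pow_mem (h _) _)

theorem μ_mem {S : Subalgebra ℂ B} {ζ : Fin n → B} (h : ∀ i, ζ i ∈ S) : o.μ ζ ∈ S :=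
  add_mem (h _) (S.smul_mem (one_mem _) _)

end Algebra

variable {B : Type*} [NormedCommRing B] [NormedAlgebra ℂ B]

/-- The flow of the vector field. -/
noncomputable def flow (t : ℂ) (ζ : Fin n → B) : Fin n → B :=
  fun i => ζ i + o.dir i • ((NormedSpace.exp (t • o.q ζ) - 1) * o.μ ζ)

theorem flow_zero (ζ : Fin n → B) : o.flow 0 ζ = ζ := by
  ext i
  simp [flow, NormedSpace.exp_zero]

theorem flow_mem {S : Subalgebra ℂ B} (hS : IsClosed (S : Set B)) {ζ : Fin n → B}
    (h : ∀ i, ζ i ∈ S) (t : ℂ) (i : Fin n) : o.flow t ζ i ∈ S := by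
  let : NormedAlgebra ℚ B := NormedAlgebra.restrictScalars ℚ ℂ B
  have h1 : NormedSpace.exp (t • o.q ζ) ∈ S :=
    NormedSpace.exp_mem (R := ℂ) hS (S.smul_mem (o.q_mem h) t)
  exact add_mem (h i) (S.smul_mem (mul_mem (sub_mem h1 (one_mem _)) (o.μ_mem h)) _)

/-- The composition of the flows of a list of overshears. -/
noncomputable def run {ι : Type*} (o : ι → Overshear n) (τ : ι → ℂ) :
    List ι → (Fin n → B) → Fin n → B
  | [], ζ => ζ
  | j :: L, ζ => (o j).flow (τ j) (run o τ L ζ)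

/-- The inverse of `Overshear.run`. -/
noncomputable def runInv {ι : Type*} (o : ι → Overshear n) (τ : ι → ℂ) :
    List ι → (Fin n → B) → Fin n → B
  | [], ζ => ζ
  | j :: L, ζ => runInv o τ L ((o j).flow (-τ j) ζ)

variable {ι : Type*} (f : ι → Overshear n)

theorem run_zero (L : List ι) (ζ : Fin n → B) : run f 0 L ζ = ζ := by
  induction L with
  | nil => rfl
  | cons j L ih => simp [run, flow_zero, ih]

theorem run_single [DecidableEq ι] (j : ι) (t : ℂ) (L : List ι) (hL : L.Nodup) (ζ : Fin n → B) :
    run f (Pi.single j t) L ζ = if j ∈ L then (f j).flow t ζ else ζ := by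
  induction L with
  | nil => simp [run]
  | cons k L ih =>
    rw [List.nodup_cons] at hL
    rw [run, ih hL.2]
    by_cases hjk : j = k
    · subst hjk
      simp [hL.1]
    · simp [hjk, flow_zero]

variable [CompleteSpace B]

theorem flow_flow (s t : ℂ) (ζ : Fin n → B) : o.flow s (o.flow t ζ) = o.flow (s + t) ζ := by
  let : NormedAlgebra ℚ B := NormedAlgebra.restrictScalars ℚ ℂ B
  ext i
  have hq : o.q (o.flow t ζ) = o.q ζ := o.q_shift ζ _
  have hμ : o.μ (o.flow t ζ) = o.μ ζ + (NormedSpace.exp (t • o.q ζ) - 1) * o.μ ζ := o.μ_shift ζ _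
  rw [flow, hq, hμ, flow, flow, add_smul, NormedSpace.exp_add, add_assoc, ← smul_add]
  congr 2
  ring

theorem map_flow {B' : Type*} [NormedCommRing B'] [NormedAlgebra ℂ B'] (φ : B →ₐ[ℂ] B')
    (hφ : Continuous φ) (t : ℂ) (ζ : Fin n → B) :
    (fun i => φ (o.flow t ζ i)) = o.flow t (fun i => φ (ζ i)) := by
  let : NormedAlgebra ℚ B := NormedAlgebra.restrictScalars ℚ ℂ B
  let : NormedAlgebra ℚ B' := NormedAlgebra.restrictScalars ℚ ℂ B'
  ext i
  simp [flow, o.map_μ, NormedSpace.map_exp φ hφ, o.map_q]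

theorem differentiable_flow :
    Differentiable ℂ fun r : ℂ × (Fin n → B) => o.flow r.1 r.2 := by
  have hexp : Differentiable ℂ (NormedSpace.exp : B → B) :=
    fun x => (NormedSpace.exp_analytic (𝕂 := ℂ) x).differentiableAt
  have hq : Differentiable ℂ fun ζ : Fin n → B => o.q ζ := by
    unfold q
    fun_prop
  have hμ : Differentiable ℂ fun ζ : Fin n → B => o.μ ζ := by
    unfold μ
    fun_prop
  rw [differentiable_pi]
  intro i
  unfold flow
  fun_prop

theorem hasDerivAt_flow (ζ : Fin n → B) : HasDerivAt (fun t => o.flow t ζ) (o.field ζ) 0 := by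
  rw [hasDerivAt_pi]
  intro i
  have h1 : HasDerivAt (fun t : ℂ => NormedSpace.exp (t • o.q ζ)) (o.q ζ) 0 := by
    have := hasDerivAt_exp_smul_const (𝕂 := ℂ) (o.q ζ) (0 : ℂ)
    simpa [NormedSpace.exp_zero] using this
  have h2 := (((h1.sub_const 1).mul_const (o.μ ζ)).const_smul (o.dir i)).const_add (ζ i)
  exact h2

theorem runInv_run (τ : ι → ℂ) (L : List ι) (ζ : Fin n → B) :
    runInv f τ L (run f τ L ζ) = ζ := by
  induction L with
  | nil => rfl
  | cons j L ih => simp [run, runInv, flow_flow, flow_zero, ih]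

theorem run_runInv (τ : ι → ℂ) (L : List ι) (ζ : Fin n → B) :
    run f τ L (runInv f τ L ζ) = ζ := by
  induction L generalizing ζ with
  | nil => rfl
  | cons j L ih => simp [run, runInv, flow_flow, flow_zero, ih]

theorem map_run {B' : Type*} [NormedCommRing B'] [NormedAlgebra ℂ B'] (φ : B →ₐ[ℂ] B')
    (hφ : Continuous φ) (τ : ι → ℂ) (L : List ι) (ζ : Fin n → B) :
    (fun i => φ (run f τ L ζ i)) = run f τ L (fun i => φ (ζ i)) := by
  induction L with
  | nil => rfl
  | cons j L ih => rw [run, map_flow _ φ hφ, ih, run]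

theorem differentiable_run [Fintype ι] (L : List ι) :
    Differentiable ℂ fun r : (ι → ℂ) × (Fin n → B) => run f r.1 L r.2 := by
  induction L with
  | nil => exact differentiable_snd
  | cons j L ih =>
    have h : Differentiable ℂ fun r : (ι → ℂ) × (Fin n → B) => r.1 j := by fun_prop
    exact (f j).differentiable_flow.comp (h.prodMk ih)

theorem differentiable_runInv [Fintype ι] (L : List ι) :
    Differentiable ℂ fun r : (ι → ℂ) × (Fin n → B) => runInv f r.1 L r.2 := by
  induction L with
  | nil => exact differentiable_snd
  | cons j L ih =>
    have h : Differentiable ℂ fun r : (ι → ℂ) × (Fin n → B) => -r.1 j := by fun_prop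
    have h2 : Differentiable ℂ fun r : (ι → ℂ) × (Fin n → B) => (f j).flow (-r.1 j) r.2 :=
      (f j).differentiable_flow.comp (f := fun r : (ι → ℂ) × (Fin n → B) => (-r.1 j, r.2))
        (h.prodMk differentiable_snd)
    exact ih.comp (differentiable_fst.prodMk h2)

/-- The spray composed of the flows of a finite family of overshears. -/
noncomputable def spray [Fintype ι] (B : Type*) [NormedCommRing B] [NormedAlgebra ℂ B]
    [CompleteSpace B] : Spray (ι → ℂ) (Fin n → B) where
  f τ ζ := run f τ Finset.univ.toList ζ
  g τ ζ := runInv f τ Finset.univ.toList ζ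
  differentiable_f := differentiable_run f _
  differentiable_g := differentiable_runInv f _
  g_f τ ζ := runInv_run f τ _ ζ
  f_g τ ζ := run_runInv f τ _ ζ
  f_zero ζ := run_zero f _ ζ

theorem map_act [Fintype ι] {W : Type*} {B' : Type*} [NormedCommRing B'] [NormedAlgebra ℂ B']
    [CompleteSpace B'] (φ : B →ₐ[ℂ] B') (hφ : Continuous φ) (l : List (W → ι → ℂ)) (w : W)
    (ζ : Fin n → B) :
    (fun i => φ ((spray f B).act l w ζ i)) = (spray f B').act l w (fun i => φ (ζ i)) := by
  induction l with
  | nil => rfl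
  | cons τ l ih =>
    simp only [Spray.act, ← ih]
    exact map_run f φ hφ _ _ _

theorem field_mem_range_M [Fintype ι] (ζ : Fin n → B) (j : ι) :
    (f j).field ζ ∈ LinearMap.range ((spray f B).M ζ : (ι → ℂ) →ₗ[ℂ] Fin n → B) := by
  classical
  refine ⟨Pi.single j 1, ?_⟩
  have h1 : HasFDerivAt (fun τ => (spray f B).f τ ζ) ((spray f B).M ζ) ((0 : ℂ) • Pi.single j (1 : ℂ)) := by
    rw [zero_smul]
    exact (spray f B).hasFDerivAt_f 0 ζ
  have h2 : HasDerivAt (fun t : ℂ => t • (Pi.single j (1 : ℂ) : ι → ℂ)) (Pi.single j 1) 0 := by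
    simpa using (hasDerivAt_id (0 : ℂ)).smul_const (Pi.single j (1 : ℂ) : ι → ℂ)
  have h3 := h1.comp_hasDerivAt (0 : ℂ) h2
  refine h3.unique ?_
  have e : ((fun τ => (spray f B).f τ ζ) ∘ fun t : ℂ => t • (Pi.single j (1 : ℂ) : ι → ℂ))
      = fun t => (f j).flow t ζ := by
    ext1 t
    have : t • (Pi.single j (1 : ℂ) : ι → ℂ) = Pi.single j t := by
      rw [← Pi.single_smul]
      simp
    simp only [Function.comp_apply, this]
    exact (run_single f j t _ (Finset.nodup_toList _) ζ).trans (by simp)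
  rw [e]
  exact (f j).hasDerivAt_flow ζ

theorem adjoin_spray_eq_top [Fintype ι] [FiniteDimensional ℂ B] (τ : ι → ℂ) {ζ : Fin n → B}
    (h : Algebra.adjoin ℂ (range ζ) = ⊤) :
    Algebra.adjoin ℂ (range ((spray f B).f τ ζ)) = ⊤ := by
  have key : ∀ (o : Overshear n) (t : ℂ) (ζ : Fin n → B), Algebra.adjoin ℂ (range ζ) = ⊤ →
      Algebra.adjoin ℂ (range (o.flow t ζ)) = ⊤ := by
    intro o t ζ h
    rw [eq_top_iff, ← h, Algebra.adjoin_le_iff]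
    rintro _ ⟨i, rfl⟩
    have e : o.flow (-t) (o.flow t ζ) = ζ := by simp [flow_flow, flow_zero]
    have hmem := o.flow_mem (Submodule.closed_of_finiteDimensional
      (Subalgebra.toSubmodule (Algebra.adjoin ℂ (range (o.flow t ζ)))))
      (fun i => Algebra.subset_adjoin (mem_range_self i)) (-t) i
    rwa [e] at hmem
  change Algebra.adjoin ℂ (range (run f τ _ ζ)) = ⊤
  induction (Finset.univ : Finset ι).toList with
  | nil => exact h
  | cons j L ih => exact key _ _ _ ih

end Overshear

theorem choose_mul_eq_of_sum_eq_zero {d S : ℕ} (hS : d + 2 ≤ S) {u v : ℕ → ℂ}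
    (h : ∀ s < S, ∑ k ∈ Finset.range (d + 1),
      (d.choose k : ℂ) * (-(s : ℂ)) ^ k * (u k + s * v k) = 0) :
    u 0 = 0 ∧ ∀ k ≤ d, (d.choose (k + 1) : ℂ) * u (k + 1) = d.choose k * v k := by
  let P : Polynomial ℂ := ∑ k ∈ Finset.range (d + 1),
    (Polynomial.monomial k ((d.choose k : ℂ) * (-1) ^ k * u k)
      + Polynomial.monomial (k + 1) ((d.choose k : ℂ) * (-1) ^ k * v k))
  have hP : P = 0 := by
    refine Polynomial.eq_zero_of_natDegree_lt_card_of_eval_eq_zero P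
      (f := fun s : Fin S => ((s : ℕ) : ℂ)) (fun s t hst => Fin.ext (by simpa using hst))
      (fun s => ?_) ?_
    · rw [← h s s.2]
      simp only [P, Polynomial.eval_finsetSum, Polynomial.eval_add, Polynomial.eval_monomial]
      refine Finset.sum_congr rfl fun k _ => ?_
      rw [neg_pow]
      ring
    · rw [Fintype.card_fin]
      refine lt_of_le_of_lt (b := d + 1) ?_ (by omega)
      refine Polynomial.natDegree_sum_le_of_forall_le _ _ fun k hk => ?_
      rw [Finset.mem_range] at hk
      refine (Polynomial.natDegree_add_le _ _).trans (max_le ?_ ?_)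
      · exact (Polynomial.natDegree_monomial_le _).trans (by omega)
      · exact (Polynomial.natDegree_monomial_le _).trans (by omega)
  have hc : ∀ k, P.coeff k = 0 := by simp [hP]
  constructor
  · have := hc 0
    simpa [P, Polynomial.finsetSum_coeff, Polynomial.coeff_monomial] using this
  · intro k hk
    have h1 := hc (k + 1)
    simp only [P, Polynomial.finsetSum_coeff, Polynomial.coeff_add, Polynomial.coeff_monomial,
      Finset.sum_add_distrib, Finset.sum_ite_eq', add_left_inj, Finset.mem_range] at h1
    have h2 : (if k + 1 < d + 1 then (d.choose (k + 1) : ℂ) * (-1) ^ (k + 1) * u (k + 1) else 0)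
        = (d.choose (k + 1) : ℂ) * (-1) ^ (k + 1) * u (k + 1) := by
      split_ifs with hlt
      · rfl
      · rw [Nat.choose_eq_zero_of_lt (by omega)]
        simp
    rw [h2, if_pos (show k < d + 1 by omega), pow_succ] at h1
    have h3 : ((-1 : ℂ)) ^ k ≠ 0 := pow_ne_zero _ (by norm_num)
    have h4 : (-1 : ℂ) ^ k * (d.choose (k + 1) * u (k + 1)) = (-1) ^ k * (d.choose k * v k) := by
      linear_combination -h1
    exact mul_left_cancel₀ h3 h4

theorem LinearMap.apply_pow_mul_pow_eq_zero {A : Type*} [CommRing A] [Algebra ℂ A]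
    (f g : A →ₗ[ℂ] ℂ) (x y r : A) {D : ℕ}
    (h : ∀ s < 2 * D + 2, ∀ d < 2 * D, ∀ e < 2,
      g ((x - (s : ℂ) • y) ^ d * r * y ^ e) + s * f ((x - (s : ℂ) • y) ^ d * r * y ^ e) = 0)
    {P Q : ℕ} (hP : P < D) (hQ : Q < D) : f (x ^ P * y ^ Q * r) = 0 := by
  have hexp : ∀ (F : A →ₗ[ℂ] ℂ) (s d e : ℕ), F ((x - (s : ℂ) • y) ^ d * r * y ^ e) =
      ∑ k ∈ Finset.range (d + 1), (d.choose k : ℂ) * (-(s : ℂ)) ^ k *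
        F (x ^ (d - k) * y ^ (k + e) * r) := by
    intro F s d e
    have h1 : x - (s : ℂ) • y = (-(s : ℂ)) • y + x := by
      rw [neg_smul]
      ring
    rw [h1, add_pow, Finset.sum_mul, Finset.sum_mul, map_sum]
    refine Finset.sum_congr rfl fun k _ => ?_
    rw [← smul_eq_mul _ (F _), ← map_smul]
    congr 1
    rw [smul_pow, mul_smul, pow_add]
    simp only [Algebra.smul_def, map_pow, map_natCast, map_neg]
    ring
  have key : ∀ d < 2 * D, ∀ e < 2, g (x ^ d * y ^ e * r) = 0 ∧ ∀ k ≤ d,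
      (d.choose (k + 1) : ℂ) * g (x ^ (d - (k + 1)) * y ^ (k + 1 + e) * r)
        = d.choose k * f (x ^ (d - k) * y ^ (k + e) * r) := by
    intro d hd e he
    have := choose_mul_eq_of_sum_eq_zero (d := d) (S := 2 * D + 2) (by omega)
      (u := fun k => g (x ^ (d - k) * y ^ (k + e) * r))
      (v := fun k => f (x ^ (d - k) * y ^ (k + e) * r)) (fun s hs => by
        rw [← h s hs d hd e he, hexp, hexp, Finset.mul_sum, ← Finset.sum_add_distrib]
        refine Finset.sum_congr rfl fun k _ => ?_
        ring)
    simpa using this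
  have hS := (key (P + Q) (by omega) 0 (by omega)).2 Q (by omega)
  simp only [Nat.add_sub_cancel, add_zero] at hS
  rcases P with _ | P
  · simpa using hS.symm
  rw [show P + 1 + Q - (Q + 1) = P by omega] at hS
  have hc1 : (((P + 1 + Q).choose (Q + 1) : ℕ) : ℂ) * (Q + 1) = (P + 1 + Q).choose Q * (P + 1) := by
    have := Nat.choose_succ_right_eq (P + 1 + Q) Q
    rw [show P + 1 + Q - Q = P + 1 by omega] at this
    exact_mod_cast this
  have hne1 : (((P + 1 + Q).choose Q : ℕ) : ℂ) ≠ 0 :=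
    Nat.cast_ne_zero.mpr (Nat.choose_pos (by omega)).ne'
  have hPg : ((P : ℂ) + 1) * g (x ^ P * y ^ (Q + 1) * r) = (Q + 1) * f (x ^ (P + 1) * y ^ Q * r) := by
    refine mul_left_cancel₀ hne1 ?_
    linear_combination (Q + 1 : ℂ) * hS - hc1 * g (x ^ P * y ^ (Q + 1) * r)
  rcases Q with _ | Q
  · have h0 := (key P (by omega) 1 (by omega)).1
    simp only [zero_add, h0, mul_zero] at hPg
    simpa using hPg.symm
  have hO := (key (P + 1 + Q) (by omega) 1 (by omega)).2 Q (by omega)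
  rw [show P + 1 + Q - (Q + 1) = P by omega, show P + 1 + Q - Q = P + 1 by omega] at hO
  have hne2 : (((P + 1 + Q).choose Q : ℕ) : ℂ) ≠ 0 :=
    Nat.cast_ne_zero.mpr (Nat.choose_pos (by omega)).ne'
  have hc2 : (((P + 1 + Q).choose (Q + 1) : ℕ) : ℂ) * (Q + 1) = (P + 1 + Q).choose Q * (P + 1) := by
    have := Nat.choose_succ_right_eq (P + 1 + Q) Q
    rw [show P + 1 + Q - Q = P + 1 by omega] at this
    exact_mod_cast this
  have hPg2 : ((P : ℂ) + 1) * g (x ^ P * y ^ (Q + 1 + 1) * r)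
      = (Q + 1) * f (x ^ (P + 1) * y ^ (Q + 1) * r) := by
    refine mul_left_cancel₀ hne2 ?_
    linear_combination (Q + 1 : ℂ) * hO - hc2 * g (x ^ P * y ^ (Q + 1 + 1) * r)
  push_cast at hPg
  linear_combination hPg2 - hPg

namespace Overshear

/-- The indices of a finite family of overshears. -/
abbrev Index (n D : ℕ) : Type :=
  {r : Fin n × Fin n // r.1 ≠ r.2} × Fin (2 * D + 2) × Fin (2 * D) × (Fin n → Fin D) × Fin 2

/-- A finite family of overshears which spans the tangent spaces. -/
def family (n D : ℕ) (j : Index n D) : Overshear n where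
  a := j.1.1.1
  b := j.1.1.2
  ne := j.1.2
  s := (j.2.1 : ℕ)
  d := j.2.2.1
  β i := j.2.2.2.1 i
  c := (j.2.2.2.2 : ℕ)

variable {A : Type*} [CommRing A] [Algebra ℂ A] {n : ℕ}

theorem apply_single_eq_zero {D : ℕ} {p : Fin n → A} (F : (Fin n → A) →ₗ[ℂ] ℂ)
    (hF : ∀ j, F ((family n D j).field p) = 0) (hn : 2 ≤ n) (a : Fin n) (e : Fin n → Fin D) :
    F (Pi.single a (∏ i, p i ^ (e i : ℕ))) = 0 := by
  obtain ⟨b, hb⟩ : ∃ b, a ≠ b := by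
    have : Nontrivial (Fin n) := Fin.nontrivial_iff_two_le.mpr hn
    obtain ⟨b, hb⟩ := exists_ne a
    exact ⟨b, hb.symm⟩
  have hprod : ∏ i, p i ^ (e i : ℕ)
      = p a ^ (e a : ℕ) * p b ^ (e b : ℕ) * ∏ i ∈ {a, b}ᶜ, p i ^ (e i : ℕ) := by
    rw [← Finset.prod_mul_prod_compl {a, b}, Finset.prod_pair hb]
  rw [hprod]
  refine LinearMap.apply_pow_mul_pow_eq_zero (F ∘ₗ LinearMap.single ℂ (fun _ => A) a)
    (F ∘ₗ LinearMap.single ℂ (fun _ => A) b) (p a) (p b) (∏ i ∈ {a, b}ᶜ, p i ^ (e i : ℕ)) (D := D)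
    ?_ (e a).2 (e b).2
  intro s hs d hd
  set q := (p a - (s : ℂ) • p b) ^ d * ∏ i ∈ {a, b}ᶜ, p i ^ (e i : ℕ) with hq
  have key : ∀ c : Fin 2, F (Pi.single b (q * (p b + (((c : ℕ) : ℂ) • 1))))
      + s * F (Pi.single a (q * (p b + (((c : ℕ) : ℂ) • 1)))) = 0 := by
    intro c
    have h := hF (⟨(a, b), hb⟩, ⟨s, hs⟩, ⟨d, hd⟩, e, c)
    rw [← h, ← smul_eq_mul (s : ℂ) (F _), ← map_smul, ← map_add]
    congr 1
    ext i
    simp only [field, dir, family, Overshear.q, μ, Pi.add_apply, Pi.smul_apply, ← hq, add_smul]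
    congr 1
    · by_cases hi : i = b
      · subst hi
        simp
      · simp [hi]
    · by_cases hi : i = a
      · subst hi
        simp
      · simp [hi]
  have h0 := key 0
  have h1 := key 1
  simp only [Fin.val_zero, Nat.cast_zero, zero_smul, add_zero] at h0
  simp only [Fin.val_one, Nat.cast_one, one_smul, mul_add, mul_one, Pi.single_add, map_add] at h1
  intro r hr
  interval_cases r
  · simp only [pow_zero, mul_one, LinearMap.comp_apply, LinearMap.single_apply]
    linear_combination h1 - h0
  · simp only [pow_one, LinearMap.comp_apply, LinearMap.single_apply]
    exact h0

theorem span_monomials_eq_top [FiniteDimensional ℂ A] {D : ℕ} (hD : Module.finrank ℂ A < D)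
    {p : Fin n → A} (hp : Algebra.adjoin ℂ (range p) = ⊤) :
    Submodule.span ℂ (range fun e : Fin n → Fin D => ∏ i, p i ^ (e i : ℕ)) = ⊤ := by
  set S := Submodule.span ℂ (range fun e : Fin n → Fin D => ∏ i, p i ^ (e i : ℕ)) with hS
  have hmem : ∀ e : Fin n → ℕ, (∀ i, e i < D) → ∏ i, p i ^ e i ∈ S := fun e he =>
    Submodule.subset_span ⟨fun i => ⟨e i, he i⟩, rfl⟩
  have hmulX : ∀ (l : Fin n), ∀ x ∈ S, x * p l ∈ S := by
    intro l x hx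
    induction hx using Submodule.span_induction with
    | mem x hx =>
      obtain ⟨e, rfl⟩ := hx
      have hprod : ∀ k : ℕ, p l ^ k * ∏ i ∈ {l}ᶜ, p i ^ (e i : ℕ)
          = ∏ i, p i ^ (Function.update (fun i => (e i : ℕ)) l k i) := by
        intro k
        rw [← Finset.prod_mul_prod_compl {l} (fun i => p i ^ _), Finset.prod_singleton,
          Function.update_self]
        congr 1
        refine Finset.prod_congr rfl fun i hi => ?_
        rw [Function.update_of_ne (by simpa using hi)]
      have hlow : ∀ k < D, p l ^ k * ∏ i ∈ {l}ᶜ, p i ^ (e i : ℕ) ∈ S := by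
        intro k hk
        rw [hprod]
        refine hmem _ fun i => ?_
        by_cases hi : i = l
        · subst hi
          simpa using hk
        · simp [hi]
      have hx : (∏ i, p i ^ (e i : ℕ)) * p l
          = p l ^ ((e l : ℕ) + 1) * ∏ i ∈ {l}ᶜ, p i ^ (e i : ℕ) := by
        rw [← Finset.prod_mul_prod_compl {l} (fun i => p i ^ _), Finset.prod_singleton]
        ring
      rw [hx]
      have hintegral : IsIntegral ℂ (p l) := Algebra.IsIntegral.isIntegral _
      set f := (Polynomial.X ^ ((e l : ℕ) + 1) : Polynomial ℂ) %ₘ minpoly ℂ (p l) with hf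
      have haeval : p l ^ ((e l : ℕ) + 1) = Polynomial.aeval (p l) f := by
        rw [hf, Polynomial.modByMonic_eq_sub_mul_div _, map_sub, map_mul, minpoly.aeval]
        simp
      have hdeg : f.natDegree < D := by
        refine lt_of_le_of_lt ?_ hD
        refine (Polynomial.natDegree_modByMonic_le _ (minpoly.monic hintegral)).trans ?_
        exact minpoly.natDegree_le _
      rw [haeval, Polynomial.aeval_eq_sum_range, Finset.sum_mul]
      refine Submodule.sum_mem _ fun k hk => ?_
      rw [smul_mul_assoc]
      exact S.smul_mem _ (hlow k (by rw [Finset.mem_range] at hk; omega))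
    | zero => simp
    | add x y _ _ hx hy =>
      rw [add_mul]
      exact S.add_mem hx hy
    | smul c x _ hx =>
      rw [smul_mul_assoc]
      exact S.smul_mem _ hx
  rw [eq_top_iff]
  intro x _
  have hx : x ∈ Algebra.adjoin ℂ (range p) := hp ▸ Algebra.mem_top
  rw [Algebra.adjoin_range_eq_range_aeval] at hx
  obtain ⟨f, rfl⟩ := hx
  change MvPolynomial.aeval p f ∈ S
  induction f using MvPolynomial.induction_on with
  | C c =>
    have := S.smul_mem c (hmem 0 fun i => by simp only [Pi.zero_apply]; omega)
    simpa [Algebra.smul_def] using this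
  | add f g hf hg =>
    rw [map_add]
    exact S.add_mem (hf trivial) (hg trivial)
  | mul_X f l hf =>
    rw [map_mul, MvPolynomial.aeval_X]
    exact hmulX l _ (hf trivial)

theorem span_field_eq_top [FiniteDimensional ℂ A] (hn : 2 ≤ n) {D : ℕ}
    (hD : Module.finrank ℂ A < D) {p : Fin n → A} (hp : Algebra.adjoin ℂ (range p) = ⊤) :
    Submodule.span ℂ (range fun j => (family n D j).field p) = ⊤ := by
  by_contra hne
  obtain ⟨F, hF0, hF⟩ := Submodule.exists_le_ker_of_lt_top _ (lt_top_iff_ne_top.mpr hne)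
  refine hF0 (LinearMap.pi_ext fun a x => ?_)
  have hFj : ∀ j, F ((family n D j).field p) = 0 := fun j =>
    hF (Submodule.subset_span (mem_range_self j))
  have hx : x ∈ Submodule.span ℂ (range fun e : Fin n → Fin D => ∏ i, p i ^ (e i : ℕ)) := by
    rw [span_monomials_eq_top hD hp]
    trivial
  have hle : Submodule.span ℂ (range fun e : Fin n → Fin D => ∏ i, p i ^ (e i : ℕ))
      ≤ LinearMap.ker (F ∘ₗ LinearMap.single ℂ (fun _ => A) a) := by
    rw [Submodule.span_le]
    rintro _ ⟨e, rfl⟩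
    exact apply_single_eq_zero F hFj hn a e
  exact hle hx

end Overshear

namespace Overshear

theorem surjective_spray_M {n : ℕ} {A : Type*} [NormedCommRing A] [NormedAlgebra ℂ A]
    [CompleteSpace A] [FiniteDimensional ℂ A] (hn : 2 ≤ n) {D : ℕ}
    (hD : Module.finrank ℂ A < D) {p : Fin n → A} (hp : Algebra.adjoin ℂ (range p) = ⊤) :
    Function.Surjective ((spray (family n D) A).M p) := by
  have h : LinearMap.range ((spray (family n D) A).M p : (Index n D → ℂ) →ₗ[ℂ] Fin n → A) = ⊤ := by
    rw [eq_top_iff, ← span_field_eq_top hn hD hp, Submodule.span_le]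
    rintro _ ⟨j, rfl⟩
    exact field_mem_range_M _ p j
  exact LinearMap.range_eq_top.mp h

theorem countable_zeros_of_entire {f : ℂ → ℂ} (hf : Differentiable ℂ f) {x : ℂ} (hx : f x ≠ 0) :
    {t | f t = 0}.Countable := by
  have h1 : AnalyticOnNhd ℂ f univ := fun z _ => hf.analyticAt z
  have h := h1.preimage_zero_mem_codiscrete hx
  rw [mem_codiscrete'] at h
  have h2 : f ⁻¹' {0}ᶜ = {t | f t = 0}ᶜ := rfl
  rw [h2, compl_compl] at h
  have := h.2.to_subtype
  exact countable_of_Lindelof_of_discrete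

theorem isPreconnected_setOf_adjoin_eq_top {n : ℕ} {A : Type*} [NormedCommRing A]
    [NormedAlgebra ℂ A] [FiniteDimensional ℂ A] :
    IsPreconnected {p : Fin n → A | Algebra.adjoin ℂ (range p) = ⊤} := by
  classical
  refine isPreconnected_of_forall_pair fun p hp q hq => ?_
  obtain ⟨b, hb, hspan, hli⟩ := exists_linearIndependent ℂ
    (range fun e : Fin n → Fin (Module.finrank ℂ A + 1) => ∏ i, p i ^ (e i : ℕ))
  rw [span_monomials_eq_top (Nat.lt_succ_self _) hp] at hspan
  let B : Module.Basis b ℂ A := Module.Basis.mk hli (by rw [Subtype.range_coe, hspan])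
  have : Fintype b := FiniteDimensional.fintypeBasisIndex B
  choose e he using fun x : b => hb x.2
  let P : ℂ → Fin n → A := fun t i => p i + t • (q i - p i)
  let f : ℂ → ℂ := fun t => B.det fun x => ∏ i, P t i ^ (e x i : ℕ)
  have hP : Differentiable ℂ P := by
    refine differentiable_pi.mpr fun i => ?_
    exact (differentiable_const _).add (differentiable_id.smul_const _)
  have hf : Differentiable ℂ f := by
    have hentry : ∀ y x : b, Differentiable ℂ fun t => B.coord y (∏ i, P t i ^ (e x i : ℕ)) := by
      intro y x
      have h1 : Differentiable ℂ fun t => ∏ i, P t i ^ (e x i : ℕ) := by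
        refine Differentiable.fun_finsetProd fun i _ => ?_
        exact ((differentiable_pi.mp hP) i).pow _
      exact (LinearMap.toContinuousLinearMap (B.coord y)).differentiable.comp h1
    have h2 : f = fun t => ∑ σ : Equiv.Perm b, Equiv.Perm.sign σ •
        ∏ x, B.coord (σ x) (∏ i, P t i ^ (e x i : ℕ)) := by
      ext t
      simp only [f, Module.Basis.det_apply, Matrix.det_apply, Module.Basis.toMatrix_apply,
        Module.Basis.coord_apply]
    rw [h2]
    refine Differentiable.fun_sum fun σ _ => ?_
    simp only [Units.smul_def, zsmul_eq_mul]
    exact (differentiable_const _).mul (Differentiable.fun_finsetProd fun x _ => hentry _ _)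
  have hf0 : f 0 ≠ 0 := by
    have h1 : (fun x => ∏ i, P 0 i ^ (e x i : ℕ)) = B := by
      ext x
      simpa [P, B] using he x
    simp only [f]
    rw [h1, Module.Basis.det_self]
    exact one_ne_zero
  have hgen : ∀ t, f t ≠ 0 → Algebra.adjoin ℂ (range (P t)) = ⊤ := by
    intro t ht
    have h1 := ((Module.Basis.is_basis_iff_det B).mpr (isUnit_iff_ne_zero.mpr ht)).2
    rw [eq_top_iff]
    intro x _
    have hx : x ∈ Submodule.span ℂ (range fun x : b => ∏ i, P t i ^ (e x i : ℕ)) := h1 ▸ trivial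
    refine (Submodule.span_le (p := (Algebra.adjoin ℂ (range (P t))).toSubmodule)).mpr ?_ hx
    rintro _ ⟨y, rfl⟩
    exact Subalgebra.prod_mem (Algebra.adjoin ℂ (range (P t))) fun i _ =>
      pow_mem (Algebra.subset_adjoin (mem_range_self i)) _
  have hP0 : P 0 = p := by ext i; simp [P]
  have hP1 : P 1 = q := by ext i; simp [P]
  refine ⟨P '' ({t | f t = 0} \ {1})ᶜ, ?_, ⟨0, ?_, hP0⟩, ⟨1, ?_, hP1⟩, ?_⟩
  · rintro _ ⟨t, ht, rfl⟩
    by_cases h1 : t = 1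
    · rw [h1, hP1]
      exact hq
    · exact hgen t fun h => ht ⟨h, h1⟩
  · exact fun h => hf0 h.1
  · exact fun h => h.2 rfl
  · have hc := (countable_zeros_of_entire hf hf0).mono (sdiff_subset (t := {1}))
    refine (hc.isConnected_compl_of_one_lt_rank ?_).isPreconnected.image _ hP.continuous.continuousOn
    rw [Complex.rank_real_complex]
    exact Nat.one_lt_ofNat

end Overshear

section JetIdeal

variable {n : ℕ} {R : ℝ}

theorem differentiable_mvPolynomial_eval (p : MvPolynomial (Fin n) ℂ) :
    Differentiable ℂ fun z : Fin n → ℂ => MvPolynomial.eval z p := by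
  induction p using MvPolynomial.induction_on with
  | C c => simp
  | add f g hf hg => simpa using hf.fun_add hg
  | mul_X f i hf => simpa using hf.fun_mul (differentiable_apply i)

theorem exists_differentiableOn_polydisc_slice (f : polydiscAlgebra n R) {x u : Fin n → ℂ}
    (hx : ‖x‖ + 1 ≤ R) (hu : ‖u‖ ≤ 1) : ∃ g : ℂ → ℂ, DifferentiableOn ℂ g (ball 0 1) ∧
      ∀ t ∈ ball (0 : ℂ) 1, ∀ z : closedBall (0 : Fin n → ℂ) R, z.1 = x + t • u →
        g t = polydiscEval z f := by
  have hmem : ∀ t ∈ ball (0 : ℂ) 1, x + t • u ∈ closedBall (0 : Fin n → ℂ) R := by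
    intro t ht
    rw [mem_ball_zero_iff] at ht
    rw [mem_closedBall_zero_iff]
    refine (norm_add_le _ _).trans (le_trans ?_ hx)
    rw [norm_smul]
    nlinarith [norm_nonneg t, norm_nonneg u]
  classical
  let g : ℂ → ℂ := fun t => if h : x + t • u ∈ closedBall (0 : Fin n → ℂ) R then
    polydiscEval ⟨_, h⟩ f else 0
  have hg : ∀ t ∈ ball (0 : ℂ) 1, ∀ z : closedBall (0 : Fin n → ℂ) R, z.1 = x + t • u →
      g t = polydiscEval z f := by
    rintro t ht ⟨z, hz⟩ rfl
    simp only [g, dif_pos hz]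
  refine ⟨g, ?_, hg⟩
  obtain ⟨p, hp, hlim⟩ := mem_closure_iff_seq_limit.mp (denseRange_polydiscPoly n R f)
  choose q hq using hp
  have hunif : TendstoUniformlyOn (fun j t => MvPolynomial.eval (x + t • u) (q j)) g atTop
      (ball 0 1) := by
    rw [Metric.tendstoUniformlyOn_iff]
    intro ε hε
    filter_upwards [Metric.tendsto_nhds.mp hlim ε hε] with j hj t ht
    rw [hg t ht ⟨_, hmem t ht⟩ rfl, ← polydiscEval_poly ⟨_, hmem t ht⟩, hq, dist_eq_norm,
      ← map_sub]
    refine (norm_polydiscEval_le _ _).trans_lt ?_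
    rwa [norm_sub_rev, ← dist_eq_norm]
  refine hunif.tendstoLocallyUniformlyOn.differentiableOn (Eventually.of_forall fun j => ?_)
    isOpen_ball
  exact ((differentiable_mvPolynomial_eval (q j)).comp (by fun_prop)).differentiableOn

/-- The elements of the polydisc algebra which vanish to order `k` at a point. -/
noncomputable def jetIdeal (k : ℕ) (x : closedBall (0 : Fin n → ℂ) R) :
    Ideal (polydiscAlgebra n R) where
  carrier := {f | ∃ M : ℝ, ∀ z, ‖polydiscEval z f‖ ≤ M * ‖z.1 - x.1‖ ^ k}
  zero_mem' := ⟨0, fun z => by simp⟩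
  add_mem' := by
    rintro f g ⟨M, hM⟩ ⟨M', hM'⟩
    refine ⟨M + M', fun z => ?_⟩
    rw [map_add, add_mul]
    exact (norm_add_le _ _).trans (add_le_add (hM z) (hM' z))
  smul_mem' := by
    rintro f g ⟨M, hM⟩
    refine ⟨‖f‖ * M, fun z => ?_⟩
    rw [smul_eq_mul, map_mul, norm_mul, mul_assoc]
    exact mul_le_mul (norm_polydiscEval_le z f) (hM z) (norm_nonneg _) (norm_nonneg _)

theorem mem_jetIdeal {k : ℕ} {x : closedBall (0 : Fin n → ℂ) R} {f : polydiscAlgebra n R} :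
    f ∈ jetIdeal k x ↔ ∃ M : ℝ, ∀ z, ‖polydiscEval z f‖ ≤ M * ‖z.1 - x.1‖ ^ k := Iff.rfl

theorem pow_mem_jetIdeal {x : closedBall (0 : Fin n → ℂ) R} {f : polydiscAlgebra n R}
    (hf : f ∈ jetIdeal 1 x) (k : ℕ) : f ^ k ∈ jetIdeal k x := by
  obtain ⟨M, hM⟩ := hf
  refine ⟨M ^ k, fun z => ?_⟩
  rw [map_pow, norm_pow, ← mul_pow]
  refine pow_le_pow_left₀ (norm_nonneg _) ?_ k
  simpa using hM z

theorem polydiscPoly_mem_jetIdeal_one {x : closedBall (0 : Fin n → ℂ) R}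
    {p : MvPolynomial (Fin n) ℂ} (hp : MvPolynomial.eval x.1 p = 0) :
    polydiscPoly n R p ∈ jetIdeal 1 x := by
  have hd := differentiable_mvPolynomial_eval p
  obtain ⟨C, -, hC⟩ := exists_bound_of_continuous hd.continuous 0 (R + 1)
  refine ⟨C, fun z => ?_⟩
  have h := norm_sub_le_of_entire hd hC z.2 x.2
  simpa [hp, polydiscEval_poly] using h

theorem norm_polydiscEval_le_of_mem_jetIdeal {k : ℕ} {x : closedBall (0 : Fin n → ℂ) R}
    (hx : ‖x.1‖ + 1 ≤ R) {f : polydiscAlgebra n R} (hf : f ∈ jetIdeal k x)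
    (z : closedBall (0 : Fin n → ℂ) R) : ‖polydiscEval z f‖ ≤ ‖f‖ * ‖z.1 - x.1‖ ^ k := by
  rcases k with _ | k
  · rw [pow_zero, mul_one]
    exact norm_polydiscEval_le z f
  obtain ⟨M, hM⟩ := hf
  rcases le_or_gt 1 ‖z.1 - x.1‖ with h1 | h1
  · refine (norm_polydiscEval_le z f).trans ?_
    exact le_mul_of_one_le_right (norm_nonneg _) (one_le_pow₀ h1)
  have hx0 : polydiscEval x f = 0 := by
    have h0 := hM x
    rw [sub_self, norm_zero, zero_pow (Nat.succ_ne_zero k), mul_zero] at h0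
    exact norm_le_zero_iff.mp h0
  rcases eq_or_ne z.1 x.1 with hzx | hzx
  · rw [Subtype.ext hzx, hx0, norm_zero]
    positivity
  have hpos : 0 < ‖z.1 - x.1‖ := norm_pos_iff.mpr (sub_ne_zero.mpr hzx)
  set r : ℂ := (‖z.1 - x.1‖ : ℂ) with hr
  have hr0 : r ≠ 0 := by
    rw [hr]
    exact_mod_cast hpos.ne'
  have hrn : ‖r‖ = ‖z.1 - x.1‖ := by simp [hr]
  set u : Fin n → ℂ := r⁻¹ • (z.1 - x.1) with hu
  have hun : ‖u‖ = 1 := by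
    rw [hu, norm_smul, norm_inv, hrn, inv_mul_cancel₀ hpos.ne']
  have hmem : ∀ t ∈ ball (0 : ℂ) 1, x.1 + t • u ∈ closedBall (0 : Fin n → ℂ) R := by
    intro t ht
    rw [mem_ball_zero_iff] at ht
    rw [mem_closedBall_zero_iff]
    refine (norm_add_le _ _).trans (le_trans ?_ hx)
    rw [norm_smul, hun]
    linarith
  obtain ⟨g, hgd, hg⟩ := exists_differentiableOn_polydisc_slice f hx hun.le
  have hrb : r ∈ ball (0 : ℂ) 1 := by rwa [mem_ball_zero_iff, hrn]
  have hg0 : g 0 = 0 := by rw [hg 0 (by simp) x (by simp), hx0]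
  have hgr : g r = polydiscEval z f := by
    refine hg r hrb z ?_
    rw [hu, smul_smul, mul_inv_cancel₀ hr0, one_smul]
    abel
  have hmaps : MapsTo g (ball 0 1) (closedBall (g 0) ‖f‖) := by
    intro t ht
    rw [hg0, mem_closedBall_zero_iff, hg t ht ⟨_, hmem t ht⟩ rfl]
    exact norm_polydiscEval_le _ _
  have hO : (fun t => g t - g 0) =o[𝓝 0] fun t => ‖t - 0‖ ^ k := by
    have h2 : (fun t => g t - g 0) =O[𝓝 0] fun t => ‖t - 0‖ ^ (k + 1) := by
      refine Asymptotics.IsBigO.of_bound M ?_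
      filter_upwards [ball_mem_nhds (0 : ℂ) one_pos] with t ht
      have := hM ⟨_, hmem t ht⟩
      rw [hg0, sub_zero, hg t ht ⟨_, hmem t ht⟩ rfl]
      simpa [norm_smul, hun] using this
    refine h2.trans_isLittleO ?_
    simp only [sub_zero]
    exact (Asymptotics.isLittleO_pow_pow (Nat.lt_succ_self k)).comp_tendsto
      (continuous_norm.tendsto' (0 : ℂ) 0 norm_zero)
  have := Complex.dist_le_mul_div_pow_of_mapsTo_ball_of_isLittleO hgd hmaps hO hrb
  rwa [hg0, hgr, dist_zero_right, dist_zero_right, hrn, div_one] at this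

theorem isClosed_jetIdeal {k : ℕ} {x : closedBall (0 : Fin n → ℂ) R} (hx : ‖x.1‖ + 1 ≤ R) :
    IsClosed (jetIdeal k x : Set (polydiscAlgebra n R)) := by
  have h : (jetIdeal k x : Set (polydiscAlgebra n R)) =
      ⋂ z, {f | ‖polydiscEval z f‖ ≤ ‖f‖ * ‖z.1 - x.1‖ ^ k} := by
    ext f
    rw [mem_iInter]
    exact ⟨fun hf => norm_polydiscEval_le_of_mem_jetIdeal hx hf, fun hf => ⟨‖f‖, hf⟩⟩
  rw [h]
  exact isClosed_iInter fun z =>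
    isClosed_le (continuous_polydiscEval z).norm (continuous_norm.mul continuous_const)

end JetIdeal

theorem adjoin_eq_top_of_ker_jetIdeal {n N k : ℕ} {R : ℝ} {xh : Fin N → closedBall (0 : Fin n → ℂ) R}
    {A : Type*} [NormedCommRing A] [NormedAlgebra ℂ A] {φ : polydiscAlgebra n R →ₐ[ℂ] A}
    (hφc : Continuous φ) (hφs : Function.Surjective φ)
    (hφ0 : ∀ f, φ f = 0 ↔ ∀ i, f ∈ jetIdeal k (xh i)) :
    FiniteDimensional ℂ A ∧
      Algebra.adjoin ℂ (range fun a => φ (polydiscPoly n R (MvPolynomial.X a))) = ⊤ := by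
  set S := Algebra.adjoin ℂ (range fun a => φ (polydiscPoly n R (MvPolynomial.X a))) with hS
  have hSr : S = (φ.comp (polydiscPoly n R)).range := by
    rw [hS, Algebra.adjoin_range_eq_range_aeval]
    congr 1
    ext a
    simp
  have hintegral : ∀ x ∈ range fun a => φ (polydiscPoly n R (MvPolynomial.X a)), IsIntegral ℂ x := by
    rintro _ ⟨a, rfl⟩
    refine ⟨∏ i, (Polynomial.X - Polynomial.C ((xh i).1 a)) ^ k,
      Polynomial.monic_prod_of_monic _ _ fun i _ => (Polynomial.monic_X_sub_C _).pow k, ?_⟩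
    rw [← Polynomial.aeval_def]
    have h1 : Polynomial.aeval (φ (polydiscPoly n R (MvPolynomial.X a)))
        (∏ i, (Polynomial.X - Polynomial.C ((xh i).1 a)) ^ k)
        = φ (∏ i, polydiscPoly n R (MvPolynomial.X a - MvPolynomial.C ((xh i).1 a)) ^ k) := by
      simp only [map_prod, map_pow, map_sub, Polynomial.aeval_X, Polynomial.aeval_C,
        ← MvPolynomial.algebraMap_eq, AlgHom.commutes]
    rw [h1, hφ0]
    intro i
    rw [← Finset.mul_prod_erase _ _ (Finset.mem_univ i)]
    refine Ideal.mul_mem_right _ _ (pow_mem_jetIdeal (polydiscPoly_mem_jetIdeal_one ?_) k)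
    simp
  have hfg : (Subalgebra.toSubmodule S).FG := fg_adjoin_of_finite (finite_range _) hintegral
  have hfd : FiniteDimensional ℂ (Subalgebra.toSubmodule S) := Module.Finite.iff_fg.mpr hfg
  have hclosed : IsClosed (S : Set A) :=
    Submodule.closed_of_finiteDimensional (Subalgebra.toSubmodule S)
  have htop : S = ⊤ := by
    have hdense : DenseRange fun p => φ (polydiscPoly n R p) :=
      hφs.denseRange.comp (denseRange_polydiscPoly n R) hφc
    rw [← SetLike.coe_set_eq, Algebra.coe_top, ← hclosed.closure_eq, hSr]
    exact hdense.closure_range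
  refine ⟨?_, htop⟩
  rw [htop, Algebra.top_toSubmodule] at hfg
  exact ⟨hfg⟩

theorem Ideal.exists_normed_quotient {C : Type} [NormedCommRing C] [NormedAlgebra ℂ C]
    [CompleteSpace C] (I : Ideal C) (hI : IsClosed (I : Set C)) :
    ∃ (A : Type) (_ : NormedCommRing A) (_ : NormedAlgebra ℂ A) (_ : CompleteSpace A)
      (φ : C →ₐ[ℂ] A), Continuous φ ∧ Function.Surjective φ ∧ ∀ f, φ f = 0 ↔ f ∈ I := by
  refine ⟨C ⧸ I, inferInstance, inferInstance, inferInstance, Ideal.Quotient.mkₐ ℂ I,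
    continuous_quot_mk, Ideal.Quotient.mkₐ_surjective ℂ I, fun f => ?_⟩
  rw [Ideal.Quotient.mkₐ_eq_mk, Ideal.Quotient.eq_zero_iff_mem]

theorem exists_jetAlgebra {n N : ℕ} {R : ℝ} (k : ℕ) (xh : Fin N → closedBall (0 : Fin n → ℂ) R)
    (hxh : ∀ i, ‖(xh i).1‖ + 1 ≤ R) :
    ∃ (A : Type) (_ : NormedCommRing A) (_ : NormedAlgebra ℂ A) (_ : CompleteSpace A)
      (φ : polydiscAlgebra n R →ₐ[ℂ] A), FiniteDimensional ℂ A ∧ Continuous φ ∧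
      Function.Surjective φ ∧ (∀ f, φ f = 0 ↔ ∀ i, f ∈ jetIdeal k (xh i)) ∧
      Algebra.adjoin ℂ (range fun a => φ (polydiscPoly n R (MvPolynomial.X a))) = ⊤ := by
  let I : Ideal (polydiscAlgebra n R) := ⨅ i, jetIdeal k (xh i)
  have hI : IsClosed (I : Set (polydiscAlgebra n R)) := by
    simp only [I, Submodule.coe_iInf]
    exact isClosed_iInter fun i => isClosed_jetIdeal (hxh i)
  obtain ⟨A, hA, hA', hA'', φ, hφc, hφs, hφ⟩ := I.exists_normed_quotient hI
  have hφ0 : ∀ f, φ f = 0 ↔ ∀ i, f ∈ jetIdeal k (xh i) := fun f => by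
    rw [hφ, Submodule.mem_iInf]
  obtain ⟨hfd, htop⟩ := adjoin_eq_top_of_ker_jetIdeal hφc hφs hφ0
  exact ⟨A, hA, hA', hA'', φ, hfd, hφc, hφs, hφ0, htop⟩

theorem Subalgebra.eq_top_of_forall_exists_sub_mem_sq {A : Type*} [CommRing A] [Algebra ℂ A]
    {S : Subalgebra ℂ A} {J : Ideal A} (hJ : IsNilpotent J)
    (h : ∀ x, ∃ s ∈ S, x - s ∈ J ^ 2) : S = ⊤ := by
  have hgr : ∀ r, ∀ x ∈ J ^ r, ∃ s ∈ S, s ∈ J ^ r ∧ x - s ∈ J ^ (r + 1) := by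
    intro r
    induction r with
    | zero =>
      intro x _
      obtain ⟨s, hs, hxs⟩ := h x
      exact ⟨s, hs, by simp, Ideal.pow_le_pow_right (by omega) hxs⟩
    | succ r ih =>
      intro x hx
      rw [pow_succ] at hx
      induction hx using Submodule.mul_induction_on' with
      | mem_mul_mem a ha b hb =>
        obtain ⟨s, hs, hsJ, has⟩ := ih a ha
        obtain ⟨t, ht, hbt⟩ := h b
        have htJ : t ∈ J := by
          have h1 := J.sub_mem hb (Ideal.pow_le_self two_ne_zero hbt)
          simpa using h1
        refine ⟨s * t, mul_mem hs ht, ?_, ?_⟩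
        · rw [pow_succ]
          exact Ideal.mul_mem_mul hsJ htJ
        · have h1 : a * b - s * t = (a - s) * b + s * (b - t) := by ring
          rw [h1]
          refine Ideal.add_mem _ ?_ ?_
          · rw [pow_succ]
            exact Ideal.mul_mem_mul has hb
          · rw [add_assoc, pow_add]
            exact Ideal.mul_mem_mul hsJ hbt
      | add a _ b _ ha hb =>
        obtain ⟨s, hs, hsJ, has⟩ := ha
        obtain ⟨t, ht, htJ, hbt⟩ := hb
        refine ⟨s + t, add_mem hs ht, Ideal.add_mem _ hsJ htJ, ?_⟩
        have h1 : a + b - (s + t) = (a - s) + (b - t) := by ring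
        rw [h1]
        exact Ideal.add_mem _ has hbt
  have hall : ∀ r, ∀ x, ∃ s ∈ S, x - s ∈ J ^ r := by
    intro r x
    induction r with
    | zero => exact ⟨0, zero_mem _, by simp⟩
    | succ r ih =>
      obtain ⟨s, hs, hxs⟩ := ih
      obtain ⟨t, ht, -, hxt⟩ := hgr r _ hxs
      exact ⟨s + t, add_mem hs ht, by rwa [← sub_sub]⟩
  obtain ⟨K, hK⟩ := hJ
  rw [eq_top_iff]
  intro x _
  obtain ⟨s, hs, hxs⟩ := hall K x
  rw [hK, Ideal.zero_eq_bot, Ideal.mem_bot, sub_eq_zero] at hxs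
  rwa [hxs]

theorem adjoin_eq_top_of_jets {A : Type*} [CommRing A] [Algebra ℂ A] {n N : ℕ} (hn : 0 < n) {J : Ideal A}
    (hJ : IsNilpotent J) {ev : Fin N → A →ₐ[ℂ] ℂ} (hev : ∀ x, x ∈ J ↔ ∀ i, ev i x = 0)
    {χ : Fin N → A} (hχ : ∀ i, χ i * χ i = χ i) (hχsum : ∑ i, χ i = 1)
    (hevχ : ∀ i j, ev i (χ j) = if i = j then 1 else 0)
    {z : Fin n → A} (hz : Algebra.adjoin ℂ (range z) = ⊤) {x : Fin N → Fin n → ℂ}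
    (hzx : ∀ i a, ev i (z a) = x i a) {p : Fin n → A} {y : Fin N → Fin n → ℂ}
    (hy : ∀ i j, i ≠ j → y i ≠ y j) {L M : Fin N → Matrix (Fin n) (Fin n) ℂ}
    (hL : ∀ i, M i * L i = 1)
    (hp : ∀ i a, χ i * (p a - algebraMap ℂ A (y i a))
      - ∑ b, L i a b • (χ i * (z b - algebraMap ℂ A (x i b))) ∈ J ^ 2) :
    Algebra.adjoin ℂ (range p) = ⊤ := by
  classical
  set S := Algebra.adjoin ℂ (range p) with hS
  have hpS : ∀ a, p a ∈ S := fun a => Algebra.subset_adjoin (mem_range_self a)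
  refine Subalgebra.eq_top_of_forall_exists_sub_mem_sq hJ fun a => ?_
  let T : Subalgebra ℂ A :=
    (S.map (Ideal.Quotient.mkₐ ℂ (J ^ 2))).comap (Ideal.Quotient.mkₐ ℂ (J ^ 2))
  have hT : ∀ {a}, a ∈ T ↔ ∃ s ∈ S, a - s ∈ J ^ 2 := by
    intro a
    simp only [T, Subalgebra.mem_comap, Subalgebra.mem_map, Ideal.Quotient.mkₐ_eq_mk]
    refine exists_congr fun s => and_congr_right fun _ => ?_
    rw [eq_comm, Ideal.Quotient.mk_eq_mk_iff_sub_mem]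
  rw [← hT]
  have hST : ∀ {s}, s ∈ S → s ∈ T := fun {s} hs => hT.mpr ⟨s, hs, by simp⟩
  have hJT : ∀ {s}, s ∈ J ^ 2 → s ∈ T := fun {s} hs => hT.mpr ⟨0, zero_mem _, by simpa using hs⟩
  have hevp : ∀ i a, ev i (p a) = y i a := by
    intro i a
    have h1 := (hev _).mp (Ideal.pow_le_self two_ne_zero (hp i a)) i
    simp only [map_sub, map_mul, map_sum, map_smul, hevχ, hzx, AlgHom.commutes] at h1
    simpa [sub_eq_zero] using h1
  have hχT : ∀ i, χ i ∈ T := by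
    intro i
    have hsep : ∀ j, ∃ a, j ≠ i → y i a - y j a ≠ 0 := by
      intro j
      by_cases hji : j = i
      · exact ⟨⟨0, hn⟩, fun h => absurd hji h⟩
      · obtain ⟨a, ha⟩ := Function.ne_iff.mp (hy i j (Ne.symm hji))
        exact ⟨a, fun _ => sub_ne_zero.mpr ha⟩
    choose c hc using hsep
    set u : A := ∏ j ∈ Finset.univ.erase i,
      (y i (c j) - y j (c j))⁻¹ • (p (c j) - algebraMap ℂ A (y j (c j))) with hu
    have huS : u ∈ S := prod_mem fun j _ =>
      S.smul_mem (sub_mem (hpS _) (S.algebraMap_mem _)) _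
    have hevu : ∀ l, ev l u = if l = i then 1 else 0 := by
      intro l
      simp only [hu, map_prod, map_smul, map_sub, hevp, AlgHom.commutes]
      split_ifs with h
      · subst h
        refine Finset.prod_eq_one fun j hj => ?_
        simpa using inv_mul_cancel₀ (hc j (Finset.ne_of_mem_erase hj))
      · refine Finset.prod_eq_zero (Finset.mem_erase.mpr ⟨h, Finset.mem_univ l⟩) ?_
        simp
    have hν : u - χ i ∈ J := (hev _).mpr fun l => by rw [map_sub, hevu, hevχ, sub_self]
    refine hT.mpr ⟨3 * u ^ 2 - 2 * u ^ 3, ?_, ?_⟩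
    · exact sub_mem (mul_mem (ofNat_mem _ 3) (pow_mem huS 2)) (mul_mem (ofNat_mem _ 2) (pow_mem huS 3))
    · have h1 : χ i - (3 * u ^ 2 - 2 * u ^ 3)
          = (u - χ i) ^ 2 * (6 * χ i + 2 * (u - χ i) - 3) := by
        linear_combination (6 * u - 4 * χ i - 1) * hχ i
      rw [h1]
      exact Ideal.mul_mem_right _ _ (Ideal.pow_mem_pow hν 2)
  have hχz : ∀ i a, χ i * (z a - algebraMap ℂ A (x i a)) ∈ T := by
    intro i a
    have h1 : ∀ c, ∑ b, L i c b • (χ i * (z b - algebraMap ℂ A (x i b))) ∈ T := by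
      intro c
      have h2 : χ i * (p c - algebraMap ℂ A (y i c)) ∈ T :=
        mul_mem (hχT i) (sub_mem (hST (hpS c)) (T.algebraMap_mem _))
      simpa using sub_mem h2 (hJT (hp i c))
    have h3 : χ i * (z a - algebraMap ℂ A (x i a))
        = ∑ c, M i a c • ∑ b, L i c b • (χ i * (z b - algebraMap ℂ A (x i b))) := by
      simp only [Finset.smul_sum, smul_smul]
      rw [Finset.sum_comm]
      simp only [← Finset.sum_smul, ← Matrix.mul_apply, hL, Matrix.one_apply, ite_smul, one_smul,
        zero_smul, Finset.sum_ite_eq, Finset.mem_univ, if_true]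
    rw [h3]
    exact sum_mem fun c _ => T.smul_mem (h1 c) _
  have hzT : ∀ a, z a ∈ T := by
    intro a
    have h1 : z a = ∑ i, (χ i * (z a - algebraMap ℂ A (x i a)) + χ i * algebraMap ℂ A (x i a)) := by
      simp only [← mul_add, sub_add_cancel, ← Finset.sum_mul, hχsum, one_mul]
    rw [h1]
    exact sum_mem fun i _ => add_mem (hχz i a) (mul_mem (hχT i) (T.algebraMap_mem _))
  have hle : Algebra.adjoin ℂ (range z) ≤ T := Algebra.adjoin_le (by rintro _ ⟨a, rfl⟩; exact hzT a)
  exact hle (hz ▸ Algebra.mem_top)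

/-- The polynomial map whose Taylor expansion at `x` has constant term `y` and `j`-th order
derivatives `c j` along coordinate directions, for `1 ≤ j ≤ k`. -/
noncomputable def jetPoly {n : ℕ} (k : ℕ) (x y : Fin n → ℂ)
    (c : (j : ℕ) → (Fin j → Fin n) → Fin n → ℂ) (a : Fin n) : MvPolynomial (Fin n) ℂ :=
  MvPolynomial.C (y a) + ∑ j ∈ Finset.Icc 1 k, ∑ α : Fin j → Fin n,
    ((j.factorial : ℂ)⁻¹ * c j α a) •
      ∏ l, (MvPolynomial.X (α l) - MvPolynomial.C (x (α l)))

theorem exists_mvPolynomial_eval_eq_ite {n N : ℕ} {x : Fin N → Fin n → ℂ}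
    (hx : Function.Injective x) (i : Fin N) :
    ∃ c : MvPolynomial (Fin n) ℂ, ∀ j, MvPolynomial.eval (x j) c = if j = i then 1 else 0 := by
  have hsep : ∀ j, j ≠ i → ∃ p : MvPolynomial (Fin n) ℂ,
      MvPolynomial.eval (x i) p = 1 ∧ MvPolynomial.eval (x j) p = 0 := by
    intro j hji
    obtain ⟨a, ha⟩ := Function.ne_iff.mp (hx.ne hji.symm)
    refine ⟨(x i a - x j a)⁻¹ • (MvPolynomial.X a - MvPolynomial.C (x j a)), ?_, ?_⟩
    · simpa [MvPolynomial.smul_eval] using inv_mul_cancel₀ (sub_ne_zero.mpr ha)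
    · simp [MvPolynomial.smul_eval]
  choose p hp1 hp0 using hsep
  classical
  refine ⟨∏ j, if h : j = i then 1 else p j h, fun j => ?_⟩
  rw [map_prod]
  split_ifs with hji
  · subst hji
    refine Finset.prod_eq_one fun l _ => ?_
    split_ifs with h
    · simp
    · exact hp1 l h
  · refine Finset.prod_eq_zero (Finset.mem_univ j) ?_
    rw [dif_neg hji, hp0]

theorem exists_idempotents_mod {n N K : ℕ} {x : Fin N → Fin n → ℂ} (hx : Function.Injective x)
    {I : Fin N → Ideal (MvPolynomial (Fin n) ℂ)}
    (hI : ∀ i q, MvPolynomial.eval (x i) q = 0 → q ^ K ∈ I i) :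
    ∃ χ : Fin N → MvPolynomial (Fin n) ℂ, (∀ i, 1 - χ i ∈ I i) ∧ ∀ i j, j ≠ i → χ i ∈ I j := by
  choose c hc using exists_mvPolynomial_eval_eq_ite hx
  refine ⟨fun i => 1 - (1 - c i ^ K) ^ K, fun i => ?_, fun i j hji => ?_⟩
  · rw [sub_sub_cancel]
    exact hI i _ (by simp [hc])
  · have h1 : c i ^ K ∣ 1 - (1 - c i ^ K) ^ K := by
      simpa using sub_dvd_pow_sub_pow (1 : MvPolynomial (Fin n) ℂ) (1 - c i ^ K) K
    exact Ideal.mem_of_dvd _ h1 (hI j _ (by simp [hc, hji]))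

theorem sum_mul_sub_mem {R : Type*} [CommRing R] {N : ℕ} {I : Fin N → Ideal R} {χ : Fin N → R}
    (h1 : ∀ i, 1 - χ i ∈ I i) (h0 : ∀ i j, j ≠ i → χ i ∈ I j) (q : Fin N → R) (i : Fin N) :
    ∑ j, χ j * q j - q i ∈ I i := by
  classical
  rw [← Finset.add_sum_erase _ _ (Finset.mem_univ i), add_sub_right_comm]
  refine (I i).add_mem ?_ (sum_mem fun j hj => (I i).mul_mem_right _ ?_)
  · have := (I i).mul_mem_right (-q i) (h1 i)
    convert this using 1
    ring
  · exact h0 j i (Finset.ne_of_mem_erase hj).symm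

theorem adjoin_jetPoly_eq_top {A : Type*} [CommRing A] [Algebra ℂ A] [FiniteDimensional ℂ A]
    {n N k : ℕ} (hn : 0 < n) (hk : 1 ≤ k) {x : Fin N → Fin n → ℂ}
    {I : Fin N → Ideal (MvPolynomial (Fin n) ℂ)}
    (hI0 : ∀ i, ∀ p ∈ I i, MvPolynomial.eval (x i) p = 0)
    (hI : ∀ i q, MvPolynomial.eval (x i) q = 0 → q ^ (k + 1) ∈ I i)
    {ψ : MvPolynomial (Fin n) ℂ →ₐ[ℂ] A} (hψs : Function.Surjective ψ)
    (hψ : ∀ p, ψ p = 0 ↔ ∀ i, p ∈ I i) {χ : Fin N → MvPolynomial (Fin n) ℂ}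
    (h1 : ∀ i, 1 - χ i ∈ I i) (h0 : ∀ i j, j ≠ i → χ i ∈ I j)
    {y : Fin N → Fin n → ℂ} (hy : ∀ i j, i ≠ j → y i ≠ y j)
    {c : Fin N → (j : ℕ) → (Fin j → Fin n) → Fin n → ℂ} {M : Fin N → Matrix (Fin n) (Fin n) ℂ}
    (hM : ∀ i, M i * Matrix.of (fun a b => c i 1 (fun _ => b) a) = 1) :
    Algebra.adjoin ℂ (range fun a => ψ (∑ i, χ i * jetPoly k (x i) (y i) (c i) a)) = ⊤ := by
  classical
  have hker : ∀ i, RingHom.ker ψ ≤ RingHom.ker (MvPolynomial.aeval (x i) : _ →ₐ[ℂ] ℂ) := by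
    intro i p hp
    exact hI0 i p ((hψ p).mp hp i)
  have hex : ∀ i, ∃ e : A →ₐ[ℂ] ℂ, ∀ p, e (ψ p) = MvPolynomial.eval (x i) p := by
    intro i
    refine ⟨(Ideal.Quotient.liftₐ (RingHom.ker ψ) (MvPolynomial.aeval (x i)) (hker i)).comp
      (Ideal.quotientKerAlgEquivOfSurjective hψs).symm.toAlgHom, fun p => ?_⟩
    have h2 : (Ideal.quotientKerAlgEquivOfSurjective hψs).symm (ψ p)
        = Ideal.Quotient.mk (RingHom.ker ψ) p := by
      rw [AlgEquiv.symm_apply_eq]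
      rfl
    simp [h2]
    rfl
  choose ev hev using hex
  have hevχ : ∀ i j, MvPolynomial.eval (x i) (χ j) = if i = j then 1 else 0 := by
    intro i j
    split_ifs with h
    · subst h
      have := hI0 i _ (h1 i)
      rw [map_sub, map_one, sub_eq_zero] at this
      exact this.symm
    · exact hI0 i _ (h0 j i h)
  have hχ : ∀ i, ψ (χ i) * ψ (χ i) = ψ (χ i) := by
    intro i
    rw [← map_mul, ← sub_eq_zero, ← map_sub, hψ]
    intro l
    have h2 : χ i * χ i - χ i = χ i * -(1 - χ i) := by ring
    rw [h2]
    by_cases hli : l = i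
    · subst hli
      exact (I l).mul_mem_left _ (neg_mem (h1 l))
    · exact (I l).mul_mem_right _ (h0 i l hli)
  have hχsum : ∑ i, ψ (χ i) = 1 := by
    rw [← map_sum, ← sub_eq_zero, ← map_one ψ, ← map_sub, hψ]
    intro i
    simpa using sum_mul_sub_mem h1 h0 (fun _ => 1) i
  let J : Ideal A := ⨅ i, RingHom.ker (ev i)
  have hJ : ∀ a, a ∈ J ↔ ∀ i, ev i a = 0 := by
    intro a
    simp [J, Submodule.mem_iInf, RingHom.mem_ker]
  have hnil : IsNilpotent J := by
    have : IsNoetherianRing A := isNoetherian_of_tower ℂ inferInstance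
    obtain ⟨r, hr⟩ := IsNoetherianRing.isNilpotent_nilradical A
    refine ⟨r, le_bot_iff.mp ((Ideal.pow_right_mono ?_ r).trans hr.le)⟩
    intro a ha
    obtain ⟨p, rfl⟩ := hψs a
    refine ⟨k + 1, ?_⟩
    rw [← map_pow, Ideal.zero_eq_bot, Ideal.mem_bot, hψ]
    intro i
    refine hI i p ?_
    rw [← hev]
    exact (hJ _).mp ha i
  refine adjoin_eq_top_of_jets (ev := ev) (χ := fun i => ψ (χ i)) (z := fun a => ψ (MvPolynomial.X a))
    (x := x) (y := y) (M := M) (L := fun i => Matrix.of (fun a b => c i 1 (fun _ => b) a)) hn hnil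
    hJ hχ hχsum (fun i j => by rw [hev, hevχ]) ?_ (fun i a => by rw [hev, MvPolynomial.eval_X]) hy hM ?_
  · rw [← AlgHom.range_eq_top] at hψs
    rw [← hψs, Algebra.adjoin_range_eq_range_aeval]
    congr 1
    ext a
    simp
  · intro i a
    have h2 : ψ (χ i) * ψ (∑ j, χ j * jetPoly k (x j) (y j) (c j) a)
        = ψ (χ i) * ψ (jetPoly k (x i) (y i) (c i) a) := by
      rw [← map_mul, ← map_mul, ← sub_eq_zero, ← map_sub, hψ]
      intro l
      rw [← mul_sub]
      by_cases hli : l = i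
      · subst hli
        exact (I l).mul_mem_left _ (sum_mul_sub_mem h1 h0 _ l)
      · exact (I l).mul_mem_right _ (h0 i l hli)
    have hmemJ : ∀ b, ψ (χ i) * (ψ (MvPolynomial.X b) - algebraMap ℂ A (x i b)) ∈ J := by
      intro b
      rw [hJ]
      intro l
      rw [map_mul, map_sub, hev, hev, hevχ, AlgHom.commutes]
      split_ifs with hli
      · simp [hli]
      · simp
    have hprod : ∀ (j : ℕ) (α : Fin (j + 1) → Fin n),
        ψ (χ i) * ∏ l, (ψ (MvPolynomial.X (α l)) - algebraMap ℂ A (x i (α l)))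
        = ∏ l, (ψ (χ i) * (ψ (MvPolynomial.X (α l)) - algebraMap ℂ A (x i (α l)))) := by
      intro j α
      rw [Finset.prod_mul_distrib, Finset.prod_const, Finset.card_univ, Fintype.card_fin,
        IsIdempotentElem.pow_succ_eq j (hχ i)]
    have h3 : ψ (jetPoly k (x i) (y i) (c i) a) = algebraMap ℂ A (y i a) +
        ∑ j ∈ Finset.Icc 1 k, ∑ α : Fin j → Fin n, ((j.factorial : ℂ)⁻¹ * c i j α a) •
          ∏ l, (ψ (MvPolynomial.X (α l)) - algebraMap ℂ A (x i (α l))) := by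
      simp only [jetPoly, map_add, map_sum, map_smul, map_prod, map_sub,
        ← MvPolynomial.algebraMap_eq, AlgHom.commutes]
    rw [mul_sub, h2, h3, mul_add, add_sub_cancel_left, ← Finset.add_sum_Ioc_eq_sum_Icc hk, mul_add,
      add_sub_right_comm]
    refine (J ^ 2).add_mem ?_ ?_
    · convert (J ^ 2).zero_mem using 1
      rw [sub_eq_zero, ← (Equiv.funUnique (Fin 1) (Fin n)).symm.sum_comp]
      simp [Finset.mul_sum]
      rfl
    · rw [Finset.mul_sum]
      refine sum_mem fun j hj => ?_
      rw [Finset.mem_Ioc] at hj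
      obtain ⟨j, rfl⟩ : ∃ r, j = r + 2 := ⟨j - 2, by omega⟩
      rw [Finset.mul_sum]
      refine sum_mem fun α _ => ?_
      rw [mul_smul_comm, hprod, ← algebraMap_smul A]
      refine (J ^ 2).smul_mem _ ?_
      have h4 : ∏ l, (ψ (χ i) * (ψ (MvPolynomial.X (α l)) - algebraMap ℂ A (x i (α l))))
          ∈ ∏ _l : Fin (j + 2), J := Ideal.prod_mem_prod fun l _ => hmemJ (α l)
      rw [Finset.prod_const, Finset.card_univ, Fintype.card_fin] at h4
      exact Ideal.pow_le_pow_right (by omega) h4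

theorem norm_sub_le_of_tendsto_mod_ker {E A : Type*} [NormedAddCommGroup E] [NormedSpace ℂ E]
    [NormedAddCommGroup A] [NormedSpace ℂ A] [FiniteDimensional ℂ A] {φ : E →L[ℂ] A}
    (hφ : Function.Surjective φ) {ev : E →L[ℂ] ℂ} {δ : ℝ} (hδ : 0 ≤ δ)
    (hker : ∀ f, φ f = 0 → ‖ev f‖ ≤ ‖f‖ * δ) {b : ℕ → E} {e : E}
    (hb : Tendsto (fun j => φ (b j)) atTop (𝓝 (φ e))) {B : ℝ} (hB : ∀ᶠ j in atTop, ‖b j‖ ≤ B)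
    {v : ℂ} (hv : Tendsto (fun j => ev (b j)) atTop (𝓝 v)) :
    ‖v - ev e‖ ≤ (B + ‖e‖ + 1) * δ := by
  obtain ⟨s, hs⟩ := φ.toLinearMap.exists_rightInverse_of_surjective (LinearMap.range_eq_top.mpr hφ)
  have hsφ : ∀ a, φ (s a) = a := fun a => LinearMap.congr_fun hs a
  have hsc : Continuous s := s.continuous_of_finiteDimensional
  have h0 : Tendsto (fun j => s (φ (b j) - φ e)) atTop (𝓝 0) := by
    have h1 : Tendsto (fun j => φ (b j) - φ e) atTop (𝓝 0) := by
      simpa using hb.sub_const (φ e)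
    exact ((hsc.tendsto' 0 0 (map_zero s)).comp h1)
  have hlim : Tendsto (fun j => ‖ev (b j - e - s (φ (b j) - φ e))‖) atTop (𝓝 ‖v - ev e‖) := by
    have h1 := (hv.sub_const (ev e)).sub ((ev.continuous.tendsto 0).comp h0)
    simp only [map_zero, sub_zero] at h1
    simpa only [map_sub, Function.comp_def] using h1.norm
  refine le_of_tendsto hlim ?_
  filter_upwards [hB, h0.norm.eventually (ge_mem_nhds (by simp : ‖(0 : E)‖ < 1))] with j hj hj'
  refine (hker _ (by simp [hsφ])).trans (mul_le_mul_of_nonneg_right ?_ hδ)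
  have h2 := norm_sub_le (b j - e) (s (φ (b j) - φ e))
  have h3 := norm_sub_le (b j) e
  linarith

theorem norm_polydiscAlgebra_le {n : ℕ} {R : ℝ} {f : polydiscAlgebra n R} {C : ℝ} (hC : 0 ≤ C)
    (h : ∀ z, ‖polydiscEval z f‖ ≤ C) : ‖f‖ ≤ C :=
  (ContinuousMap.norm_le _ hC).mpr h

theorem differentiable_map_jetPoly {A : Type*} [NormedCommRing A] [NormedAlgebra ℂ A] {m n k : ℕ}
    (ψ : MvPolynomial (Fin n) ℂ →ₐ[ℂ] A) (x : Fin n → ℂ) {y : (Fin m → ℂ) → Fin n → ℂ}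
    (hy : Differentiable ℂ y) {c : (j : ℕ) → (Fin j → Fin n) → (Fin m → ℂ) → Fin n → ℂ}
    (hc : ∀ j, 1 ≤ j → j ≤ k → ∀ α, Differentiable ℂ (c j α)) (a : Fin n) :
    Differentiable ℂ fun w => ψ (jetPoly k x (y w) (fun j α => c j α w) a) := by
  simp only [jetPoly, map_add, map_sum, map_smul, ← MvPolynomial.algebraMap_eq, AlgHom.commutes,
    Algebra.algebraMap_eq_smul_one (A := A)]
  refine Differentiable.fun_add ?_ ?_
  · exact (differentiable_pi.mp hy a).smul_const _
  · refine Differentiable.fun_sum fun j hj => Differentiable.fun_sum fun α _ => ?_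
    rw [Finset.mem_Icc] at hj
    exact ((differentiable_pi.mp (hc j hj.1 hj.2 α) a).const_mul _).smul_const _

theorem exists_jetIdeal_mvPolynomial {n N : ℕ} {R : ℝ} (k : ℕ)
    (xh : Fin N → closedBall (0 : Fin n → ℂ) R) :
    ∃ I : Fin N → Ideal (MvPolynomial (Fin n) ℂ),
      (∀ i p, p ∈ I i ↔ polydiscPoly n R p ∈ jetIdeal (k + 1) (xh i)) ∧
      (∀ i, ∀ p ∈ I i, MvPolynomial.eval (xh i).1 p = 0) ∧
      ∀ i q, MvPolynomial.eval (xh i).1 q = 0 → q ^ (k + 1) ∈ I i := by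
  have hmem : ∀ i p, p ∈ (jetIdeal (k + 1) (xh i)).comap (polydiscPoly n R) ↔
      polydiscPoly n R p ∈ jetIdeal (k + 1) (xh i) := fun i p => Ideal.mem_comap
  refine ⟨fun i => (jetIdeal (k + 1) (xh i)).comap (polydiscPoly n R), hmem, fun i p hp => ?_,
    fun i q hq => ?_⟩
  · obtain ⟨M, hM⟩ := mem_jetIdeal.mp ((hmem i p).mp hp)
    have h1 := hM (xh i)
    rw [polydiscEval_poly, sub_self, norm_zero, zero_pow k.succ_ne_zero, mul_zero] at h1
    exact norm_le_zero_iff.mp h1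
  · rw [hmem, map_pow]
    exact pow_mem_jetIdeal (polydiscPoly_mem_jetIdeal_one hq) _

theorem exists_norm_sub_le_of_tendsto_act {ι : Type*} [Fintype ι] {n : ℕ} (F : ι → Overshear n)
    {W Z B A : Type*} [NormedCommRing B] [NormedAlgebra ℂ B] [CompleteSpace B] [NormedCommRing A]
    [NormedAlgebra ℂ A] [CompleteSpace A] [FiniteDimensional ℂ A] {φ : B →ₐ[ℂ] A}
    (hφc : Continuous φ) (hφs : Function.Surjective φ) {ev : Z → B →ₐ[ℂ] ℂ}
    (hev : ∀ z, Continuous (ev z)) (hevle : ∀ z f, ‖ev z f‖ ≤ ‖f‖)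
    (hleev : ∀ f c, 0 ≤ c → (∀ z, ‖ev z f‖ ≤ c) → ‖f‖ ≤ c) {δ : Z → ℝ} (hδ : ∀ z, 0 ≤ δ z)
    (hker : ∀ f, φ f = 0 → ∀ z, ‖ev z f‖ ≤ ‖f‖ * δ z) {l : ℕ → List (W → ι → ℂ)} {w : W}
    {p e : Fin n → B}
    (hjet : Tendsto (fun j => (Overshear.spray F A).act (l j) w fun a => φ (p a)) atTop
      (𝓝 fun a => φ (e a)))
    (hbdd : ∀ r, ∃ C, ∀ᶠ j in atTop, ∀ x ∈ closedBall (0 : Fin n → ℂ) r,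
      ‖(Overshear.spray F ℂ).act (l j) w x‖ ≤ C) {v : Z → Fin n → ℂ}
    (hlim : ∀ z, Tendsto (fun j => (Overshear.spray F ℂ).act (l j) w fun a => ev z (p a)) atTop
      (𝓝 (v z))) :
    ∃ C, ∀ z, ‖v z - fun a => ev z (e a)‖ ≤ C * δ z := by
  set b : ℕ → Fin n → B := fun j => (Overshear.spray F B).act (l j) w p with hb
  have hbφ : ∀ j, (fun a => φ (b j a)) = (Overshear.spray F A).act (l j) w fun a => φ (p a) :=
    fun j => Overshear.map_act F φ hφc (l j) w p
  have hbev : ∀ z j, (fun a => ev z (b j a)) =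
      (Overshear.spray F ℂ).act (l j) w fun a => ev z (p a) :=
    fun z j => Overshear.map_act F (ev z) (hev z) (l j) w p
  simp only [← hbφ] at hjet
  obtain ⟨C, hC⟩ := hbdd ‖p‖
  have hbC : ∀ a, ∀ᶠ j in atTop, ‖b j a‖ ≤ max C 0 := by
    intro a
    filter_upwards [hC] with j hj
    refine hleev _ _ (le_max_right _ _) fun z => ?_
    have h1 := hj (fun a => ev z (p a)) ?_
    · rw [← hbev] at h1
      exact ((norm_le_pi_norm (fun a => ev z (b j a)) a).trans h1).trans (le_max_left _ _)
    · rw [mem_closedBall_zero_iff]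
      exact (pi_norm_le_iff_of_nonneg (norm_nonneg _)).mpr fun a =>
        (hevle z _).trans (norm_le_pi_norm p a)
  refine ⟨max C 0 + ‖e‖ + 1, fun z => (pi_norm_le_iff_of_nonneg ?_).mpr fun a => ?_⟩
  · have := hδ z
    positivity
  have h1 := norm_sub_le_of_tendsto_mod_ker (φ := (⟨φ.toLinearMap, hφc⟩ : B →L[ℂ] A)) hφs
    (ev := ⟨(ev z).toLinearMap, hev z⟩) (hδ z) (fun f hf => hker f hf z) (b := fun j => b j a)
    (e := e a) (v := v z a) (tendsto_pi_nhds.mp hjet a) (hbC a) ?_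
  · refine h1.trans (mul_le_mul_of_nonneg_right ?_ (hδ z))
    linarith [norm_le_pi_norm e a]
  · have h2 := hlim z
    simp only [← hbev] at h2
    exact tendsto_pi_nhds.mp h2 a

theorem exists_norm_inverse_sub_le {E : Type*} [NormedAddCommGroup E] [NormedSpace ℂ E]
    [FiniteDimensional ℂ E] {G H p : E → E} (hH : Differentiable ℂ H) (hHG : ∀ z, H (G z) = z)
    {x : E} {C : ℝ} {K : ℕ} (hC : ∀ z ∈ closedBall x 1, ‖G (p z) - z‖ ≤ C * ‖z - x‖ ^ K) :
    ∃ C', ∀ z ∈ closedBall x 1, ‖H z - p z‖ ≤ C' * ‖z - x‖ ^ K := by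
  have : ProperSpace E := FiniteDimensional.proper ℂ E
  obtain ⟨D, hD0, hD⟩ := exists_bound_of_continuous hH.continuous x (1 + |C| + 1)
  refine ⟨D * C, fun z hz => ?_⟩
  have hz1 : ‖z - x‖ ≤ 1 := by rwa [mem_closedBall, dist_eq_norm] at hz
  have h1 : ‖G (p z) - z‖ ≤ |C| := by
    refine (hC z hz).trans ?_
    have h2 : ‖z - x‖ ^ K ≤ 1 := pow_le_one₀ (norm_nonneg _) hz1
    have h3 : 0 ≤ ‖z - x‖ ^ K := by positivity
    nlinarith [le_abs_self C, abs_nonneg C]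
  have hmem : G (p z) ∈ closedBall x (1 + |C|) := by
    rw [mem_closedBall, dist_eq_norm]
    have h2 := norm_add_le (G (p z) - z) (z - x)
    rw [sub_add_sub_cancel] at h2
    linarith
  have h4 := norm_sub_le_of_entire hH hD
    (closedBall_subset_closedBall (by linarith [abs_nonneg C]) hz) hmem
  rw [hHG, norm_sub_rev z] at h4
  exact h4.trans (by rw [mul_assoc]; exact mul_le_mul_of_nonneg_left (hC z hz) hD0)

theorem exists_norm_sub_le_of_tendsto_act_polydisc {ι : Type*} [Fintype ι] {n k : ℕ} {R : ℝ}
    (F : ι → Overshear n) {W A : Type*} [NormedCommRing A] [NormedAlgebra ℂ A] [CompleteSpace A]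
    [FiniteDimensional ℂ A] {φ : polydiscAlgebra n R →ₐ[ℂ] A} (hφc : Continuous φ)
    (hφs : Function.Surjective φ) {x : closedBall (0 : Fin n → ℂ) R} (hx : ‖x.1‖ + 1 ≤ R)
    (hφ : ∀ f, φ f = 0 → f ∈ jetIdeal k x) {l : ℕ → List (W → ι → ℂ)} {w : W}
    {p e : Fin n → MvPolynomial (Fin n) ℂ}
    (hjet : Tendsto (fun j => (Overshear.spray F A).act (l j) w
      fun a => φ (polydiscPoly n R (p a))) atTop (𝓝 fun a => φ (polydiscPoly n R (e a))))
    (hbdd : ∀ r, ∃ C, ∀ᶠ j in atTop, ∀ x ∈ closedBall (0 : Fin n → ℂ) r,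
      ‖(Overshear.spray F ℂ).act (l j) w x‖ ≤ C) {v : closedBall (0 : Fin n → ℂ) R → Fin n → ℂ}
    (hlim : ∀ z : closedBall (0 : Fin n → ℂ) R, Tendsto (fun j => (Overshear.spray F ℂ).act (l j) w
      fun a => MvPolynomial.eval z.1 (p a)) atTop (𝓝 (v z))) :
    ∃ C, ∀ z, ‖v z - fun a => MvPolynomial.eval z.1 (e a)‖ ≤ C * ‖z.1 - x.1‖ ^ k := by
  have hev : ∀ (q : Fin n → MvPolynomial (Fin n) ℂ) (z : closedBall (0 : Fin n → ℂ) R),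
      (fun a => MvPolynomial.eval z.1 (q a)) = fun a => polydiscEval z (polydiscPoly n R (q a)) :=
    fun q z => funext fun a => (polydiscEval_poly z _).symm
  simp only [hev] at hlim ⊢
  have hδ : ∀ z : closedBall (0 : Fin n → ℂ) R, 0 ≤ ‖z.1 - x.1‖ ^ k := fun z => by positivity
  have hker : ∀ f, φ f = 0 → ∀ z, ‖polydiscEval z f‖ ≤ ‖f‖ * ‖z.1 - x.1‖ ^ k :=
    fun f hf => norm_polydiscEval_le_of_mem_jetIdeal hx (hφ f hf)
  have hle : ∀ (f : polydiscAlgebra n R) (c : ℝ), 0 ≤ c → (∀ z, ‖polydiscEval z f‖ ≤ c) → ‖f‖ ≤ c :=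
    fun f c hc h => norm_polydiscAlgebra_le hc h
  exact exists_norm_sub_le_of_tendsto_act F hφc hφs continuous_polydiscEval norm_polydiscEval_le hle
    hδ hker hjet hbdd hlim

theorem exists_automorphisms_of_jets {m n k N : ℕ} (hn : 2 ≤ n) (hk : 1 ≤ k)
    {x : Fin N → Fin n → ℂ} (hx : Function.Injective x) {y : Fin N → (Fin m → ℂ) → Fin n → ℂ}
    (hyd : ∀ i, Differentiable ℂ (y i)) (hy : ∀ i j, i ≠ j → ∀ w, y i w ≠ y j w)
    {c : Fin N → (j : ℕ) → (Fin j → Fin n) → (Fin m → ℂ) → Fin n → ℂ}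
    (hc : ∀ i j, 1 ≤ j → j ≤ k → ∀ α, Differentiable ℂ (c i j α))
    (hM : ∀ i w, ∃ M : Matrix (Fin n) (Fin n) ℂ,
      M * Matrix.of (fun a b => c i 1 (fun _ => b) w a) = 1) :
    ∃ Ξ Ξ' : (Fin m → ℂ) × (Fin n → ℂ) → Fin n → ℂ, Differentiable ℂ Ξ ∧ Differentiable ℂ Ξ' ∧
      (∀ w z, Ξ' (w, Ξ (w, z)) = z) ∧ (∀ w z, Ξ (w, Ξ' (w, z)) = z) ∧
      ∀ i w, ∃ C, ∀ z ∈ closedBall (x i) 1,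
        ‖Ξ' (w, z) - fun a => MvPolynomial.eval z
          (jetPoly k (x i) (y i w) (fun j α => c i j α w) a)‖ ≤ C * ‖z - x i‖ ^ (k + 1) := by
  set R : ℝ := ∑ i, ‖x i‖ + 1 with hR
  have hxR : ∀ i, ‖x i‖ + 1 ≤ R := fun i => by
    have := Finset.single_le_sum (fun j _ => norm_nonneg (x j)) (Finset.mem_univ i)
    linarith
  have hball : ∀ i, ∀ z ∈ closedBall (x i) 1, z ∈ closedBall (0 : Fin n → ℂ) R := by
    intro i z hz
    rw [mem_closedBall, dist_eq_norm] at hz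
    rw [mem_closedBall_zero_iff]
    linarith [hxR i, norm_le_norm_add_norm_sub' z (x i)]
  let xh : Fin N → closedBall (0 : Fin n → ℂ) R := fun i => ⟨x i, hball i _ (by simp)⟩
  obtain ⟨A, hA1, hA2, hA3, φ, hfd, hφc, hφs, hφ0, hgen⟩ := exists_jetAlgebra (k + 1) xh hxR
  obtain ⟨I, hImem, hI0, hI⟩ := exists_jetIdeal_mvPolynomial k xh
  obtain ⟨χ, hχ1, hχ0⟩ := exists_idempotents_mod hx hI
  let ψ : MvPolynomial (Fin n) ℂ →ₐ[ℂ] A := φ.comp (polydiscPoly n R)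
  have hψ : ∀ p, ψ p = 0 ↔ ∀ i, p ∈ I i := fun p => by
    simp only [hImem]
    exact hφ0 _
  have hψs : Function.Surjective ψ := by
    rw [← AlgHom.range_eq_top, ← hgen, Algebra.adjoin_range_eq_range_aeval]
    congr 1
    ext a
    simp [ψ]
  let P : (Fin m → ℂ) → Fin n → MvPolynomial (Fin n) ℂ := fun w a =>
    ∑ i, χ i * jetPoly k (x i) (y i w) (fun j α => c i j α w) a
  have hγ : Differentiable ℂ fun w a => ψ (P w a) := by
    refine differentiable_pi.mpr fun a => ?_
    simp only [P, map_sum, map_mul]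
    exact Differentiable.fun_sum fun i _ =>
      (differentiable_map_jetPoly ψ (x i) (hyd i) (hc i) a).const_mul _
  have hγU : ∀ w, (fun a => ψ (P w a)) ∈ {p : Fin n → A | Algebra.adjoin ℂ (range p) = ⊤} := by
    intro w
    choose M hM using hM
    exact adjoin_jetPoly_eq_top (by omega) hk hI0 hI hψs hψ hχ1 hχ0
      (fun i j hij => hy i j hij w) (M := fun i => M i w) fun i => hM i w
  let F := Overshear.family n (Module.finrank ℂ A + 1)
  obtain ⟨l, Ξ, Ξ', hΞ, hΞ', hinv, hinv', hlim, hbdd, hjet⟩ :=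
    Spray.exists_limit (Overshear.spray F A) (Overshear.spray F ℂ)
      (U := {p : Fin n → A | Algebra.adjoin ℂ (range p) = ⊤})
      (fun τ p hp => Overshear.adjoin_spray_eq_top F τ hp)
      (fun p hp => Overshear.surjective_spray_M hn (Nat.lt_succ_self _) hp)
      Overshear.isPreconnected_setOf_adjoin_eq_top hgen hγ hγU
  refine ⟨Ξ, Ξ', hΞ, hΞ', hinv, hinv', fun i w => ?_⟩
  obtain ⟨C, hC⟩ := exists_norm_sub_le_of_tendsto_act_polydisc F hφc hφs (hxR i)
    (fun f hf => (hφ0 f).mp hf i) (hjet w) (hbdd w) (fun z => hlim w _)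
  obtain ⟨C', hC'⟩ := exists_norm_inverse_sub_le (G := fun z => Ξ (w, z)) (H := fun z => Ξ' (w, z))
    (hΞ'.comp ((differentiable_const w).prodMk differentiable_id)) (hinv w)
    (p := fun z a => MvPolynomial.eval z (P w a)) (x := x i) (C := C) (K := k + 1) (by
      intro z hz
      have h1 := hC ⟨z, hball i z hz⟩
      simp only [MvPolynomial.eval_X] at h1
      exact h1)
  have hPQ : ∀ a, ∃ M : ℝ, ∀ z : closedBall (0 : Fin n → ℂ) R, ‖MvPolynomial.eval z.1 (P w a)
      - MvPolynomial.eval z.1 (jetPoly k (x i) (y i w) (fun j α => c i j α w) a)‖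
      ≤ M * ‖z.1 - x i‖ ^ (k + 1) := by
    intro a
    obtain ⟨M, hM⟩ := mem_jetIdeal.mp ((hImem i _).mp (sum_mul_sub_mem hχ1 hχ0
      (fun i => jetPoly k (x i) (y i w) (fun j α => c i j α w) a) i))
    refine ⟨M, fun z => ?_⟩
    rw [← map_sub, ← polydiscEval_poly]
    exact hM z
  choose M hM using hPQ
  refine ⟨C' + ∑ a, |M a|, fun z hz => ?_⟩
  rw [add_mul]
  refine (norm_sub_le_norm_sub_add_norm_sub _ (fun a => MvPolynomial.eval z (P w a)) _).trans
    (add_le_add (hC' z hz) ((pi_norm_le_iff_of_nonneg (by positivity)).mpr fun a => ?_))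
  refine (hM a ⟨z, hball i z hz⟩).trans (mul_le_mul_of_nonneg_right ?_ (by positivity))
  exact (le_abs_self _).trans (Finset.single_le_sum (fun a _ => abs_nonneg (M a)) (Finset.mem_univ a))

theorem iteratedFDeriv_sum_formalMultilinearSeries {E F : Type*} [NormedAddCommGroup E]
    [NormedSpace ℂ E] [NormedAddCommGroup F] [NormedSpace ℂ F] [CompleteSpace F]
    (p : FormalMultilinearSeries ℂ E F) (k : ℕ) (hp : ∀ j, k < j → p j = 0) (x : E) {j : ℕ}
    (hsymm : ∀ (σ : Equiv.Perm (Fin j)) v, p j (v ∘ σ) = p j v) :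
    iteratedFDeriv ℂ j (fun z => ∑ l ∈ Finset.range (k + 1), p l fun _ => z - x) x
      = (j.factorial : ℂ) • p j := by
  have h : HasFPowerSeriesOnBall (fun z => ∑ l ∈ Finset.range (k + 1), p l fun _ => z - x) p x ⊤ :=
    { r_le := by
        rw [p.radius_eq_top_of_forall_image_add_eq_zero (k + 1) fun m => hp _ (by omega)]
      r_pos := by simp
      hasSum := by
        intro v _
        simp only [add_sub_cancel_left]
        refine hasSum_sum_of_ne_finset_zero fun l hl => ?_
        rw [hp l (by simpa using hl)]
        rfl }
  ext v
  refine (h.iteratedFDeriv_eq_sum (fun z _ => ?_) v).trans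
    ((Finset.sum_congr rfl fun σ _ => hsymm σ v).trans ?_)
  · exact (h.analyticAt_of_mem (by simp)).analyticWithinAt
  · rw [Finset.sum_const, Finset.card_univ, Fintype.card_perm, Fintype.card_fin,
      smul_apply, Nat.cast_smul_eq_nsmul]

theorem ContinuousMultilinearMap.apply_const_eq_sum {n j : ℕ} {E F : Type*} [NormedAddCommGroup E]
    [NormedSpace ℂ E] [NormedAddCommGroup F] [NormedSpace ℂ F] (e : E ≃L[ℂ] (Fin n → ℂ))
    (B : ContinuousMultilinearMap ℂ (fun _ : Fin j => E) F) (v : E) :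
    B (fun _ => v) = ∑ α : Fin j → Fin n,
      (∏ l, e v (α l)) • B fun l => e.symm (Pi.single (α l) 1) := by
  have hv : v = ∑ b, e v b • e.symm (Pi.single b 1) := by
    apply e.injective
    ext a
    simp [Pi.single_apply]
  conv_lhs => rw [hv]
  rw [B.map_sum]
  exact Finset.sum_congr rfl fun α _ => B.map_smul_univ _ _

theorem iteratedFDeriv_eq_of_norm_sub_le {E F : Type} [NormedAddCommGroup E] [NormedSpace ℂ E]
    [FiniteDimensional ℂ E] [NormedAddCommGroup F] [NormedSpace ℂ F] [CompleteSpace F] {k : ℕ}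
    {y : F} {B : (j : ℕ) → ContinuousMultilinearMap ℂ (fun _ : Fin j => E) F}
    (hB : ∀ j, 1 ≤ j → j ≤ k → ∀ (σ : Equiv.Perm (Fin j)) v, B j (v ∘ σ) = B j v)
    {g : E → F} (hg : Differentiable ℂ g) {x : E} {C r : ℝ} (hr : 0 < r)
    (h : ∀ z ∈ closedBall x r, ‖g z - (y + ∑ j ∈ Finset.Icc 1 k, (j.factorial : ℂ)⁻¹ •
      B j fun _ => z - x)‖ ≤ C * ‖z - x‖ ^ (k + 1)) :
    g x = y ∧ ∀ j, 1 ≤ j → j ≤ k → iteratedFDeriv ℂ j g x = B j := by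
  let p : FormalMultilinearSeries ℂ E F
    | 0 => ContinuousMultilinearMap.uncurry0 ℂ E y
    | j + 1 => if j + 1 ≤ k then ((j + 1).factorial : ℂ)⁻¹ • B (j + 1) else 0
  have hp : ∀ j, 1 ≤ j → j ≤ k → p j = (j.factorial : ℂ)⁻¹ • B j := by
    intro j hj hjk
    obtain ⟨j, rfl⟩ := Nat.exists_eq_add_of_le' hj
    exact if_pos hjk
  have hp0 : ∀ j, k < j → p j = 0 := by
    intro j hj
    obtain ⟨j, rfl⟩ := Nat.exists_eq_add_of_le' (Nat.one_le_of_lt hj)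
    exact if_neg (by omega)
  have hT : ∀ z, y + ∑ j ∈ Finset.Icc 1 k, (j.factorial : ℂ)⁻¹ • B j (fun _ => z - x)
      = ∑ l ∈ Finset.range (k + 1), p l fun _ => z - x := by
    intro z
    rw [Finset.range_eq_Ico, ← Finset.add_sum_Ioo_eq_sum_Ico (Nat.succ_pos k)]
    refine congrArg₂ _ rfl (Finset.sum_congr (by ext; simp; omega) fun j hj => ?_)
    rw [Finset.mem_Ioo] at hj
    rw [hp j (by omega) (by omega)]
    rfl
  simp only [hT] at h
  have hTd : Differentiable ℂ fun z => ∑ l ∈ Finset.range (k + 1), p l fun _ => z - x :=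
    Differentiable.fun_sum fun l _ => (p l).contDiff.differentiable (n := 1) one_ne_zero |>.comp
      (differentiable_pi.mpr fun _ => differentiable_id.sub_const x)
  constructor
  · have h1 := h x (mem_closedBall_self hr.le)
    rw [← hT, sub_self, norm_zero, zero_pow k.succ_ne_zero, mul_zero, norm_le_zero_iff,
      sub_eq_zero] at h1
    rw [h1, add_eq_left]
    refine Finset.sum_eq_zero fun j hj => ?_
    rw [(B j).map_coord_zero (⟨0, (Finset.mem_Icc.mp hj).1⟩ : Fin j) rfl, smul_zero]
  · intro j hj hjk
    have h1 := iteratedFDeriv_eq_zero_of_norm_le (hg.fun_sub hTd) hr h hjk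
    have h2 := iteratedFDeriv_sub_apply (i := j) (x := x) (contDiff_of_entire hg).contDiffAt
      (contDiff_of_entire hTd).contDiffAt
    have h3 := iteratedFDeriv_sum_formalMultilinearSeries p k hp0 x (j := j) fun σ v => by
      rw [hp j hj hjk]
      exact congrArg ((j.factorial : ℂ)⁻¹ • ·) (hB j hj hjk σ v)
    rw [h3, hp j hj hjk, smul_smul, mul_inv_cancel₀ (by exact_mod_cast j.factorial_ne_zero),
      one_smul] at h2
    exact (sub_eq_zero.mp (h2.symm.trans h1))

theorem exists_matrix_mul_eq_one {n : ℕ} {E : Type*} [NormedAddCommGroup E] [NormedSpace ℂ E]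
    (e : E ≃L[ℂ] (Fin n → ℂ)) (B : ContinuousMultilinearMap ℂ (fun _ : Fin 1 => E) E)
    (hB : Function.Injective fun v => B fun _ => v) :
    ∃ M : Matrix (Fin n) (Fin n) ℂ,
      M * Matrix.of (fun a b => e (B fun _ => e.symm (Pi.single b 1)) a) = 1 := by
  set L := Matrix.of (fun a b => e (B fun _ => e.symm (Pi.single b 1)) a) with hL
  have hmul : ∀ v, L.mulVec v = e (B fun _ => e.symm v) := by
    intro v
    rw [B.apply_const_eq_sum e, ← (Equiv.funUnique (Fin 1) (Fin n)).symm.sum_comp]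
    ext a
    simp [Matrix.mulVec, dotProduct, hL, mul_comm]
  have hinj : Function.Injective L.mulVec := by
    intro u v huv
    rw [hmul, hmul] at huv
    exact e.symm.injective (hB (e.injective huv))
  exact ⟨L⁻¹, Matrix.nonsing_inv_mul _
    ((Matrix.isUnit_iff_isUnit_det L).mp (Matrix.mulVec_injective_iff_isUnit.mp hinj))⟩

theorem eval_jetPoly_eq {n k : ℕ} {E : Type*} [NormedAddCommGroup E] [NormedSpace ℂ E]
    (e : E ≃L[ℂ] (Fin n → ℂ)) (x y z : E)
    (B : (j : ℕ) → ContinuousMultilinearMap ℂ (fun _ : Fin j => E) E) :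
    (fun a => MvPolynomial.eval (e z) (jetPoly k (e x) (e y)
      (fun j α => e (B j fun l => e.symm (Pi.single (α l) 1))) a))
      = e (y + ∑ j ∈ Finset.Icc 1 k, (j.factorial : ℂ)⁻¹ • B j fun _ => z - x) := by
  ext a
  simp only [jetPoly, map_add, map_sum, map_smul, map_prod, map_sub, MvPolynomial.eval_C,
    MvPolynomial.eval_X, MvPolynomial.smul_eval, Pi.add_apply, Finset.sum_apply, Pi.smul_apply,
    smul_eq_mul]
  congr 1
  refine Finset.sum_congr rfl fun j _ => ?_
  rw [(B j).apply_const_eq_sum e (z - x), map_sum, Finset.sum_apply, Finset.mul_sum]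
  refine Finset.sum_congr rfl fun α _ => ?_
  simp only [map_smul, map_sub, Pi.smul_apply, Pi.sub_apply, smul_eq_mul]
  ring

theorem exists_norm_conj_sub_le {n K : ℕ} {E : Type*} [NormedAddCommGroup E] [NormedSpace ℂ E]
    (e : E ≃L[ℂ] (Fin n → ℂ)) {f : (Fin n → ℂ) → Fin n → ℂ} {T : E → E} {x : E} {C : ℝ}
    (h : ∀ z ∈ closedBall (e x) 1, ‖f z - e (T (e.symm z))‖ ≤ C * ‖z - e x‖ ^ K) :
    ∃ C' r, 0 < r ∧ ∀ z ∈ closedBall x r, ‖e.symm (f (e z)) - T z‖ ≤ C' * ‖z - x‖ ^ K := by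
  set a := ‖(e : E →L[ℂ] (Fin n → ℂ))‖ with ha
  set b := ‖(e.symm : (Fin n → ℂ) →L[ℂ] E)‖ with hb
  have hle : ∀ z, ‖e z - e x‖ ≤ a * ‖z - x‖ := by
    intro z
    rw [← map_sub]
    exact (e : E →L[ℂ] (Fin n → ℂ)).le_opNorm _
  have ha0 : 0 ≤ a := norm_nonneg _
  refine ⟨b * (|C| * a ^ K), (a + 1)⁻¹, by positivity, fun z hz => ?_⟩
  rw [mem_closedBall, dist_eq_norm] at hz
  have hz1 : e z ∈ closedBall (e x) 1 := by
    rw [mem_closedBall, dist_eq_norm]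
    refine (hle z).trans ((mul_le_mul_of_nonneg_left hz ha0).trans ?_)
    rw [← div_eq_mul_inv, div_le_one (by positivity)]
    linarith
  have h1 := h _ hz1
  rw [e.symm_apply_apply] at h1
  have h2 : e.symm (f (e z)) - T z = e.symm (f (e z) - e (T z)) := by simp
  rw [h2, mul_assoc]
  refine ((e.symm : (Fin n → ℂ) →L[ℂ] E).le_opNorm _).trans
    (mul_le_mul_of_nonneg_left (h1.trans ?_) (norm_nonneg _))
  rw [mul_assoc, ← mul_pow]
  exact mul_le_mul (le_abs_self C) (pow_le_pow_left₀ (norm_nonneg _) (hle z) K) (by positivity)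
    (abs_nonneg C)

/-- Parametric jet interpolation for `X = ℂⁿ` (n ≥ 2) with parameter space
`W = ℂ^m`. Given distinct points `xhᵢ`, holomorphic families of nondegenerate `k`-jets
(encoded by images `yᵢ(w)` with pairwise distinct values and symmetric multilinear
derivatives `A i j w` with invertible linear part), there is a holomorphic family of
holomorphic automorphisms of `ℂⁿ` interpolating the prescribed jets. -/
theorem parametric_jet_interpolation_Cm
    (m n k N : ℕ) (hm : 1 ≤ m) (hn : 2 ≤ n) (hk : 1 ≤ k) (hN : 1 ≤ N)
    (xh : Fin N → EuclideanSpace ℂ (Fin n)) (hxh : Function.Injective xh)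
    (y : Fin N → EuclideanSpace ℂ (Fin m) → EuclideanSpace ℂ (Fin n))
    (hy : ∀ i, Differentiable ℂ (y i))
    (hy' : ∀ i j, i ≠ j → ∀ w, y i w ≠ y j w)
    (A : Fin N → (j : ℕ) → EuclideanSpace ℂ (Fin m) →
      ContinuousMultilinearMap ℂ (fun _ : Fin j => EuclideanSpace ℂ (Fin n))
        (EuclideanSpace ℂ (Fin n)))
    (hAsymm : ∀ i (j : ℕ), 1 ≤ j → j ≤ k → ∀ w (σ : Equiv.Perm (Fin j))
      (v : Fin j → EuclideanSpace ℂ (Fin n)), A i j w (v ∘ σ) = A i j w v)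
    (hAholo : ∀ i (j : ℕ), 1 ≤ j → j ≤ k → ∀ v : Fin j → EuclideanSpace ℂ (Fin n),
      Differentiable ℂ (fun w => A i j w v))
    (hA1 : ∀ i w, Function.Bijective
      (fun v : EuclideanSpace ℂ (Fin n) => A i 1 w (fun _ => v))) :
    ∃ F : EuclideanSpace ℂ (Fin m) × EuclideanSpace ℂ (Fin n) → EuclideanSpace ℂ (Fin n),
      Differentiable ℂ F ∧
      (∀ w, ∃ G : EuclideanSpace ℂ (Fin n) → EuclideanSpace ℂ (Fin n),
        Differentiable ℂ G ∧ (∀ z, G (F (w, z)) = z) ∧ (∀ z, F (w, G z) = z)) ∧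
      (∀ i w, F (w, xh i) = y i w) ∧
      (∀ i (j : ℕ), 1 ≤ j → j ≤ k → ∀ w,
        iteratedFDeriv ℂ j (fun z => F (w, z)) (xh i) = A i j w) := by
  let e : EuclideanSpace ℂ (Fin n) ≃L[ℂ] (Fin n → ℂ) := EuclideanSpace.equiv (Fin n) ℂ
  let d : EuclideanSpace ℂ (Fin m) ≃L[ℂ] (Fin m → ℂ) := EuclideanSpace.equiv (Fin m) ℂ
  obtain ⟨Ξ, Ξ', hΞ, hΞ', hinv, hinv', hjet⟩ := exists_automorphisms_of_jets hn hk
    (x := fun i => e (xh i)) (e.injective.comp hxh) (y := fun i w => e (y i (d.symm w)))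
    (fun i => e.differentiable.comp ((hy i).comp d.symm.differentiable))
    (fun i j hij w => e.injective.ne (hy' i j hij _))
    (c := fun i j α w => e (A i j (d.symm w) fun l => e.symm (Pi.single (α l) 1)))
    (fun i j hj hjk α => e.differentiable.comp ((hAholo i j hj hjk _).comp d.symm.differentiable))
    (fun i w => exists_matrix_mul_eq_one e (A i 1 (d.symm w)) (hA1 i _).injective)
  have hF : Differentiable ℂ fun q : EuclideanSpace ℂ (Fin m) × EuclideanSpace ℂ (Fin n) =>
      e.symm (Ξ' (d q.1, e q.2)) :=
    e.symm.differentiable.comp (hΞ'.comp ((d.differentiable.comp differentiable_fst).prodMk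
      (e.differentiable.comp differentiable_snd)))
  have hmain : ∀ i w, e.symm (Ξ' (d w, e (xh i))) = y i w ∧ ∀ j, 1 ≤ j → j ≤ k →
      iteratedFDeriv ℂ j (fun z => e.symm (Ξ' (d w, e z))) (xh i) = A i j w := by
    intro i w
    obtain ⟨C, hC⟩ := hjet i (d w)
    simp only [d.symm_apply_apply] at hC
    obtain ⟨C', r, hr, hC'⟩ := exists_norm_conj_sub_le e (f := fun z => Ξ' (d w, z)) (x := xh i)
      (T := fun z => y i w + ∑ j ∈ Finset.Icc 1 k, (j.factorial : ℂ)⁻¹ •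
        A i j w fun _ => z - xh i) (K := k + 1) (C := C) (by
        intro z hz
        rw [← eval_jetPoly_eq e, e.apply_symm_apply]
        exact hC z hz)
    exact iteratedFDeriv_eq_of_norm_sub_le (fun j hj hjk => hAsymm i j hj hjk w)
      (hF.comp ((differentiable_const w).prodMk differentiable_id)) hr hC'
  refine ⟨fun q => e.symm (Ξ' (d q.1, e q.2)), hF, fun w => ⟨fun z => e.symm (Ξ (d w, e z)), ?_, ?_, ?_⟩,
    fun i w => (hmain i w).1, fun i j hj hjk w => (hmain i w).2 j hj hjk⟩
  · exact e.symm.differentiable.comp (hΞ.comp ((differentiable_const _).prodMk e.differentiable))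
  · intro z
    simp [hinv']
  · intro z
    simp [hinv]
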